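/- Let D₋₂ = {d > 1 squarefree, d ≢ 1 mod 4 : every odd prime p | d satisfies (−2/p) = 1} and let D₋₂(X) = D₋₂ ∩ [1, X]. Then |D₋₂(X)| = (2C₋₂/3)·X/√(log X) + O(X/(log X)^{3/2}), where C₋₂ = (1/√π)·lim_{s→1⁺} ( √(s−1) · ∏_{p ∈ P₋₂} (1 + p^{−s}) ) and P₋₂ is the set of primes p such that p = 2 or (−2/p) = 1. -/

import Mathlib

open Filter Asymptotics

/-- The set `D₋₂` of squarefree `d > 1` with `d ≢ 1 (mod 4)` all of whose odd prime
divisors `p` satisfy `(-2/p) = 1`. -/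
def Dmtwo : Set ℕ :=
  {d : ℕ | 1 < d ∧ Squarefree d ∧ d % 4 ≠ 1 ∧
    ∀ p : ℕ, p.Prime → Odd p → p ∣ d → jacobiSym (-2) p = 1}


namespace LandauD
set_option linter.unusedSectionVars false
set_option linter.unusedTactic false
set_option linter.unusedVariables false

section LBound
open Complex MeasureTheory Finset

variable {q : ℕ} [NeZero q]

/-- Partial sums of a Dirichlet character are linear up to a bounded error. -/
lemma char_sum_bound (χ : DirichletCharacter ℂ q) :
    ∃ (c : ℂ) (B : ℝ), 0 ≤ B ∧ ∀ n : ℕ, ‖∑ k ∈ Icc 1 n, χ (k : ZMod q) - c * n‖ ≤ B := by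
  set c : ℂ := (∑ k ∈ Icc 1 q, χ (k : ZMod q)) / q with hc
  set b : ℕ → ℂ := fun n => ∑ k ∈ Icc 1 n, χ (k : ZMod q) - c * n with hb
  have hq : (q : ℂ) ≠ 0 := by exact_mod_cast NeZero.ne q
  have hstep : ∀ n, b (n + 1) = b n + χ ((n + 1 : ℕ) : ZMod q) - c := by
    intro n
    simp only [hb]
    rw [Finset.sum_Icc_succ_top (by omega)]
    push_cast; ring
  have hper : Function.Periodic b q := by
    intro n
    induction n with
    | zero =>
      simp only [hb, zero_add]
      rw [hc]; field_simp; simp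
    | succ n ih =>
      rw [show n + 1 + q = (n + q) + 1 by ring, hstep, hstep, ih]
      push_cast; simp
  refine ⟨c, ∑ i ∈ range q, ‖b i‖, by positivity, fun n => ?_⟩
  have h := hper.map_mod_nat n
  change ‖b n‖ ≤ _
  rw [← h]
  exact Finset.single_le_sum (f := fun i => ‖b i‖) (fun i _ => norm_nonneg _)
    (Finset.mem_range.2 (Nat.mod_lt _ (Nat.pos_of_ne_zero (NeZero.ne q))))

/-- The error function in the summation formula. -/
noncomputable def errF (χ : DirichletCharacter ℂ q) (c : ℂ) (N : ℕ) (u : ℝ) : ℂ :=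
  (Set.Ioi (N : ℝ)).indicator (fun u : ℝ => ∑ k ∈ Icc 1 ⌊u⌋₊, χ (k : ZMod q)
    - ∑ k ∈ Icc 1 N, χ (k : ZMod q) - c * (u - N)) u

lemma errF_bound {χ : DirichletCharacter ℂ q} {c : ℂ} {B : ℝ} (hB : 0 ≤ B)
    (h : ∀ n : ℕ, ‖∑ k ∈ Icc 1 n, χ (k : ZMod q) - c * n‖ ≤ B) (N : ℕ) (u : ℝ) :
    ‖errF χ c N u‖ ≤ 2 * B + ‖c‖ := by
  unfold errF
  by_cases hu : u ∈ Set.Ioi (N : ℝ)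
  · rw [Set.indicator_of_mem hu]
    have hu0 : 0 ≤ u := le_trans (Nat.cast_nonneg N) (le_of_lt hu)
    have h1 := h ⌊u⌋₊
    have h2 := h N
    have h3 : ‖c * ((⌊u⌋₊ : ℂ) - u)‖ ≤ ‖c‖ := by
      rw [norm_mul]
      have : ‖((⌊u⌋₊ : ℂ) - u)‖ ≤ 1 := by
        rw [show ((⌊u⌋₊ : ℂ) - u) = (((⌊u⌋₊ : ℝ) - u : ℝ) : ℂ) by push_cast; rfl, Complex.norm_real,
          Real.norm_eq_abs, abs_le]
        constructor
        · linarith [Nat.lt_floor_add_one u]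
        · linarith [Nat.floor_le hu0]
      nlinarith [norm_nonneg c]
    calc _ = ‖(∑ k ∈ Icc 1 ⌊u⌋₊, χ (k : ZMod q) - c * (⌊u⌋₊ : ℕ))
          - (∑ k ∈ Icc 1 N, χ (k : ZMod q) - c * N) + c * ((⌊u⌋₊ : ℂ) - u)‖ := by
            congr 1; push_cast; ring
      _ ≤ _ := by
        refine (norm_add_le _ _).trans ?_
        refine (add_le_add (norm_sub_le _ _) h3).trans ?_
        linarith
  · rw [Set.indicator_of_notMem hu]; simp; positivity

lemma errF_meas (χ : DirichletCharacter ℂ q) (c : ℂ) (N : ℕ) : Measurable (errF χ c N) := by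
  unfold errF
  refine Measurable.indicator ?_ measurableSet_Ioi
  refine Measurable.sub (Measurable.sub ?_ measurable_const) (by fun_prop)
  exact (measurable_from_nat (f := fun n => ∑ k ∈ Icc 1 n, χ (k : ZMod q))).comp Nat.measurable_floor

lemma errF_locInt {χ : DirichletCharacter ℂ q} {c : ℂ} {B : ℝ} (hB : 0 ≤ B)
    (h : ∀ n : ℕ, ‖∑ k ∈ Icc 1 n, χ (k : ZMod q) - c * n‖ ≤ B) (N : ℕ) :
    LocallyIntegrable (errF χ c N) := by
  refine (locallyIntegrable_const (2 * B + ‖c‖ : ℝ)).mono (errF_meas χ c N).aestronglyMeasurable ?_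
  refine Eventually.of_forall fun u => ?_
  rw [Real.norm_of_nonneg (by positivity)]
  exact errF_bound hB h N u

lemma errF_mellin_diff {χ : DirichletCharacter ℂ q} {c : ℂ} {B : ℝ} (hB : 0 ≤ B)
    (h : ∀ n : ℕ, ‖∑ k ∈ Icc 1 n, χ (k : ZMod q) - c * n‖ ≤ B) {N : ℕ} (hN : 1 ≤ N)
    {s : ℂ} (hs : 0 < s.re) : DifferentiableAt ℂ (fun s => mellin (errF χ c N) (-s)) s := by
  have : DifferentiableAt ℂ (mellin (errF χ c N)) (-s) := by
    refine mellin_differentiableAt_of_isBigO_rpow (a := 0) (b := (-s).re - 1)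
      ((errF_locInt hB h N).locallyIntegrableOn _) ?_ (by simpa using hs) ?_ (by linarith)
    · refine IsBigO.of_bound (2 * B + ‖c‖) (Eventually.of_forall fun u => ?_)
      simpa using errF_bound hB h N u
    · refine IsBigO.of_bound 0 ?_
      have : ∀ᶠ u : ℝ in nhdsWithin 0 (Set.Ioi 0), u < 1 :=
        nhdsWithin_le_nhds (eventually_lt_nhds (by norm_num))
      filter_upwards [this] with u hu
      have : errF χ c N u = 0 := by
        unfold errF
        rw [Set.indicator_of_notMem]
        have : (1:ℝ) ≤ N := by exact_mod_cast hN
        simp only [Set.mem_Ioi, not_lt]; linarith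
      simp [this]
  exact this.comp s (differentiableAt_id.neg)

lemma errF_mellin_eq (χ : DirichletCharacter ℂ q) (c : ℂ) (N : ℕ) (s : ℂ) :
    mellin (errF χ c N) (-s) = ∫ u in Set.Ioi (N:ℝ), (u : ℂ) ^ (-s - 1) • errF χ c N u := by
  unfold mellin
  refine setIntegral_eq_of_subset_of_forall_sdiff_eq_zero measurableSet_Ioi
      (Set.Ioi_subset_Ioi (Nat.cast_nonneg N)) ?_
  intro u hu
  have : errF χ c N u = 0 := by
    unfold errF; rw [Set.indicator_of_notMem hu.2]
  simp [this]

lemma errF_mellin_bound {χ : DirichletCharacter ℂ q} {c : ℂ} {B : ℝ} (hB : 0 ≤ B)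
    (h : ∀ n : ℕ, ‖∑ k ∈ Icc 1 n, χ (k : ZMod q) - c * n‖ ≤ B) {N : ℕ} (hN : 1 ≤ N)
    {s : ℂ} (hs : 0 < s.re) :
    ‖mellin (errF χ c N) (-s)‖ ≤ (2 * B + ‖c‖) * ((N : ℝ) ^ (-s.re) / s.re) := by
  have hN0 : (0:ℝ) < N := by exact_mod_cast hN
  have hintg : IntegrableOn (fun u : ℝ => (2 * B + ‖c‖) * u ^ (-s.re - 1)) (Set.Ioi (N:ℝ)) :=
    (integrableOn_Ioi_rpow_of_lt (by linarith) hN0).const_mul _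
  have e1 : mellin (errF χ c N) (-s)
      = ∫ u in Set.Ioi (N:ℝ), (u : ℂ) ^ (-s - 1) • errF χ c N u := errF_mellin_eq χ c N s
  rw [e1]
  calc _ ≤ ∫ u in Set.Ioi (N:ℝ), (2 * B + ‖c‖) * u ^ (-s.re - 1) := by
        refine norm_integral_le_of_norm_le hintg ?_
        filter_upwards [ae_restrict_mem measurableSet_Ioi] with u hu
        have hu0 : 0 < u := hN0.trans hu
        rw [norm_smul, norm_cpow_eq_rpow_re_of_pos hu0]
        simp only [sub_re, neg_re, one_re]
        rw [mul_comm]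
        gcongr
        exact errF_bound hB h N u
    _ = _ := by
        rw [integral_const_mul, integral_Ioi_rpow_of_lt (by linarith) hN0]
        congr 1
        rw [show -s.re - 1 + 1 = -s.re by ring]
        field_simp

lemma LSeries_formula {χ : DirichletCharacter ℂ q} {c : ℂ} {B : ℝ} (hB : 0 ≤ B)
    (h : ∀ n : ℕ, ‖∑ k ∈ Icc 1 n, χ (k : ZMod q) - c * n‖ ≤ B) {N : ℕ} (hN : 1 ≤ N)
    {s : ℂ} (hs : 1 < s.re) :
    DirichletCharacter.LFunction χ s = ∑ k ∈ Icc 1 N, χ (k : ZMod q) * (k : ℂ) ^ (-s)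
      + c * ((N : ℂ) ^ (1 - s) / (s - 1)) + s * mellin (errF χ c N) (-s) := by
  have hN0 : (0:ℝ) < N := by exact_mod_cast hN
  have hs0 : s ≠ 0 := by rintro rfl; simp at hs; linarith
  have hs1 : s - 1 ≠ 0 := by
    intro h0; have : s = 1 := sub_eq_zero.1 h0; subst this; simp at hs
  rw [DirichletCharacter.LFunction_eq_LSeries χ hs]
  set f1 : ℕ → ℂ := fun n => if n ≤ N then χ (n : ZMod q) else 0 with hf1
  set f2 : ℕ → ℂ := fun n => if n ≤ N then 0 else χ (n : ZMod q) with hf2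
  have hsplit : (fun n : ℕ => χ (n : ZMod q)) = f1 + f2 := by
    funext n; simp only [hf1, hf2, Pi.add_apply]; split_ifs <;> simp
  have hf2n : ∀ n, ‖f2 n‖ ≤ 1 := by
    intro n; simp only [hf2]; split_ifs
    · simp
    · exact χ.norm_le_one _
  have hf1n : ∀ n, ‖f1 n‖ ≤ 1 := by
    intro n; simp only [hf1]; split_ifs
    · exact χ.norm_le_one _
    · simp
  have hO2 : (fun n ↦ ∑ k ∈ Icc 1 n, ‖f2 k‖) =O[atTop] fun n : ℕ ↦ (n : ℝ) ^ (1:ℝ) := by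
    refine IsBigO.of_bound 1 (Eventually.of_forall fun n => ?_)
    rw [Real.norm_of_nonneg (by positivity), Real.rpow_one, Real.norm_of_nonneg (by positivity)]
    calc _ ≤ ∑ k ∈ Icc 1 n, (1:ℝ) := Finset.sum_le_sum fun k _ => hf2n k
      _ = _ := by simp
  rw [hsplit, LSeries_add (LSeriesSummable_of_bounded_of_one_lt_re (m := 1) (fun n _ => hf1n n) hs)
    (LSeriesSummable_of_bounded_of_one_lt_re (m := 1) (fun n _ => hf2n n) hs)]
  have e1 : LSeries f1 s = ∑ k ∈ Icc 1 N, χ (k : ZMod q) * (k : ℂ) ^ (-s) := by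
    unfold LSeries
    rw [tsum_eq_sum (s := Icc 1 N)]
    · refine Finset.sum_congr rfl fun k hk => ?_
      rw [Finset.mem_Icc] at hk
      rw [LSeries.term_of_ne_zero (by omega)]
      simp only [hf1, if_pos hk.2]
      rw [cpow_neg, div_eq_mul_inv]
    · intro k hk
      rcases Nat.eq_zero_or_pos k with rfl | hk0
      · simp
      · rw [LSeries.term_of_ne_zero (by omega)]
        have : ¬ k ≤ N := fun hh => hk (Finset.mem_Icc.2 ⟨hk0, hh⟩)
        simp [hf1, this]
  have e2 : LSeries f2 s = s * ∫ u in Set.Ioi (N:ℝ),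
      (c * ((u : ℂ) ^ (-s) - N * (u : ℂ) ^ (-s - 1)) + (u : ℂ) ^ (-s - 1) • errF χ c N u) := by
    rw [LSeries_eq_mul_integral' f2 zero_le_one hs hO2]
    congr 1
    rw [setIntegral_eq_of_subset_of_forall_sdiff_eq_zero (s := Set.Ioi (N:ℝ)) measurableSet_Ioi
      (Set.Ioi_subset_Ioi (show (1:ℝ) ≤ N by exact_mod_cast hN))]
    · refine setIntegral_congr_fun measurableSet_Ioi fun u hu => ?_
      have hu0 : 0 < u := hN0.trans hu
      have hNu : N ≤ ⌊u⌋₊ := Nat.le_floor (le_of_lt hu)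
      have hsum : ∑ k ∈ Icc 1 ⌊u⌋₊, f2 k
          = ∑ k ∈ Icc 1 ⌊u⌋₊, χ (k : ZMod q) - ∑ k ∈ Icc 1 N, χ (k : ZMod q) := by
        have : ∀ k, f2 k = χ (k : ZMod q) - f1 k := fun k => by
          have := congrFun hsplit k
          simp only [Pi.add_apply] at this
          rw [this]; ring
        simp_rw [this]
        rw [Finset.sum_sub_distrib]
        congr 1
        simp only [hf1]
        rw [← Finset.sum_filter]
        congr 1
        ext k; simp only [Finset.mem_filter, Finset.mem_Icc]; omega
      simp only [hsum]
      unfold errF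
      rw [Set.indicator_of_mem hu, smul_eq_mul, show -(s+1) = -s - 1 by ring]
      have : (u : ℂ) ^ (-s) = u * (u : ℂ) ^ (-s - 1) := by
        rw [show -s = 1 + (-s - 1) by ring, cpow_add _ _ (by exact_mod_cast hu0.ne'), cpow_one]
        ring_nf
      rw [this]; ring
    · intro u hu
      have hu' : ⌊u⌋₊ ≤ N := by
        have : u ≤ N := not_lt.1 hu.2
        exact Nat.floor_le_of_le this
      rw [Finset.sum_eq_zero, zero_mul]
      intro k hk
      rw [Finset.mem_Icc] at hk
      simp only [hf2]; rw [if_pos (by omega)]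
  have i1 : IntegrableOn (fun u : ℝ => (u : ℂ) ^ (-s)) (Set.Ioi (N:ℝ)) :=
    integrableOn_Ioi_cpow_of_lt (by simpa using hs) hN0
  have i2 : IntegrableOn (fun u : ℝ => (u : ℂ) ^ (-s - 1)) (Set.Ioi (N:ℝ)) :=
    integrableOn_Ioi_cpow_of_lt (by simp; linarith) hN0
  have i3 : IntegrableOn (fun u : ℝ => (u : ℂ) ^ (-s - 1) • errF χ c N u) (Set.Ioi (N:ℝ)) := by
    simp_rw [smul_eq_mul]
    exact Integrable.mul_bdd (c := 2 * B + ‖c‖) i2 (errF_meas χ c N).aestronglyMeasurable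
      (Eventually.of_forall fun u => errF_bound hB h N u)
  have i4 : IntegrableOn (fun u : ℝ => c * ((u : ℂ) ^ (-s) - N * (u : ℂ) ^ (-s - 1)))
      (Set.Ioi (N:ℝ)) := (i1.sub (i2.const_mul _)).const_mul _
  have e3 : mellin (errF χ c N) (-s)
      = ∫ u in Set.Ioi (N:ℝ), (u : ℂ) ^ (-s - 1) • errF χ c N u := errF_mellin_eq χ c N s
  rw [e1, e2, e3, integral_add i4 i3, integral_const_mul, integral_sub i1 (i2.const_mul _),
    integral_const_mul, integral_Ioi_cpow_of_lt (by simpa using hs) hN0,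
    integral_Ioi_cpow_of_lt (by simp; linarith) hN0]
  have hNs : (N : ℂ) ^ (1 - s) = N * (N:ℂ) ^ (-s) := by
    rw [sub_eq_add_neg, cpow_add _ _ (by exact_mod_cast hN0.ne'), cpow_one]
  rw [show -s + 1 = 1 - s by ring, show -s - 1 + 1 = -s by ring]
  push_cast
  rw [hNs]
  have : 1 - s ≠ 0 := by
    intro h0; apply hs1; linear_combination -h0
  field_simp
  ring

end LBound
end LandauD

namespace LandauD
set_option linter.unusedSectionVars false
set_option linter.unusedTactic false
set_option linter.unusedVariables false

section LBoundTwo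
open Complex MeasureTheory Finset

variable {q : ℕ} [NeZero q]

/-- The region where growth of L-functions is studied. -/
def Sreg : Set ℂ := {s : ℂ | 1 < s.re ∧ s.re ≤ 2 ∧ 1 ≤ |s.im|}

/-- The comparison function `|t|^{1/100}`. -/
noncomputable def gfun (s : ℂ) : ℝ := |s.im| ^ ((1 : ℝ) / 100)

/-- Local continuation of the L-function. -/
noncomputable def Rfun (χ : DirichletCharacter ℂ q) (c : ℂ) (N : ℕ) (z : ℂ) : ℂ :=
  ∑ k ∈ Icc 1 N, χ (k : ZMod q) * (k : ℂ) ^ (-z) + c * ((N : ℂ) ^ (1 - z) / (z - 1)) +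
    z * mellin (errF χ c N) (-z)

lemma Rfun_diff {χ : DirichletCharacter ℂ q} {c : ℂ} {B : ℝ} (hB : 0 ≤ B)
    (h : ∀ n : ℕ, ‖∑ k ∈ Icc 1 n, χ (k : ZMod q) - c * n‖ ≤ B) {N : ℕ} (hN : 1 ≤ N) {z : ℂ}
    (hz : 0 < z.re) (hz1 : z ≠ 1) : DifferentiableAt ℂ (Rfun χ c N) z := by
  unfold Rfun
  have hN0 : (N : ℂ) ≠ 0 := by exact_mod_cast (by omega : N ≠ 0)
  refine DifferentiableAt.add (DifferentiableAt.add ?_ ?_) ?_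
  · refine DifferentiableAt.fun_sum fun k hk => ?_
    have hk0 : (k : ℂ) ≠ 0 := by
      have := (Finset.mem_Icc.mp hk).1
      exact_mod_cast (by omega : k ≠ 0)
    refine DifferentiableAt.const_mul ?_ _
    exact DifferentiableAt.const_cpow (by fun_prop) (Or.inl hk0)
  · refine DifferentiableAt.const_mul ?_ _
    refine DifferentiableAt.div ?_ (by fun_prop) (sub_ne_zero.mpr hz1)
    exact DifferentiableAt.const_cpow (by fun_prop) (Or.inl hN0)
  · exact differentiableAt_id.mul (errF_mellin_diff hB h hN hz)

lemma Rfun_bound {χ : DirichletCharacter ℂ q} {c : ℂ} {B : ℝ} (hB : 0 ≤ B)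
    (h : ∀ n : ℕ, ‖∑ k ∈ Icc 1 n, χ (k : ZMod q) - c * n‖ ≤ B) {N : ℕ} (hN : 1 ≤ N) {z : ℂ}
    (hz : 199 / 200 ≤ z.re) (hz1 : 1 / 2 ≤ ‖z - 1‖) (hz2 : ‖z‖ ≤ 4 * N) :
    ‖Rfun χ c N z‖ ≤ (201 + 2 * ‖c‖ + 8 * (2 * B + ‖c‖)) * (N : ℝ) ^ ((1 : ℝ) / 100) := by
  have hN1 : (1 : ℝ) ≤ N := by exact_mod_cast hN
  have hN0 : (0 : ℝ) < N := by linarith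
  have hcpow : ∀ (k : ℕ) (w : ℂ), 1 ≤ k → ‖(k : ℂ) ^ w‖ = (k : ℝ) ^ w.re := by
    intro k w hk
    exact Complex.norm_natCast_cpow_of_pos (by omega) w
  have hp1 : (N : ℝ) ^ ((1 : ℝ) / 200) ≤ (N : ℝ) ^ ((1 : ℝ) / 100) :=
    Real.rpow_le_rpow_of_exponent_le hN1 (by norm_num)
  have hp2 : (N : ℝ) ^ ((1 : ℝ) / 200) * (N : ℝ) ^ ((1 : ℝ) / 200) = (N : ℝ) ^ ((1 : ℝ) / 100) := by
    rw [← Real.rpow_add hN0]; norm_num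
  have hp0 : 0 < (N : ℝ) ^ ((1 : ℝ) / 200) := by positivity
  have h1 : ‖∑ k ∈ Icc 1 N, χ (k : ZMod q) * (k : ℂ) ^ (-z)‖ ≤ 201 * (N : ℝ) ^ ((1 : ℝ) / 100) := by
    calc ‖∑ k ∈ Icc 1 N, χ (k : ZMod q) * (k : ℂ) ^ (-z)‖
        ≤ ∑ k ∈ Icc 1 N, (k : ℝ)⁻¹ * (N : ℝ) ^ ((1 : ℝ) / 200) := by
          refine norm_sum_le_of_le _ fun k hk => ?_
          have hk1 := (Finset.mem_Icc.mp hk).1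
          have hkN := (Finset.mem_Icc.mp hk).2
          have hk1' : (1 : ℝ) ≤ k := by exact_mod_cast hk1
          have hk0' : (0 : ℝ) < k := by linarith
          rw [norm_mul, hcpow k _ hk1]
          calc ‖χ (k : ZMod q)‖ * (k : ℝ) ^ (-z).re ≤ 1 * (k : ℝ) ^ (-1 + (1 : ℝ) / 200) := by
                gcongr
                · exact DirichletCharacter.norm_le_one χ _
                · simp; linarith
            _ = (k : ℝ)⁻¹ * (k : ℝ) ^ ((1 : ℝ) / 200) := by
                rw [Real.rpow_add hk0', Real.rpow_neg_one, one_mul]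
            _ ≤ _ := by gcongr
      _ = (∑ k ∈ Icc 1 N, (k : ℝ)⁻¹) * (N : ℝ) ^ ((1 : ℝ) / 200) := by rw [Finset.sum_mul]
      _ ≤ (1 + Real.log N) * (N : ℝ) ^ ((1 : ℝ) / 200) := by
          gcongr
          have := harmonic_le_one_add_log N
          rw [harmonic_eq_sum_Icc] at this
          push_cast at this
          exact this
      _ ≤ ((N : ℝ) ^ ((1 : ℝ) / 200) + 200 * (N : ℝ) ^ ((1 : ℝ) / 200)) * (N : ℝ) ^ ((1 : ℝ) / 200) := by
          gcongr
          · exact Real.one_le_rpow hN1 (by norm_num)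
          · have := Real.log_le_rpow_div hN0.le (show (0 : ℝ) < 1 / 200 by norm_num)
            linarith [this, show (N : ℝ) ^ ((1 : ℝ) / 200) / (1 / 200) = 200 * (N : ℝ) ^ ((1 : ℝ) / 200) by ring]
      _ = 201 * (N : ℝ) ^ ((1 : ℝ) / 100) := by rw [← hp2]; ring
  have h2 : ‖c * ((N : ℂ) ^ (1 - z) / (z - 1))‖ ≤ 2 * ‖c‖ * (N : ℝ) ^ ((1 : ℝ) / 100) := by
    rw [norm_mul, norm_div, hcpow N _ hN]
    have : (N : ℝ) ^ (1 - z).re / ‖z - 1‖ ≤ (N : ℝ) ^ ((1 : ℝ) / 100) / (1 / 2) := by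
      gcongr
      · simp; linarith
    calc _ ≤ ‖c‖ * ((N : ℝ) ^ ((1 : ℝ) / 100) / (1 / 2)) := by gcongr
      _ = _ := by ring
  have h3 : ‖z * mellin (errF χ c N) (-z)‖ ≤ 8 * (2 * B + ‖c‖) * (N : ℝ) ^ ((1 : ℝ) / 100) := by
    rw [norm_mul]
    have := errF_mellin_bound hB h hN (s := z) (by linarith)
    have h4 : (N : ℝ) ^ (-z.re) / z.re ≤ ((N : ℝ)⁻¹ * (N : ℝ) ^ ((1 : ℝ) / 100)) / (1 / 2) := by
      rw [← Real.rpow_neg_one, ← Real.rpow_add hN0]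
      gcongr
      · linarith
      · linarith
    calc ‖z‖ * ‖mellin (errF χ c N) (-z)‖
        ≤ (4 * N) * ((2 * B + ‖c‖) * (((N : ℝ)⁻¹ * (N : ℝ) ^ ((1 : ℝ) / 100)) / (1 / 2))) := by
          gcongr
          exact this.trans (by gcongr)
      _ = _ := by field_simp; ring
  calc ‖Rfun χ c N z‖ ≤ _ := norm_add₃_le
    _ ≤ _ := by linarith

lemma LFunction_iter_bigO (χ : DirichletCharacter ℂ q) (k : ℕ) :
    (fun s => iteratedDeriv k (DirichletCharacter.LFunction χ) s) =O[𝓟 Sreg] gfun := by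
  obtain ⟨c, B, hB, h⟩ := char_sum_bound χ
  rw [isBigO_principal]
  refine ⟨(k.factorial : ℝ) * ((201 + 2 * ‖c‖ + 8 * (2 * B + ‖c‖)) * 2) / (1 / 200) ^ k, ?_⟩
  rintro s ⟨hs1, hs2, hs3⟩
  set N := ⌈|s.im|⌉₊ with hNdef
  have hNge : |s.im| ≤ N := Nat.le_ceil _
  have hN1' : (1 : ℝ) ≤ N := hs3.trans hNge
  have hN1 : 1 ≤ N := by exact_mod_cast hN1'
  have hNle : (N : ℝ) ≤ 2 * |s.im| := by
    have := Nat.ceil_lt_add_one (abs_nonneg s.im)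
    linarith
  have hev : DirichletCharacter.LFunction χ =ᶠ[nhds s] Rfun χ c N := by
    have : {z : ℂ | 1 < z.re} ∈ nhds s :=
      (isOpen_lt continuous_const Complex.continuous_re).mem_nhds hs1
    filter_upwards [this] with z hz
    exact LSeries_formula hB h hN1 hz
  rw [hev.iteratedDeriv_eq]
  have key : ∀ z ∈ Metric.closedBall s (1 / 200), 199 / 200 ≤ z.re ∧ 1 / 2 ≤ ‖z - 1‖ ∧ ‖z‖ ≤ 4 * N := by
    intro z hz
    rw [mem_closedBall_iff_norm] at hz
    have hre := (Complex.abs_re_le_norm (z - s)).trans hz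
    have him := (Complex.abs_im_le_norm (z - s)).trans hz
    simp only [sub_re, sub_im] at hre him
    rw [abs_le] at hre him
    refine ⟨by linarith [hre.1], ?_, ?_⟩
    · have h1 := Complex.abs_im_le_norm (z - 1)
      simp only [sub_im, one_im, sub_zero] at h1
      have : |s.im| ≤ |z.im| + 1 / 200 := by
        have := abs_sub_abs_le_abs_sub s.im z.im
        have h2 : |s.im - z.im| ≤ 1 / 200 := by rw [abs_le]; constructor <;> linarith [him.1, him.2]
        linarith
      linarith
    · have h1 : ‖z‖ ≤ ‖s‖ + 1 / 200 := by
        have := norm_le_norm_add_norm_sub s z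
        linarith [norm_sub_rev s z]
      have h2 := Complex.norm_le_abs_re_add_abs_im s
      rw [abs_of_pos (by linarith : 0 < s.re)] at h2
      linarith
  have hd : DiffContOnCl ℂ (Rfun χ c N) (Metric.ball s (1 / 200)) := by
    refine DifferentiableOn.diffContOnCl fun z hz => ?_
    have hz' : z ∈ Metric.closedBall s (1 / 200) := Metric.closure_ball_subset_closedBall hz
    obtain ⟨a1, a2, a3⟩ := key z hz'
    refine (Rfun_diff hB h hN1 (by linarith) ?_).differentiableWithinAt
    rintro rfl
    norm_num at a2
  have hb := Complex.norm_iteratedDeriv_le_of_forall_mem_sphere_norm_le (n := k)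
    (C := (201 + 2 * ‖c‖ + 8 * (2 * B + ‖c‖)) * (N : ℝ) ^ ((1 : ℝ) / 100))
    (show (0 : ℝ) < 1 / 200 by norm_num) hd (fun z hz => by
      obtain ⟨a1, a2, a3⟩ := key z (Metric.sphere_subset_closedBall hz)
      exact Rfun_bound hB h hN1 a1 a2 a3)
  refine hb.trans ?_
  have hg : (N : ℝ) ^ ((1 : ℝ) / 100) ≤ 2 * gfun s := by
    calc (N : ℝ) ^ ((1 : ℝ) / 100) ≤ (2 * |s.im|) ^ ((1 : ℝ) / 100) := by gcongr
      _ = 2 ^ ((1 : ℝ) / 100) * gfun s := by rw [Real.mul_rpow (by norm_num) (abs_nonneg _)]; rfl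
      _ ≤ 2 * gfun s := by
        have : (2 : ℝ) ^ ((1 : ℝ) / 100) ≤ 2 := by
          calc (2 : ℝ) ^ ((1 : ℝ) / 100) ≤ 2 ^ (1 : ℝ) :=
                Real.rpow_le_rpow_of_exponent_le (by norm_num) (by norm_num)
            _ = 2 := by norm_num
        have h0 : 0 ≤ gfun s := by unfold gfun; positivity
        gcongr
  have h0 : 0 ≤ gfun s := by unfold gfun; positivity
  rw [Real.norm_of_nonneg h0]
  calc _ ≤ (k.factorial : ℝ) * ((201 + 2 * ‖c‖ + 8 * (2 * B + ‖c‖)) * (2 * gfun s)) / (1 / 200) ^ k := by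
        gcongr
    _ = _ := by ring

end LBoundTwo
end LandauD

namespace LandauD
set_option linter.unusedSectionVars false
set_option linter.unusedTactic false
set_option linter.unusedVariables false

section LBoundThree
open Complex MeasureTheory Finset DirichletCharacter

variable {q : ℕ} [NeZero q]

lemma one_le_gfun {s : ℂ} (hs : s ∈ Sreg) : 1 ≤ gfun s :=
  Real.one_le_rpow hs.2.2 (by norm_num)

lemma LTriv_bound : ∃ C : ℝ, 1 ≤ C ∧ ∀ x : ℝ, 0 < x → x ≤ 1 →
    ‖LFunctionTrivChar q (1 + x)‖ ≤ C / x := by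
  have hc : Continuous fun x : ℝ => LFunctionTrivChar₁ q (1 + x) :=
    (differentiable_LFunctionTrivChar₁ q).continuous.comp (by fun_prop)
  obtain ⟨C, hC⟩ := (isCompact_Icc (a := (0 : ℝ)) (b := 1)).exists_bound_of_continuousOn hc.continuousOn
  refine ⟨max C 1, le_max_right _ _, fun x hx hx1 => ?_⟩
  have h1 := hC x ⟨hx.le, hx1⟩
  have hne : (1 : ℂ) + x ≠ 1 := by
    simpa using hx.ne'
  rw [LFunctionTrivChar₁, Function.update_of_ne hne] at h1
  rw [norm_mul, add_sub_cancel_left, Complex.norm_real, Real.norm_of_nonneg hx.le] at h1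
  rw [le_div_iff₀ hx]
  calc _ = x * ‖LFunctionTrivChar q (1 + x)‖ := by ring
    _ ≤ C := h1
    _ ≤ _ := le_max_left _ _

lemma LFunction_fourth (χ : DirichletCharacter ℂ q) : ∃ M : ℝ, 1 ≤ M ∧ ∀ s ∈ Sreg,
    (s.re - 1) ^ 3 ≤ M * gfun s * ‖LFunction χ s‖ ^ 4 := by
  obtain ⟨C1, hC1, h1⟩ := LTriv_bound (q := q)
  obtain ⟨C2, h2⟩ := isBigO_principal.mp (LFunction_iter_bigO (χ ^ 2) 0)
  refine ⟨max (C1 ^ 3 * (2 * |C2|)) 1, le_max_right _ _, fun s hs => ?_⟩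
  have hg1 := one_le_gfun hs
  set x := s.re - 1 with hx
  have hx0 : 0 < x := by have := hs.1; simp only [hx]; linarith
  have hx1 : x ≤ 1 := by have := hs.2.1; simp only [hx]; linarith
  have hse : (1 : ℂ) + x + I * s.im = s := by
    apply Complex.ext <;> simp [hx]
  have hp := norm_LFunction_product_ge_one (N := q) χ hx0 s.im
  rw [hse, norm_mul, norm_mul, norm_pow, norm_pow] at hp
  have hs2 : (1 : ℂ) + x + 2 * I * s.im ∈ Sreg := by
    refine ⟨by simpa using hx0, by simp; linarith, ?_⟩
    simp [abs_mul]
    linarith [hs.2.2]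
  have h3 := h2 _ hs2
  rw [iteratedDeriv_zero, Real.norm_of_nonneg (by linarith [one_le_gfun hs2])] at h3
  have hg2 : gfun ((1 : ℂ) + x + 2 * I * s.im) ≤ 2 * gfun s := by
    unfold gfun
    have : |((1 : ℂ) + x + 2 * I * s.im).im| = 2 * |s.im| := by simp [abs_mul]
    rw [this, Real.mul_rpow (by norm_num) (abs_nonneg _)]
    gcongr
    calc (2 : ℝ) ^ ((1 : ℝ) / 100) ≤ 2 ^ (1 : ℝ) :=
          Real.rpow_le_rpow_of_exponent_le (by norm_num) (by norm_num)
      _ = 2 := by norm_num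
  have h4 : ‖LFunction (χ ^ 2) (1 + x + 2 * I * s.im)‖ ≤ 2 * |C2| * gfun s := by
    calc _ ≤ C2 * gfun ((1 : ℂ) + x + 2 * I * s.im) := h3
      _ ≤ |C2| * (2 * gfun s) := by
        gcongr
        · linarith [one_le_gfun hs2]
        · exact le_abs_self _
      _ = _ := by ring
  have h5 := h1 x hx0 hx1
  have h6 : 1 ≤ (C1 / x) ^ 3 * ‖LFunction χ s‖ ^ 4 * (2 * |C2| * gfun s) := by
    refine le_trans hp ?_
    gcongr
  calc x ^ 3 ≤ x ^ 3 * ((C1 / x) ^ 3 * ‖LFunction χ s‖ ^ 4 * (2 * |C2| * gfun s)) :=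
        le_mul_of_one_le_right (by positivity) h6
    _ = (C1 ^ 3 * (2 * |C2|)) * gfun s * ‖LFunction χ s‖ ^ 4 := by field_simp
    _ ≤ _ := by gcongr; exact le_max_left _ _

lemma LFunction_diff_Sreg (χ : DirichletCharacter ℂ q) {s : ℂ} (hs : 1 < s.re) :
    DifferentiableAt ℂ (LFunction χ) s := by
  refine differentiableAt_LFunction χ s (.inl ?_)
  rintro rfl
  simp at hs

lemma LFunction_inv_bigO (χ : DirichletCharacter ℂ q) :
    (fun s => (LFunction χ s)⁻¹) =O[𝓟 Sreg] fun s => gfun s ^ 4 := by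
  obtain ⟨M, hM, h1⟩ := LFunction_fourth χ
  obtain ⟨C3', h2'⟩ := isBigO_principal.mp (LFunction_iter_bigO χ 1)
  obtain ⟨C3, hC3, h2⟩ : ∃ C3 : ℝ, 1 ≤ C3 ∧ ∀ s ∈ Sreg, ‖deriv (LFunction χ) s‖ ≤ C3 * gfun s := by
    refine ⟨max C3' 1, le_max_right _ _, fun s hs => ?_⟩
    have := h2' s hs
    rw [iteratedDeriv_one, Real.norm_of_nonneg (by linarith [one_le_gfun hs])] at this
    refine this.trans ?_
    have := one_le_gfun hs
    gcongr
    exact le_max_left _ _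
  set η : ℝ := 1 / (16 * C3 ^ 4 * M) with hη
  have hη0 : 0 < η := by positivity
  have hη1 : η ≤ 1 := by
    rw [hη, div_le_one (by positivity)]
    have : 1 ≤ C3 ^ 4 := one_le_pow₀ hC3
    nlinarith
  have hηeq : η ^ 3 = M * (2 * C3 * η) ^ 4 := by rw [hη]; field_simp; ring
  -- lower bound away from the line
  have hA : ∀ s ∈ Sreg, η / gfun s ^ 5 ≤ s.re - 1 → 2 * C3 * η / gfun s ^ 4 ≤ ‖LFunction χ s‖ := by
    intro s hs hx
    have hg := one_le_gfun hs
    have hg0 : 0 < gfun s := by linarith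
    have := h1 s hs
    have h3 : (η / gfun s ^ 5) ^ 3 ≤ M * gfun s * ‖LFunction χ s‖ ^ 4 :=
      le_trans (by gcongr) this
    have h4 : (2 * C3 * η / gfun s ^ 4) ^ 4 ≤ ‖LFunction χ s‖ ^ 4 := by
      have : (η / gfun s ^ 5) ^ 3 = M * gfun s * (2 * C3 * η / gfun s ^ 4) ^ 4 := by
        rw [div_pow, hηeq, div_pow]; field_simp
      rw [this] at h3
      exact le_of_mul_le_mul_left h3 (by positivity)
    exact le_of_pow_le_pow_left₀ (by norm_num) (norm_nonneg _) h4
  have hB : ∀ s ∈ Sreg, C3 * η / gfun s ^ 4 ≤ ‖LFunction χ s‖ := by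
    intro s hs
    have hg := one_le_gfun hs
    have hg0 : 0 < gfun s := by linarith
    rcases le_or_gt (η / gfun s ^ 5) (s.re - 1) with hx | hx
    · refine le_trans ?_ (hA s hs hx)
      gcongr
      nlinarith
    · set s0 : ℂ := ((1 + η / gfun s ^ 5 : ℝ) : ℂ) + I * s.im with hs0
      have him : s0.im = s.im := by
        rw [hs0]; simp only [Complex.add_im, Complex.ofReal_re, Complex.mul_im, Complex.I_re, Complex.I_im, Complex.ofReal_im]; ring
      have hre : s0.re = 1 + η / gfun s ^ 5 := by
        rw [hs0]; simp only [Complex.add_re, Complex.ofReal_re, Complex.mul_re, Complex.I_re, Complex.I_im, Complex.ofReal_im]; ring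
      have hgs : gfun s0 = gfun s := by unfold gfun; rw [him]
      have hpos : 0 < η / gfun s ^ 5 := by positivity
      have hle : η / gfun s ^ 5 ≤ 1 := by
        rw [div_le_one (by positivity)]
        exact hη1.trans (one_le_pow₀ hg)
      have hs0m : s0 ∈ Sreg := ⟨by rw [hre]; linarith, by rw [hre]; linarith, by rw [him]; exact hs.2.2⟩
      have h3 := hA s0 hs0m (by rw [hgs, hre]; linarith)
      rw [hgs] at h3
      set W : Set ℂ := ({z | 1 < z.re} ∩ {z | z.re ≤ 2}) ∩ ({z | z.im ≤ s.im} ∩ {z | s.im ≤ z.im}) with hW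
      have hWc : Convex ℝ W :=
        ((convex_halfSpace_re_gt 1).inter (convex_halfSpace_re_le 2)).inter
          ((convex_halfSpace_im_le _).inter (convex_halfSpace_im_ge _))
      have hmv := Convex.norm_image_sub_le_of_norm_deriv_le (f := LFunction χ) (C := C3 * gfun s) (s := W)
        (x := s) (y := s0)
        (fun z hz => LFunction_diff_Sreg χ hz.1.1) (fun z hz => by
          have e : z.im = s.im := le_antisymm hz.2.1 hz.2.2
          have := h2 z ⟨hz.1.1, hz.1.2, by rw [e]; exact hs.2.2⟩
          have hgz : gfun z = gfun s := by unfold gfun; rw [e]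
          rwa [hgz] at this) hWc ⟨⟨hs.1, hs.2.1⟩, le_refl s.im, le_refl s.im⟩
          ⟨⟨hs0m.1, hs0m.2.1⟩, him.le, him.ge⟩
      have hd : ‖s0 - s‖ ≤ η / gfun s ^ 5 := by
        have h5 := Complex.norm_le_abs_re_add_abs_im (s0 - s)
        simp only [Complex.sub_re, Complex.sub_im, him, hre, sub_self, abs_zero, add_zero] at h5
        refine h5.trans ?_
        rw [abs_of_pos (by linarith)]
        linarith [hs.1]
      have h6 : ‖LFunction χ s0 - LFunction χ s‖ ≤ C3 * η / gfun s ^ 4 := by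
        refine hmv.trans ?_
        calc _ ≤ C3 * gfun s * (η / gfun s ^ 5) := by gcongr
          _ = _ := by field_simp
      have h7 := norm_sub_norm_le (LFunction χ s0) (LFunction χ s)
      have : 2 * C3 * η / gfun s ^ 4 = C3 * η / gfun s ^ 4 + C3 * η / gfun s ^ 4 := by ring
      linarith
  rw [isBigO_principal]
  refine ⟨1 / (C3 * η), fun s hs => ?_⟩
  have hg0 : 0 < gfun s := by linarith [one_le_gfun hs]
  rw [norm_inv, Real.norm_of_nonneg (by positivity)]
  have := hB s hs
  calc ‖LFunction χ s‖⁻¹ ≤ (C3 * η / gfun s ^ 4)⁻¹ := by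
        gcongr
    _ = _ := by field_simp

end LBoundThree
end LandauD

namespace LandauD
set_option linter.unusedSectionVars false
set_option linter.unusedTactic false
set_option linter.unusedVariables false

section AuxBound
open Complex MeasureTheory Finset DirichletCharacter ArithmeticFunction.vonMangoldt

variable {q : ℕ} [NeZero q]

/-- The open half plane `re s > 1`. -/
def Hreg : Set ℂ := {s : ℂ | 1 < s.re}

lemma Hreg_open : IsOpen Hreg := isOpen_lt continuous_const Complex.continuous_re

lemma Sreg_sub_Hreg {s : ℂ} (hs : s ∈ Sreg) : s ∈ Hreg := hs.1

lemma gfun_pow_bigO {m n : ℕ} (h : m ≤ n) :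
    (fun s => gfun s ^ m) =O[𝓟 Sreg] fun s => gfun s ^ n := by
  rw [isBigO_principal]
  refine ⟨1, fun s hs => ?_⟩
  have := one_le_gfun hs
  rw [Real.norm_of_nonneg (by positivity), Real.norm_of_nonneg (by positivity), one_mul]
  exact pow_le_pow_right₀ this h

/-- Logarithmic derivative. -/
noncomputable def Pfun (χ : DirichletCharacter ℂ q) (s : ℂ) : ℂ :=
  deriv (LFunction χ) s / LFunction χ s

/-- First derivative of the logarithmic derivative. -/
noncomputable def Pfun1 (χ : DirichletCharacter ℂ q) (s : ℂ) : ℂ :=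
  iteratedDeriv 2 (LFunction χ) s / LFunction χ s - Pfun χ s * Pfun χ s

/-- Second derivative of the logarithmic derivative. -/
noncomputable def Pfun2 (χ : DirichletCharacter ℂ q) (s : ℂ) : ℂ :=
  iteratedDeriv 3 (LFunction χ) s / LFunction χ s -
    Pfun χ s * (iteratedDeriv 2 (LFunction χ) s / LFunction χ s) -
    2 * (Pfun χ s * Pfun1 χ s)

lemma L_iter_hasDerivAt (χ : DirichletCharacter ℂ q) (k : ℕ) {s : ℂ} (hs : s ∈ Hreg) :
    HasDerivAt (iteratedDeriv k (LFunction χ)) (iteratedDeriv (k + 1) (LFunction χ) s) s := by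
  have h0 : DifferentiableOn ℂ (LFunction χ) Hreg := fun z hz =>
    (LFunction_diff_Sreg χ hz).differentiableWithinAt
  have h1 : ∀ k, DifferentiableOn ℂ (iteratedDeriv k (LFunction χ)) Hreg := by
    intro k
    induction k with
    | zero => simpa using h0
    | succ k ih => rw [iteratedDeriv_succ]; exact ih.deriv Hreg_open
  rw [iteratedDeriv_succ]
  exact ((h1 k).differentiableAt (Hreg_open.mem_nhds hs)).hasDerivAt

lemma L_ne_zero (χ : DirichletCharacter ℂ q) {s : ℂ} (hs : s ∈ Hreg) : LFunction χ s ≠ 0 := by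
  refine LFunction_ne_zero_of_one_le_re χ (.inr ?_) (le_of_lt hs)
  rintro rfl
  simp [Hreg] at hs

lemma Pfun_hasDerivAt (χ : DirichletCharacter ℂ q) {s : ℂ} (hs : s ∈ Hreg) :
    HasDerivAt (Pfun χ) (Pfun1 χ s) s := by
  have h0 := L_iter_hasDerivAt χ 0 hs
  have h1 := L_iter_hasDerivAt χ 1 hs
  rw [iteratedDeriv_zero] at h0
  have := h1.div h0 (L_ne_zero χ hs)
  have e : (iteratedDeriv 1 (LFunction χ) / LFunction χ) = Pfun χ := by
    funext z; simp [Pfun, iteratedDeriv_one]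
  rw [e] at this
  refine this.congr_deriv ?_
  have := L_ne_zero χ hs
  simp only [Pfun1, Pfun, iteratedDeriv_one, zero_add, Nat.reduceAdd]
  field_simp

lemma Pfun1_hasDerivAt (χ : DirichletCharacter ℂ q) {s : ℂ} (hs : s ∈ Hreg) :
    HasDerivAt (Pfun1 χ) (Pfun2 χ s) s := by
  have h0 := L_iter_hasDerivAt χ 0 hs
  have h2 := L_iter_hasDerivAt χ 2 hs
  have hP := Pfun_hasDerivAt χ hs
  rw [iteratedDeriv_zero] at h0
  have := (h2.div h0 (L_ne_zero χ hs)).sub (hP.mul hP)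
  refine this.congr_deriv ?_
  have := L_ne_zero χ hs
  simp only [Pfun2, Pfun, iteratedDeriv_one, zero_add]
  field_simp
  ring

lemma Pfun_bigO (χ : DirichletCharacter ℂ q) :
    (Pfun χ =O[𝓟 Sreg] fun s => gfun s ^ 15) ∧ (Pfun1 χ =O[𝓟 Sreg] fun s => gfun s ^ 15) ∧
    (Pfun2 χ =O[𝓟 Sreg] fun s => gfun s ^ 15) := by
  have hi := LFunction_inv_bigO χ
  have hk : ∀ k, (fun s => iteratedDeriv k (LFunction χ) s / LFunction χ s) =O[𝓟 Sreg]
      fun s => gfun s ^ 5 := by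
    intro k
    refine ((LFunction_iter_bigO χ k).mul hi).congr (fun s => ?_) (fun s => ?_)
    · rw [div_eq_mul_inv]
    · ring
  have hP : Pfun χ =O[𝓟 Sreg] fun s => gfun s ^ 5 := by
    refine (hk 1).congr (fun s => ?_) (fun s => rfl)
    simp [Pfun, iteratedDeriv_one]
  have hP1 : Pfun1 χ =O[𝓟 Sreg] fun s => gfun s ^ 10 := by
    refine ((hk 2).trans (gfun_pow_bigO (by norm_num))).sub ?_
    refine (hP.mul hP).congr (fun s => rfl) (fun s => by ring)
  refine ⟨hP.trans (gfun_pow_bigO (by norm_num)), hP1.trans (gfun_pow_bigO (by norm_num)), ?_⟩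
  refine IsBigO.sub (IsBigO.sub ((hk 3).trans (gfun_pow_bigO (by norm_num))) ?_) ?_
  · refine IsBigO.trans ?_ (gfun_pow_bigO (show 10 ≤ 15 by norm_num))
    refine (hP.mul (hk 2)).congr (fun s => rfl) (fun s => by ring)
  · refine IsBigO.const_mul_left ?_ 2
    refine (hP.mul hP1).congr (fun s => rfl) (fun s => by ring)

/-- Strip `1 < re s ≤ 2`. -/
def Treg : Set ℂ := {s : ℂ | 1 < s.re ∧ s.re ≤ 2}

/-- Comparison function. -/
noncomputable def Gfun (e : ℝ) (s : ℂ) : ℝ := (1 + |s.im|) ^ e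

lemma Gfun_pos (e : ℝ) (s : ℂ) : 0 < Gfun e s := by unfold Gfun; positivity

lemma gfun_Gfun : (fun s => gfun s ^ 15) =O[𝓟 Sreg] Gfun (3 / 20) := by
  rw [isBigO_principal]
  refine ⟨1, fun s hs => ?_⟩
  have := one_le_gfun hs
  rw [Real.norm_of_nonneg (by positivity), Real.norm_of_nonneg (Gfun_pos _ _).le, one_mul]
  unfold gfun Gfun
  rw [← Real.rpow_natCast, ← Real.rpow_mul (abs_nonneg _)]
  norm_num
  gcongr
  linarith

lemma inv_sub_one_bigO (k : ℕ) : (fun s : ℂ => ((s - 1) ^ k)⁻¹) =O[𝓟 Sreg] Gfun (3 / 20) := by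
  rw [isBigO_principal]
  refine ⟨1, fun s hs => ?_⟩
  rw [Real.norm_of_nonneg (Gfun_pos _ _).le, one_mul]
  have h1 : 1 ≤ ‖s - 1‖ := by
    have := Complex.abs_im_le_norm (s - 1)
    simp at this
    linarith [hs.2.2]
  have h2 : 1 ≤ Gfun (3 / 20) s := Real.one_le_rpow (by linarith [abs_nonneg s.im]) (by norm_num)
  rw [norm_inv, norm_pow]
  exact (inv_le_one_of_one_le₀ (one_le_pow₀ h1)).trans h2

variable {a : ZMod q}

/-- Explicit form on `re s > 1`. -/
noncomputable def Afun (a : ZMod q) (p : DirichletCharacter ℂ q → ℂ → ℂ) (r : ℂ → ℂ) (s : ℂ) : ℂ :=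
  -(q.totient : ℂ)⁻¹ * ∑ χ : DirichletCharacter ℂ q, χ a⁻¹ * p χ s - (q.totient : ℂ)⁻¹ * r s

lemma Afun_hasDerivAt (a : ZMod q) {p p' : DirichletCharacter ℂ q → ℂ → ℂ} {r r' : ℂ → ℂ} {s : ℂ}
    (hp : ∀ χ, HasDerivAt (p χ) (p' χ s) s) (hr : HasDerivAt r (r' s) s) :
    HasDerivAt (Afun a p r) (Afun a p' r' s) s := by
  unfold Afun
  refine HasDerivAt.sub (HasDerivAt.const_mul _ ?_) (hr.const_mul _)
  exact HasDerivAt.fun_sum fun χ _ => (hp χ).const_mul _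

lemma Afun_bigO (a : ZMod q) {p : DirichletCharacter ℂ q → ℂ → ℂ} {r : ℂ → ℂ}
    (hp : ∀ χ, p χ =O[𝓟 Sreg] fun s => gfun s ^ 15) (hr : r =O[𝓟 Sreg] Gfun (3 / 20)) :
    Afun a p r =O[𝓟 Sreg] Gfun (3 / 20) := by
  unfold Afun
  refine IsBigO.sub (IsBigO.const_mul_left ?_ _) (hr.const_mul_left _)
  exact IsBigO.fun_sum fun χ _ => ((hp χ).trans gfun_Gfun).const_mul_left _

lemma aux_eq_Afun (ha : IsUnit a) {s : ℂ} (hs : s ∈ Hreg) :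
    LFunctionResidueClassAux a s = Afun a Pfun (fun s => ((s - 1) ^ 1)⁻¹) s := by
  rw [eqOn_LFunctionResidueClassAux ha hs]
  simp only [LSeries_residueClass_eq ha hs, Afun, Pfun]
  ring

lemma aux_deriv (ha : IsUnit a) {s : ℂ} (hs : s ∈ Hreg) :
    deriv (LFunctionResidueClassAux a) s = Afun a Pfun1 (fun s => -((s - 1) ^ 2)⁻¹) s := by
  have : LFunctionResidueClassAux a =ᶠ[nhds s] Afun a Pfun (fun s => ((s - 1) ^ 1)⁻¹) := by
    filter_upwards [Hreg_open.mem_nhds hs] with z hz using aux_eq_Afun ha hz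
  rw [this.deriv_eq]
  have h1 : s - 1 ≠ 0 := by
    intro h
    have : s = 1 := by linear_combination h
    rw [this] at hs
    simp [Hreg] at hs
  refine (Afun_hasDerivAt a (fun χ => Pfun_hasDerivAt χ hs) ?_).deriv
  have := ((((hasDerivAt_id s).sub_const 1).pow 1).inv (by simpa using h1))
  refine this.congr_deriv ?_
  simp
  field_simp

lemma aux_deriv2 (ha : IsUnit a) {s : ℂ} (hs : s ∈ Hreg) :
    deriv (deriv (LFunctionResidueClassAux a)) s = Afun a Pfun2 (fun s => 2 * ((s - 1) ^ 3)⁻¹) s := by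
  have : deriv (LFunctionResidueClassAux a) =ᶠ[nhds s] Afun a Pfun1 (fun s => -((s - 1) ^ 2)⁻¹) := by
    filter_upwards [Hreg_open.mem_nhds hs] with z hz using aux_deriv ha hz
  rw [this.deriv_eq]
  have h1 : s - 1 ≠ 0 := by
    intro h
    have : s = 1 := by linear_combination h
    rw [this] at hs
    simp [Hreg] at hs
  refine (Afun_hasDerivAt a (fun χ => Pfun1_hasDerivAt χ hs) ?_).deriv
  have := ((((hasDerivAt_id s).sub_const 1).pow 2).inv (by simpa using h1)).neg
  refine this.congr_deriv ?_
  simp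
  field_simp

/-- Region of analyticity. -/
def Ureg (q : ℕ) [NeZero q] : Set ℂ :=
  {s : ℂ | LFunctionTrivChar₁ q s ≠ 0 ∧ ∀ χ : DirichletCharacter ℂ q, χ ≠ 1 → LFunction χ s ≠ 0}

lemma Ureg_open : IsOpen (Ureg q) := by
  have : Ureg q = {s : ℂ | LFunctionTrivChar₁ q s ≠ 0} ∩
      ⋂ χ : {χ : DirichletCharacter ℂ q // χ ≠ 1}, {s : ℂ | LFunction χ.1 s ≠ 0} := by
    ext s; simp [Ureg]
  rw [this]
  refine IsOpen.inter ?_ (isOpen_iInter_of_finite fun χ => ?_)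
  · exact isOpen_ne_fun (differentiable_LFunctionTrivChar₁ q).continuous continuous_const
  · exact isOpen_ne_fun (differentiable_LFunction χ.2).continuous continuous_const

lemma mem_Ureg {s : ℂ} (hs : 1 ≤ s.re) : s ∈ Ureg q := by
  refine ⟨?_, fun χ hχ => LFunction_ne_zero_of_one_le_re χ (.inl hχ) hs⟩
  rcases eq_or_ne s 1 with rfl | h
  · exact LFunctionTrivChar₁_apply_one_ne_zero _
  · rw [LFunctionTrivChar₁, Function.update_of_ne h]
    exact mul_ne_zero (sub_ne_zero.mpr h) (LFunction_ne_zero_of_one_le_re 1 (.inr h) hs)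

lemma aux_diffOn (a : ZMod q) : DifferentiableOn ℂ (LFunctionResidueClassAux a) (Ureg q) := by
  intro s hs
  refine DifferentiableAt.differentiableWithinAt ?_
  have d1 := (differentiable_LFunctionTrivChar₁ q)
  refine DifferentiableAt.const_mul ?_ _
  refine DifferentiableAt.sub ?_ ?_
  · exact (d1.contDiff.differentiable_deriv_two s).neg.div (d1 s) hs.1
  · refine DifferentiableAt.fun_sum fun χ hχ => ?_
    have hχ' : χ ≠ 1 := by simpa using hχ
    have d2 := differentiable_LFunction hχ'
    exact ((d2.contDiff.differentiable_deriv_two s).const_mul _).div (d2 s) (hs.2 χ hχ')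

lemma bigO_strip {f : ℂ → ℂ} (hf : ContinuousOn f (Ureg q))
    (h : f =O[𝓟 Sreg] Gfun (3 / 20)) : f =O[𝓟 Treg] Gfun (3 / 20) := by
  have hcomp : IsCompact (Set.Icc (1 : ℝ) 2 ×ℂ Set.Icc (-1 : ℝ) 1) := isCompact_Icc.reProdIm isCompact_Icc
  obtain ⟨C, hC⟩ := hcomp.exists_bound_of_continuousOn (f := f) (hf.mono fun s hs => mem_Ureg (by
    have := (Complex.mem_reProdIm.mp hs).1.1
    exact this))
  obtain ⟨C', hC'⟩ := isBigO_principal.mp h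
  rw [isBigO_principal]
  refine ⟨max C C', fun s hs => ?_⟩
  rw [Real.norm_of_nonneg (Gfun_pos _ _).le]
  rcases le_total 1 |s.im| with h1 | h1
  · have := hC' s ⟨hs.1, hs.2, h1⟩
    rw [Real.norm_of_nonneg (Gfun_pos _ _).le] at this
    exact this.trans (mul_le_mul_of_nonneg_right (le_max_right _ _) (Gfun_pos _ _).le)
  · have h3 := hC s (Complex.mem_reProdIm.mpr ⟨⟨hs.1.le, hs.2⟩, abs_le.mp h1⟩)
    have h2 : 1 ≤ Gfun (3 / 20) s := Real.one_le_rpow (by linarith [abs_nonneg s.im]) (by norm_num)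
    have h4 : C ≤ max C C' := le_max_left _ _
    have h5 : 0 ≤ max C C' := le_trans ((norm_nonneg _).trans h3) h4
    nlinarith

/-- The transform whose boundary behaviour governs primes in progressions. -/
noncomputable def Kfun (a : ZMod q) (s : ℂ) : ℂ :=
  (LFunctionResidueClassAux a s - (q.totient : ℂ)⁻¹) * s⁻¹

noncomputable def Kfun1 (a : ZMod q) (s : ℂ) : ℂ :=
  deriv (LFunctionResidueClassAux a) s * s⁻¹ -
    (LFunctionResidueClassAux a s - (q.totient : ℂ)⁻¹) * (s ^ 2)⁻¹

noncomputable def Kfun2 (a : ZMod q) (s : ℂ) : ℂ :=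
  deriv (deriv (LFunctionResidueClassAux a)) s * s⁻¹ -
    2 * (deriv (LFunctionResidueClassAux a) s * (s ^ 2)⁻¹) +
    2 * ((LFunctionResidueClassAux a s - (q.totient : ℂ)⁻¹) * (s ^ 3)⁻¹)

lemma ne_zero_of_Hreg {s : ℂ} (hs : s ∈ Hreg) : s ≠ 0 := by
  rintro rfl
  simp [Hreg] at hs
  linarith

lemma Hreg_sub_Ureg {s : ℂ} (hs : s ∈ Hreg) : s ∈ Ureg q := mem_Ureg (le_of_lt hs)

lemma Kfun_hasDerivAt (a : ZMod q) {s : ℂ} (hs : s ∈ Hreg) : HasDerivAt (Kfun a) (Kfun1 a s) s := by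
  have hs0 := ne_zero_of_Hreg hs
  have h1 := ((aux_diffOn a).differentiableAt (Ureg_open.mem_nhds (Hreg_sub_Ureg hs))).hasDerivAt
  refine ((h1.sub_const _).mul (hasDerivAt_inv hs0)).congr_deriv ?_
  simp only [Kfun1]
  ring

lemma Kfun1_hasDerivAt (a : ZMod q) {s : ℂ} (hs : s ∈ Hreg) : HasDerivAt (Kfun1 a) (Kfun2 a s) s := by
  have hs0 := ne_zero_of_Hreg hs
  have h1 := ((aux_diffOn a).differentiableAt (Ureg_open.mem_nhds (Hreg_sub_Ureg hs))).hasDerivAt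
  have h2 := (((aux_diffOn a).deriv Ureg_open).differentiableAt
    (Ureg_open.mem_nhds (Hreg_sub_Ureg hs))).hasDerivAt
  have h3 := ((hasDerivAt_id s).pow 2).inv (by simpa using hs0)
  refine ((h2.mul (hasDerivAt_inv hs0)).sub ((h1.sub_const _).mul h3)).congr_deriv ?_
  simp only [Kfun2]
  simp
  field_simp
  ring

lemma inv_pow_bigO (k : ℕ) (hk : 1 ≤ k) : (fun s : ℂ => (s ^ k)⁻¹) =O[𝓟 Treg] Gfun (-1) := by
  rw [isBigO_principal]
  refine ⟨2, fun s hs => ?_⟩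
  rw [Real.norm_of_nonneg (Gfun_pos _ _).le]
  have h1 := Complex.abs_im_le_norm s
  have h2 := Complex.abs_re_le_norm s
  rw [abs_of_pos (by linarith [hs.1])] at h2
  have h3 : 1 ≤ ‖s‖ := by linarith [hs.1]
  unfold Gfun
  rw [Real.rpow_neg_one, norm_inv, norm_pow]
  calc (‖s‖ ^ k)⁻¹ ≤ (‖s‖)⁻¹ := by
        gcongr
        exact le_self_pow₀ h3 (by omega)
    _ ≤ ((1 + |s.im|) / 2)⁻¹ := by gcongr; linarith
    _ = _ := by field_simp

lemma Kfun_bigO (ha : IsUnit a) :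
    (Kfun a =O[𝓟 Treg] Gfun (-17 / 20)) ∧ (Kfun1 a =O[𝓟 Treg] Gfun (-17 / 20)) ∧
    (Kfun2 a =O[𝓟 Treg] Gfun (-17 / 20)) := by
  have d0 := aux_diffOn a
  have d1 := d0.deriv Ureg_open
  have d2 := d1.deriv Ureg_open
  have a0 : LFunctionResidueClassAux a =O[𝓟 Treg] Gfun (3 / 20) := by
    refine bigO_strip d0.continuousOn ?_
    refine (Afun_bigO a (fun χ => (Pfun_bigO χ).1) (inv_sub_one_bigO 1)).congr' ?_ EventuallyEq.rfl
    exact eventually_principal.mpr fun s hs => (aux_eq_Afun ha (Sreg_sub_Hreg hs)).symm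
  have a1 : deriv (LFunctionResidueClassAux a) =O[𝓟 Treg] Gfun (3 / 20) := by
    refine bigO_strip d1.continuousOn ?_
    refine (Afun_bigO a (fun χ => (Pfun_bigO χ).2.1) (inv_sub_one_bigO 2).neg_left).congr' ?_ EventuallyEq.rfl
    exact eventually_principal.mpr fun s hs => (aux_deriv ha (Sreg_sub_Hreg hs)).symm
  have a2 : deriv (deriv (LFunctionResidueClassAux a)) =O[𝓟 Treg] Gfun (3 / 20) := by
    refine bigO_strip d2.continuousOn ?_
    refine (Afun_bigO a (fun χ => (Pfun_bigO χ).2.2) ((inv_sub_one_bigO 3).const_mul_left 2)).congr' ?_ EventuallyEq.rfl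
    exact eventually_principal.mpr fun s hs => (aux_deriv2 ha (Sreg_sub_Hreg hs)).symm
  have hone : (fun _ : ℂ => (q.totient : ℂ)⁻¹) =O[𝓟 Treg] Gfun (3 / 20) := by
    rw [isBigO_principal]
    refine ⟨‖(q.totient : ℂ)⁻¹‖, fun s hs => ?_⟩
    rw [Real.norm_of_nonneg (Gfun_pos _ _).le]
    have h2 : 1 ≤ Gfun (3 / 20) s := Real.one_le_rpow (by linarith [abs_nonneg s.im]) (by norm_num)
    exact le_mul_of_one_le_right (norm_nonneg _) h2
  have hmul : ∀ (f : ℂ → ℂ) (k : ℕ), 1 ≤ k → f =O[𝓟 Treg] Gfun (3 / 20) →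
      (fun s => f s * (s ^ k)⁻¹) =O[𝓟 Treg] Gfun (-17 / 20) := by
    intro f k hk hf
    refine (hf.mul (inv_pow_bigO k hk)).congr (fun s => rfl) (fun s => ?_)
    unfold Gfun
    rw [← Real.rpow_add (by positivity)]
    norm_num
  have b0 := hmul _ 1 le_rfl (a0.sub hone)
  have b1 := hmul _ 1 le_rfl a1
  have b2 := hmul _ 1 le_rfl a2
  simp only [pow_one] at b0 b1 b2
  refine ⟨b0, b1.sub (hmul _ 2 (by norm_num) (a0.sub hone)), ?_⟩
  exact (b2.sub ((hmul _ 2 (by norm_num) a1).const_mul_left 2)).add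
    ((hmul _ 3 (by norm_num) (a0.sub hone)).const_mul_left 2)

end AuxBound
end LandauD

namespace LandauD
set_option linter.unusedSectionVars false
set_option linter.unusedTactic false
set_option linter.unusedVariables false

section Transform
open Complex MeasureTheory Finset ArithmeticFunction.vonMangoldt

variable {q : ℕ} [NeZero q]

/-- Chebyshev function of a residue class. -/
noncomputable def psiA (a : ZMod q) (x : ℝ) : ℝ := ∑ k ∈ Icc 1 ⌊x⌋₊, residueClass a k

/-- Normalized error. -/
noncomputable def eA (a : ZMod q) (u : ℝ) : ℝ :=
  psiA a (Real.exp u) * Real.exp (-u) - (q.totient : ℝ)⁻¹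

lemma psiA_mono (a : ZMod q) : Monotone (psiA a) := by
  intro x y h
  unfold psiA
  refine Finset.sum_le_sum_of_subset_of_nonneg ?_ fun k _ _ => residueClass_nonneg a k
  exact Finset.Icc_subset_Icc le_rfl (Nat.floor_mono h)

lemma psiA_nonneg (a : ZMod q) (x : ℝ) : 0 ≤ psiA a x :=
  Finset.sum_nonneg fun k _ => residueClass_nonneg a k

lemma psiA_le (a : ZMod q) {x : ℝ} (hx : 0 ≤ x) : psiA a x ≤ 6 * x := by
  have h1 : psiA a x ≤ Chebyshev.psi x := by
    unfold psiA Chebyshev.psi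
    have e : Ioc 0 ⌊x⌋₊ = Icc 1 ⌊x⌋₊ := rfl
    rw [e]
    exact Finset.sum_le_sum fun k _ => residueClass_le a k
  have h2 := Chebyshev.psi_le_const_mul_self hx
  have h3 : Real.log 4 ≤ 2 := by
    rw [show (4 : ℝ) = 2 ^ 2 by norm_num, Real.log_pow]
    have := Real.log_two_lt_d9
    push_cast
    linarith
  nlinarith

lemma totient_inv_le : (q.totient : ℝ)⁻¹ ≤ 1 := by
  refine inv_le_one_of_one_le₀ ?_
  exact_mod_cast Nat.totient_pos.mpr (NeZero.pos q)

lemma eA_bound (a : ZMod q) (u : ℝ) : |eA a u| ≤ 7 := by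
  have h0 := psiA_nonneg a (Real.exp u)
  have h1 := psiA_le a (Real.exp_pos u).le
  have h2 : psiA a (Real.exp u) * Real.exp (-u) ≤ 6 := by
    calc _ ≤ 6 * Real.exp u * Real.exp (-u) := by gcongr
      _ = 6 := by rw [mul_assoc, ← Real.exp_add]; simp
  have h3 : 0 ≤ psiA a (Real.exp u) * Real.exp (-u) := by positivity
  have h4 := totient_inv_le (q := q)
  have h5 : 0 ≤ (q.totient : ℝ)⁻¹ := by positivity
  unfold eA
  rw [abs_le]
  constructor <;> linarith

lemma eA_meas (a : ZMod q) : Measurable (eA a) := by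
  unfold eA
  exact (((psiA_mono a).measurable.comp Real.measurable_exp).mul (by fun_prop)).sub_const _

/-- Damped error, extended by zero. -/
noncomputable def hA (a : ZMod q) (ε : ℝ) (u : ℝ) : ℂ :=
  (Set.Ioi (0 : ℝ)).indicator (fun u => ((eA a u * Real.exp (-ε * u) : ℝ) : ℂ)) u

lemma hA_integrable (a : ZMod q) {ε : ℝ} (hε : 0 < ε) : Integrable (hA a ε) := by
  unfold hA
  rw [integrable_indicator_iff measurableSet_Ioi]
  have h1 : IntegrableOn (fun u : ℝ => Real.exp (-ε * u)) (Set.Ioi 0) :=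
    integrableOn_exp_mul_Ioi (by linarith) 0
  refine IntegrableOn.congr_fun (f := fun u => ((eA a u * Real.exp (-ε * u) : ℝ) : ℂ)) ?_ (fun _ _ => rfl) measurableSet_Ioi
  refine Integrable.ofReal ?_
  refine Integrable.bdd_mul (c := 7) h1 (eA_meas a).aestronglyMeasurable ?_
  exact Eventually.of_forall fun u => by simpa using eA_bound a u

lemma hA_transform {a : ZMod q} (ha : IsUnit a) {ε : ℝ} (hε : 0 < ε) (ξ : ℝ) :
    ∫ u in Set.Ioi (0 : ℝ), ((eA a u * Real.exp (-ε * u) : ℝ) : ℂ) * cexp (-(2 * Real.pi * ξ * u : ℝ) * I)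
      = Kfun a (1 + ε + 2 * Real.pi * ξ * I) := by
  set s : ℂ := 1 + ε + 2 * Real.pi * ξ * I with hs
  have hsre : s.re = 1 + ε := by simp [hs]
  have hs1 : 1 < s.re := by rw [hsre]; linarith
  have hs0 : s ≠ 0 := by rintro h; rw [h] at hs1; simp at hs1; linarith
  have hsm : s - 1 ≠ 0 := by
    intro h; have := congrArg re h; simp [hsre] at this; linarith
  have hL : LSeries (fun n => (residueClass a n : ℂ)) s =
      s * ∫ t in Set.Ioi (1 : ℝ), (∑ k ∈ Icc 1 ⌊t⌋₊, (residueClass a k : ℂ)) * t ^ (-(s + 1)) := by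
    refine LSeries_eq_mul_integral_of_nonneg (residueClass a) zero_le_one hs1 ?_ (residueClass_nonneg a)
    refine IsBigO.of_bound 6 (Eventually.of_forall fun n => ?_)
    have := psiA_le a (Nat.cast_nonneg n)
    have h0 := psiA_nonneg a n
    unfold psiA at this h0
    rw [Nat.floor_natCast] at this h0
    rw [Real.norm_of_nonneg h0]
    simpa using this
  have hcv : ∫ t in Set.Ioi (1 : ℝ), (∑ k ∈ Icc 1 ⌊t⌋₊, (residueClass a k : ℂ)) * t ^ (-(s + 1)) =
      ∫ u in Set.Ioi (0 : ℝ), (psiA a (Real.exp u) : ℂ) * cexp (-s * u) := by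
    have him : Real.exp '' (Set.Ioi 0) = Set.Ioi 1 := by
      ext y
      constructor
      · rintro ⟨u, hu, rfl⟩; exact Real.one_lt_exp_iff.mpr hu
      · intro hy
        have hy' : (1 : ℝ) < y := hy
        exact ⟨Real.log y, Real.log_pos hy', Real.exp_log (by linarith)⟩
    rw [← him, integral_image_eq_integral_abs_deriv_smul measurableSet_Ioi
      (fun x _ => (Real.hasDerivAt_exp x).hasDerivWithinAt) Real.exp_injective.injOn]
    refine setIntegral_congr_fun measurableSet_Ioi fun u hu => ?_
    simp only [abs_of_pos (Real.exp_pos u), psiA, Complex.real_smul]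
    push_cast
    rw [Complex.cpow_def_of_ne_zero (Complex.exp_ne_zero _), ← Complex.ofReal_exp, ← Complex.ofReal_log (Real.exp_pos u).le, Real.log_exp]
    rw [mul_left_comm]
    congr 1
    push_cast
    rw [← Complex.exp_add]
    congr 1
    ring
  have hK : Kfun a s = LSeries (fun n => (residueClass a n : ℂ)) s / s - (q.totient : ℂ)⁻¹ * (1 / (s - 1)) := by
    unfold Kfun
    rw [eqOn_LFunctionResidueClassAux ha hs1]
    field_simp
    ring
  have hexp : ∀ u : ℝ, cexp (-s * u) = (Real.exp (-u) * Real.exp (-ε * u) : ℝ) * cexp (-(2 * Real.pi * ξ * u : ℝ) * I) := by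
    intro u
    push_cast
    rw [← Complex.exp_add, ← Complex.exp_add, hs]
    congr 1
    ring
  have hint1 : IntegrableOn (fun u : ℝ => cexp (-(s - 1) * u)) (Set.Ioi 0) :=
    integrableOn_exp_mul_complex_Ioi (by simp [hsre]; linarith) 0
  have hval : ∫ u in Set.Ioi (0 : ℝ), cexp (-(s - 1) * u) = 1 / (s - 1) := by
    rw [integral_exp_mul_complex_Ioi (by simp [hsre]; linarith) 0]
    have : -(s - 1) ≠ 0 := neg_ne_zero.mpr hsm
    simp only [Complex.ofReal_zero, mul_zero, Complex.exp_zero]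
    rw [div_neg, neg_div, neg_neg]
  have hint2 : IntegrableOn (fun u : ℝ => (psiA a (Real.exp u) : ℂ) * cexp (-s * u)) (Set.Ioi 0) := by
    have : (fun u : ℝ => (psiA a (Real.exp u) : ℂ) * cexp (-s * u)) =
        fun u : ℝ => ((psiA a (Real.exp u) * Real.exp (-u) : ℝ) : ℂ) * cexp (-(s - 1) * u) := by
      funext u
      push_cast
      rw [mul_assoc, ← Complex.exp_add]
      congr 2
      ring
    rw [this]
    refine Integrable.bdd_mul (c := 8) hint1 ?_ ?_
    · refine (Measurable.aestronglyMeasurable ?_)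
      exact Complex.measurable_ofReal.comp (((psiA_mono a).measurable.comp Real.measurable_exp).mul (by fun_prop))
    · refine Eventually.of_forall fun u => ?_
      rw [Complex.norm_real]
      have h1 := eA_bound a u
      have h2 := totient_inv_le (q := q)
      have h5 : 0 ≤ (q.totient : ℝ)⁻¹ := by positivity
      unfold eA at h1
      rw [abs_le] at h1
      rw [Real.norm_eq_abs, abs_le]
      constructor <;> linarith [h1.1, h1.2]
  rw [hK, hL, mul_div_cancel_left₀ _ hs0, hcv, ← hval, ← integral_const_mul, ← integral_sub hint2 (hint1.const_mul _)]
  refine setIntegral_congr_fun measurableSet_Ioi fun u hu => ?_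
  have h2 : cexp (-(s - 1) * u) = (Real.exp (-ε * u) : ℝ) * cexp (-(2 * Real.pi * ξ * u : ℝ) * I) := by
    push_cast
    rw [← Complex.exp_add, hs]
    congr 1
    ring
  simp only [hexp, h2, eA]
  push_cast
  ring

open FourierTransform in
lemma hA_fourier {a : ZMod q} (ha : IsUnit a) {ε : ℝ} (hε : 0 < ε) (ξ : ℝ) :
    𝓕 (hA a ε) ξ = Kfun a (1 + ε + 2 * Real.pi * ξ * I) := by
  rw [← hA_transform ha hε, Real.fourier_real_eq_integral_exp_smul, ← integral_indicator measurableSet_Ioi]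
  congr 1
  funext u
  unfold hA
  by_cases hu : u ∈ Set.Ioi (0 : ℝ)
  · rw [Set.indicator_of_mem hu, Set.indicator_of_mem hu, smul_eq_mul, mul_comm]
    congr 2
    push_cast
    ring
  · rw [Set.indicator_of_notMem hu, Set.indicator_of_notMem hu, smul_zero]

end Transform
end LandauD

namespace LandauD
set_option linter.unusedSectionVars false
set_option linter.unusedTactic false
set_option linter.unusedVariables false

section Smooth
open Complex MeasureTheory Finset ArithmeticFunction.vonMangoldt FourierTransform SchwartzMap

variable {q : ℕ} [NeZero q]

lemma fourier_swap {f g : ℝ → ℂ} (hf : Integrable f) (hg : Integrable g) :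
    ∫ u, f u * 𝓕 g u = ∫ ξ, 𝓕 f ξ * g ξ := by
  have := VectorFourier.integral_fourierIntegral_smul_eq_flip (L := innerₗ ℝ)
    Real.continuous_fourierChar continuous_inner hf hg
  rw [flip_innerₗ] at this
  exact this.symm

lemma fourier_scale (g0 : ℝ → ℂ) {η : ℝ} (hη : 0 < η) (U u : ℝ) :
    𝓕 (fun ξ : ℝ => (η : ℂ) * g0 (η * ξ) * cexp ((2 * Real.pi * U * ξ : ℝ) * I)) u =
      𝓕 g0 ((u - U) / η) := by
  rw [Real.fourier_real_eq_integral_exp_smul, Real.fourier_real_eq_integral_exp_smul]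
  have h := Measure.integral_comp_mul_left
    (fun v : ℝ => cexp (((-2 * Real.pi * v * ((u - U) / η) : ℝ) : ℂ) * I) • g0 v) η
  have h2 : ∀ F : ℝ → ℂ, (|η⁻¹| : ℝ) • (∫ y, F y) = (η : ℂ)⁻¹ * ∫ y, F y := by
    intro F
    rw [abs_of_pos (by positivity), Complex.real_smul]; push_cast; rfl
  rw [h2] at h
  have hη' : (η : ℂ) ≠ 0 := by exact_mod_cast hη.ne'
  rw [eq_inv_mul_iff_mul_eq₀ hη', ← integral_const_mul] at h
  rw [← h]
  congr 1
  funext ξ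
  simp only [smul_eq_mul]
  have : cexp (((-2 * Real.pi * (η * ξ) * ((u - U) / η) : ℝ) : ℂ) * I) =
      cexp (((-2 * Real.pi * ξ * u : ℝ) : ℂ) * I) * cexp ((2 * Real.pi * U * ξ : ℝ) * I) := by
    rw [← Complex.exp_add]
    congr 1
    push_cast
    field_simp
    ring
  rw [this]
  ring

lemma schwartz_decay (g : 𝓢(ℝ, ℂ)) : ∃ D : ℝ, 0 ≤ D ∧ ∀ η : ℝ, 0 < η → η ≤ 1 → ∀ ξ : ℝ,
    ‖g (η * ξ)‖ ≤ D * (η ^ (-(1 / 4 : ℝ)) * (1 + |ξ|) ^ (-(1 / 4 : ℝ))) := by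
  obtain ⟨C0, hC0, h0⟩ := g.decay 0 0
  obtain ⟨C1, hC1, h1⟩ := g.decay 1 0
  refine ⟨C0 + C1, by positivity, fun η hη hη1 ξ => ?_⟩
  have a0 := h0 (η * ξ)
  have a1 := h1 (η * ξ)
  simp only [pow_zero, one_mul, norm_iteratedFDeriv_zero, pow_one] at a0 a1
  have hb : ‖g (η * ξ)‖ * (1 + |η * ξ|) ≤ C0 + C1 := by
    rw [Real.norm_eq_abs] at a1
    linarith
  have hpos : 0 < 1 + |η * ξ| := by positivity
  have h3 : ‖g (η * ξ)‖ ≤ (C0 + C1) * (1 + |η * ξ|)⁻¹ := by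
    rw [← div_eq_mul_inv, le_div_iff₀ hpos]; exact hb
  refine h3.trans ?_
  gcongr
  rw [← Real.mul_rpow hη.le (by positivity), ← Real.rpow_neg_one]
  calc (1 + |η * ξ|) ^ (-1 : ℝ) ≤ (1 + |η * ξ|) ^ (-(1 / 4) : ℝ) :=
        Real.rpow_le_rpow_of_exponent_le (by linarith [abs_nonneg (η * ξ)]) (by norm_num)
    _ ≤ _ := by
        refine Real.rpow_le_rpow_of_nonpos (by positivity) ?_ (by norm_num)
        rw [abs_mul, abs_of_pos hη]
        nlinarith

/-- boundary curve -/
noncomputable def sl (ε ξ : ℝ) : ℂ := 1 + ε + 2 * Real.pi * ξ * I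

lemma sl_re (ε ξ : ℝ) : (sl ε ξ).re = 1 + ε := by simp [sl]
lemma sl_im (ε ξ : ℝ) : (sl ε ξ).im = 2 * Real.pi * ξ := by simp [sl]

lemma sl_hasDerivAt (ε ξ : ℝ) : HasDerivAt (sl ε) (2 * Real.pi * I) ξ := by
  have h : HasDerivAt (fun ξ : ℝ => (ξ : ℂ)) 1 ξ := Complex.ofRealCLM.hasDerivAt
  have := (((h.const_mul (2 * Real.pi : ℂ)).mul_const I).const_add ((1 : ℂ) + ε))
  rw [mul_one] at this
  exact this

lemma bound_of_bigO {K : ℂ → ℂ} (h : K =O[𝓟 Treg] Gfun (-17 / 20)) :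
    ∃ C : ℝ, 0 ≤ C ∧ ∀ ε : ℝ, 0 < ε → ε ≤ 1 → ∀ ξ : ℝ,
      ‖K (sl ε ξ)‖ ≤ C * (1 + |ξ|) ^ (-(17 / 20) : ℝ) := by
  obtain ⟨C, hC⟩ := isBigO_principal.mp h
  refine ⟨|C|, abs_nonneg _, fun ε hε hε1 ξ => ?_⟩
  have := hC (sl ε ξ) ⟨by rw [sl_re]; linarith, by rw [sl_re]; linarith⟩
  rw [Real.norm_of_nonneg (Gfun_pos _ _).le] at this
  refine this.trans ?_
  gcongr
  · exact (Gfun_pos _ _).le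
  · exact le_abs_self C
  · unfold Gfun
    rw [sl_im, show (-17 / 20 : ℝ) = -(17 / 20) by norm_num]
    refine Real.rpow_le_rpow_of_nonpos (by positivity) ?_ (by norm_num)
    rw [abs_mul, abs_of_pos Real.two_pi_pos]
    have := Real.pi_gt_three
    nlinarith [abs_nonneg ξ]

lemma smooth_avg {a : ZMod q} (ha : IsUnit a) (w : 𝓢(ℝ, ℂ)) :
    ∃ C : ℝ, 0 ≤ C ∧ ∀ ε : ℝ, 0 < ε → ε ≤ 1 → ∀ η : ℝ, 0 < η → η ≤ 1 → ∀ U : ℝ, 0 < U →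
      ‖∫ u, hA a ε u * w ((u - U) / η)‖ ≤ C * (η ^ (3 / 4 : ℝ) / U ^ 2) := by
  set g0 : 𝓢(ℝ, ℂ) := 𝓕⁻ w with hg0
  have hFg : 𝓕 (g0 : ℝ → ℂ) = w := by
    rw [← SchwartzMap.fourier_coe, hg0, FourierTransform.fourier_fourierInv_eq]
  set g1 : 𝓢(ℝ, ℂ) := SchwartzMap.derivCLM ℂ ℂ g0 with hg1
  set g2 : 𝓢(ℝ, ℂ) := SchwartzMap.derivCLM ℂ ℂ g1 with hg2
  have dg0 : ∀ y, HasDerivAt g0 (g1 y) y := fun y => by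
    rw [hg1, SchwartzMap.derivCLM_apply]; exact g0.differentiableAt.hasDerivAt
  have dg1 : ∀ y, HasDerivAt g1 (g2 y) y := fun y => by
    rw [hg2, SchwartzMap.derivCLM_apply]; exact g1.differentiableAt.hasDerivAt
  obtain ⟨D0, hD0, b0⟩ := schwartz_decay g0
  obtain ⟨D1, hD1, b1⟩ := schwartz_decay g1
  obtain ⟨D2, hD2, b2⟩ := schwartz_decay g2
  obtain ⟨o0, o1, o2⟩ := Kfun_bigO ha
  obtain ⟨E0, hE0, c0⟩ := bound_of_bigO o0
  obtain ⟨E1, hE1, c1⟩ := bound_of_bigO o1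
  obtain ⟨E2, hE2, c2⟩ := bound_of_bigO o2
  set M : ℝ := 40 * (E2 * D0) + 14 * (E1 * D1) + E0 * D2 + (7 * (E1 * D0) + E0 * D1) + E0 * D0 with hM
  have hM0 : 0 ≤ M := by positivity
  set J : ℝ := ∫ ξ : ℝ, (1 + ‖ξ‖) ^ (-(11 / 10) : ℝ) with hJ
  have hJi : Integrable fun ξ : ℝ => (1 + ‖ξ‖) ^ (-(11 / 10) : ℝ) :=
    integrable_one_add_norm (by simp; norm_num)
  have hJ0 : 0 ≤ J := integral_nonneg fun ξ => by positivity
  refine ⟨M * J, by positivity, fun ε hε hε1 η hη hη1 U hU => ?_⟩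
  set τ : ℂ := 2 * Real.pi * I with hτ
  have hτn : ‖τ‖ ≤ 7 := by
    rw [hτ]; simp [abs_of_pos Real.pi_pos]
    linarith [Real.pi_lt_d2]
  -- functions on the line
  set k0 : ℝ → ℂ := fun ξ => Kfun a (sl ε ξ) with hk0
  set k1 : ℝ → ℂ := fun ξ => Kfun1 a (sl ε ξ) * τ with hk1
  set k2 : ℝ → ℂ := fun ξ => Kfun2 a (sl ε ξ) * τ * τ with hk2
  have hmem : ∀ ξ, sl ε ξ ∈ Hreg := fun ξ => by
    show 1 < (sl ε ξ).re
    rw [sl_re]; linarith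
  have dk0 : ∀ ξ, HasDerivAt k0 (k1 ξ) ξ := fun ξ =>
    HasDerivAt.comp_of_eq ξ (Kfun_hasDerivAt a (hmem ξ)) (sl_hasDerivAt ε ξ) rfl
  have dk1 : ∀ ξ, HasDerivAt k1 (k2 ξ) ξ := fun ξ =>
    (HasDerivAt.comp_of_eq ξ (Kfun1_hasDerivAt a (hmem ξ)) (sl_hasDerivAt ε ξ) rfl).mul_const τ
  have dη : ∀ ξ : ℝ, HasDerivAt (fun ξ : ℝ => η * ξ) η ξ := fun ξ => by
    simpa using (hasDerivAt_id ξ).const_mul η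
  set γ0 : ℝ → ℂ := fun ξ => g0 (η * ξ) with hγ0
  set γ1 : ℝ → ℂ := fun ξ => η * g1 (η * ξ) with hγ1
  set γ2 : ℝ → ℂ := fun ξ => η * (η * g2 (η * ξ)) with hγ2
  have dγ0 : ∀ ξ, HasDerivAt γ0 (γ1 ξ) ξ := fun ξ => by
    have := (dg0 (η * ξ)).scomp ξ (dη ξ)
    rw [Complex.real_smul] at this
    exact this
  have dγ1 : ∀ ξ, HasDerivAt γ1 (γ2 ξ) ξ := fun ξ => by
    have := (dg1 (η * ξ)).scomp ξ (dη ξ)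
    rw [Complex.real_smul] at this
    exact this.const_mul (η : ℂ)
  set Q : ℝ → ℂ := fun ξ => η * (k0 ξ * γ0 ξ) with hQ
  set Q1 : ℝ → ℂ := fun ξ => η * (k1 ξ * γ0 ξ + k0 ξ * γ1 ξ) with hQ1
  set Q2 : ℝ → ℂ := fun ξ => η * ((k2 ξ * γ0 ξ + k1 ξ * γ1 ξ) + (k1 ξ * γ1 ξ + k0 ξ * γ2 ξ)) with hQ2
  have dQ : ∀ ξ, HasDerivAt Q (Q1 ξ) ξ := fun ξ => ((dk0 ξ).mul (dγ0 ξ)).const_mul (η : ℂ)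
  have dQ1 : ∀ ξ, HasDerivAt Q1 (Q2 ξ) ξ := fun ξ =>
    (((dk1 ξ).mul (dγ0 ξ)).add ((dk0 ξ).mul (dγ1 ξ))).const_mul (η : ℂ)
  have eQ1 : deriv Q = Q1 := funext fun ξ => (dQ ξ).deriv
  have eQ2 : deriv Q1 = Q2 := funext fun ξ => (dQ1 ξ).deriv
  -- bounds
  set B : ℝ → ℝ := fun ξ => η ^ (3 / 4 : ℝ) * (1 + ‖ξ‖) ^ (-(11 / 10) : ℝ) with hB
  have hBi : Integrable B := hJi.const_mul _
  have hprod : ∀ (x y : ℂ) (E D ξ : ℝ), 0 ≤ E → 0 ≤ D → ‖x‖ ≤ E * (1 + |ξ|) ^ (-(17 / 20) : ℝ) →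
      ‖y‖ ≤ D * (η ^ (-(1 / 4 : ℝ)) * (1 + |ξ|) ^ (-(1 / 4 : ℝ))) → η * ‖x * y‖ ≤ E * D * B ξ := by
    intro x y E D ξ hE hD hx hy
    rw [norm_mul]
    calc η * (‖x‖ * ‖y‖) ≤ η * ((E * (1 + |ξ|) ^ (-(17 / 20) : ℝ)) *
          (D * (η ^ (-(1 / 4 : ℝ)) * (1 + |ξ|) ^ (-(1 / 4 : ℝ))))) := by gcongr
      _ = E * D * ((η ^ (1 : ℝ) * η ^ (-(1 / 4 : ℝ))) *
          ((1 + |ξ|) ^ (-(17 / 20) : ℝ) * (1 + |ξ|) ^ (-(1 / 4 : ℝ)))) := by rw [Real.rpow_one]; ring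
      _ = _ := by
        rw [← Real.rpow_add hη, ← Real.rpow_add (by positivity)]
        simp only [hB, Real.norm_eq_abs]
        norm_num
  have hc0 : ∀ ξ, ‖k0 ξ‖ ≤ E0 * (1 + |ξ|) ^ (-(17 / 20) : ℝ) := fun ξ => c0 ε hε hε1 ξ
  have hc1 : ∀ ξ, ‖k1 ξ‖ ≤ (7 * E1) * (1 + |ξ|) ^ (-(17 / 20) : ℝ) := fun ξ => by
    simp only [hk1, norm_mul]
    calc _ ≤ E1 * (1 + |ξ|) ^ (-(17 / 20) : ℝ) * 7 := by gcongr; exact c1 ε hε hε1 ξ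
      _ = _ := by ring
  have hc2 : ∀ ξ, ‖k2 ξ‖ ≤ (49 * E2) * (1 + |ξ|) ^ (-(17 / 20) : ℝ) := fun ξ => by
    simp only [hk2, norm_mul]
    calc _ ≤ E2 * (1 + |ξ|) ^ (-(17 / 20) : ℝ) * 7 * 7 := by gcongr; exact c2 ε hε hε1 ξ
      _ = _ := by ring
  have hb0 : ∀ ξ, ‖γ0 ξ‖ ≤ D0 * (η ^ (-(1 / 4 : ℝ)) * (1 + |ξ|) ^ (-(1 / 4 : ℝ))) := fun ξ => b0 η hη hη1 ξ
  have hηn : ‖(η : ℂ)‖ = η := by rw [Complex.norm_real, Real.norm_of_nonneg hη.le]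
  have hb1 : ∀ ξ, ‖γ1 ξ‖ ≤ D1 * (η ^ (-(1 / 4 : ℝ)) * (1 + |ξ|) ^ (-(1 / 4 : ℝ))) := fun ξ => by
    simp only [hγ1, norm_mul, hηn]
    calc _ ≤ 1 * ‖g1 (η * ξ)‖ := by gcongr
      _ ≤ _ := by rw [one_mul]; exact b1 η hη hη1 ξ
  have hb2 : ∀ ξ, ‖γ2 ξ‖ ≤ D2 * (η ^ (-(1 / 4 : ℝ)) * (1 + |ξ|) ^ (-(1 / 4 : ℝ))) := fun ξ => by
    simp only [hγ2, norm_mul, hηn]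
    calc _ ≤ 1 * (1 * ‖g2 (η * ξ)‖) := by gcongr
      _ ≤ _ := by rw [one_mul, one_mul]; exact b2 η hη hη1 ξ
  have hQb : ∀ ξ, ‖Q ξ‖ ≤ E0 * D0 * B ξ := fun ξ => by
    simp only [hQ]
    rw [norm_mul, hηn]
    exact hprod _ _ _ _ _ hE0 hD0 (hc0 ξ) (hb0 ξ)
  have hQ1b : ∀ ξ, ‖Q1 ξ‖ ≤ (7 * E1 * D0 + E0 * D1) * B ξ := fun ξ => by
    simp only [hQ1]
    rw [norm_mul, hηn]
    have p1 := hprod _ _ _ _ _ (by positivity) hD0 (hc1 ξ) (hb0 ξ)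
    have p2 := hprod _ _ _ _ _ hE0 hD1 (hc0 ξ) (hb1 ξ)
    calc _ ≤ η * (‖k1 ξ * γ0 ξ‖ + ‖k0 ξ * γ1 ξ‖) := by gcongr; exact norm_add_le _ _
      _ ≤ _ := by linarith
  have hQ2b : ∀ ξ, ‖Q2 ξ‖ ≤ (49 * E2 * D0 + 14 * E1 * D1 + E0 * D2) * B ξ := fun ξ => by
    simp only [hQ2]
    rw [norm_mul, hηn]
    have p1 := hprod _ _ _ _ _ (by positivity) hD0 (hc2 ξ) (hb0 ξ)
    have p2 := hprod _ _ _ _ _ (by positivity) hD1 (hc1 ξ) (hb1 ξ)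
    have p3 := hprod _ _ _ _ _ hE0 hD2 (hc0 ξ) (hb2 ξ)
    calc _ ≤ η * ((‖k2 ξ * γ0 ξ‖ + ‖k1 ξ * γ1 ξ‖) + (‖k1 ξ * γ1 ξ‖ + ‖k0 ξ * γ2 ξ‖)) := by
          gcongr
          exact (norm_add_le _ _).trans (add_le_add (norm_add_le _ _) (norm_add_le _ _))
      _ ≤ _ := by linarith
  have cQ : Differentiable ℝ Q := fun ξ => (dQ ξ).differentiableAt
  have cQ1 : Differentiable ℝ Q1 := fun ξ => (dQ1 ξ).differentiableAt
  have iQ : Integrable Q := (hBi.const_mul _).mono' cQ.continuous.aestronglyMeasurable (Eventually.of_forall hQb)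
  have iQ1 : Integrable Q1 := (hBi.const_mul _).mono' cQ1.continuous.aestronglyMeasurable (Eventually.of_forall hQ1b)
  have iQ2 : Integrable Q2 := by
    refine (hBi.const_mul _).mono' ?_ (Eventually.of_forall hQ2b)
    rw [← eQ2]; exact aestronglyMeasurable_deriv _ _
  -- transform
  have f1 := congrFun (Real.fourier_deriv iQ cQ (eQ1 ▸ iQ1)) (-U)
  have f2 := congrFun (Real.fourier_deriv iQ1 cQ1 (eQ2 ▸ iQ2)) (-U)
  rw [eQ1] at f1
  rw [eQ2, f1] at f2
  have hfin : ‖𝓕 Q (-U)‖ * (2 * Real.pi * U) ^ 2 ≤ ∫ ξ, ‖Q2 ξ‖ := by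
    have h1 : ‖𝓕 Q2 (-U)‖ ≤ ∫ ξ, ‖Q2 ξ‖ := by
      rw [Real.fourier_real_eq_integral_exp_smul]
      refine (norm_integral_le_integral_norm _).trans (le_of_eq ?_)
      congr 1
      funext ξ
      rw [norm_smul, Complex.norm_exp_ofReal_mul_I, one_mul]
    have h2 : ‖𝓕 Q2 (-U)‖ = ‖𝓕 Q (-U)‖ * (2 * Real.pi * U) ^ 2 := by
      rw [f2, norm_smul, norm_smul]
      simp only [norm_mul, Complex.norm_real, Complex.norm_I, Complex.ofReal_neg, norm_neg,
        Real.norm_of_nonneg hU.le, Real.norm_of_nonneg Real.pi_pos.le, Complex.norm_ofNat]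
      ring
    rw [← h2]; exact h1
  have hQ2i : ∫ ξ, ‖Q2 ξ‖ ≤ (49 * E2 * D0 + 14 * E1 * D1 + E0 * D2) * (η ^ (3 / 4 : ℝ) * J) := by
    calc _ ≤ ∫ ξ, (49 * E2 * D0 + 14 * E1 * D1 + E0 * D2) * B ξ :=
          integral_mono iQ2.norm (hBi.const_mul _) hQ2b
      _ = _ := by rw [integral_const_mul, hB, integral_const_mul]
  -- the swap
  have hval : ∫ u, hA a ε u * w ((u - U) / η) = 𝓕 Q (-U) := by
    set g : ℝ → ℂ := fun ξ : ℝ => (η : ℂ) * g0 (η * ξ) * cexp ((2 * Real.pi * U * ξ : ℝ) * I) with hg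
    have hgi : Integrable g := by
      have h1 : Integrable fun ξ : ℝ => (η : ℂ) * g0 (η * ξ) :=
        ((g0.integrable (μ := volume)).comp_mul_left' hη.ne').const_mul _
      refine h1.norm.mono' ?_ (Eventually.of_forall fun ξ => ?_)
      · refine Continuous.aestronglyMeasurable ?_
        have := g0.continuous
        simp only [hg]
        fun_prop
      · simp only [hg]
        rw [norm_mul, Complex.norm_exp_ofReal_mul_I, mul_one]
    have h1 : ∀ u, w ((u - U) / η) = 𝓕 g u := fun u => by
      rw [hg, fourier_scale _ hη, hFg]
    simp_rw [h1]
    rw [fourier_swap (hA_integrable a hε) hgi, Real.fourier_real_eq_integral_exp_smul]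
    congr 1
    funext ξ
    rw [hA_fourier ha hε]
    simp only [hg, hQ, hk0, sl, hγ0, smul_eq_mul]
    have : ((-2 * Real.pi * ξ * -U : ℝ) : ℂ) * I = ((2 * Real.pi * U * ξ : ℝ) : ℂ) * I := by push_cast; ring
    rw [this]
    ring
  rw [hval]
  have hp : 36 * U ^ 2 ≤ (2 * Real.pi * U) ^ 2 := by
    rw [mul_pow]; gcongr; nlinarith [Real.pi_gt_three]
  have hη3 : 0 < η ^ (3 / 4 : ℝ) := by positivity
  have : ‖𝓕 Q (-U)‖ * (36 * U ^ 2) ≤ (49 * E2 * D0 + 14 * E1 * D1 + E0 * D2) * (η ^ (3 / 4 : ℝ) * J) :=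
    le_trans (by gcongr) (hfin.trans hQ2i)
  rw [show M * J * (η ^ (3 / 4 : ℝ) / U ^ 2) = M * J * η ^ (3 / 4 : ℝ) / U ^ 2 by ring, le_div_iff₀ (by positivity)]
  have h49 : (49 * E2 * D0 + 14 * E1 * D1 + E0 * D2) ≤ 36 * M := by
    have := mul_nonneg hE2 hD0
    have := mul_nonneg hE1 hD1
    have := mul_nonneg hE0 hD2
    have := mul_nonneg hE1 hD0
    have := mul_nonneg hE0 hD1
    have := mul_nonneg hE0 hD0
    simp only [hM]; nlinarith
  have h50 : (49 * E2 * D0 + 14 * E1 * D1 + E0 * D2) * (η ^ (3 / 4 : ℝ) * J) ≤ 36 * M * (η ^ (3 / 4 : ℝ) * J) := by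
    gcongr
  nlinarith

end Smooth
end LandauD

namespace LandauD
set_option linter.unusedSectionVars false
set_option linter.unusedTactic false
set_option linter.unusedVariables false

section Tauber
open Complex MeasureTheory Finset ArithmeticFunction.vonMangoldt FourierTransform SchwartzMap

variable {q : ℕ} [NeZero q]

/-- A fixed bump. -/
noncomputable def bump0 : ContDiffBump (0 : ℝ) := ⟨1 / 2, 1, by norm_num, by norm_num⟩

/-- Normalized bump function supported in the unit interval around zero. -/
noncomputable def bmp (x : ℝ) : ℝ := bump0.normed volume x

lemma bmp_nonneg (x : ℝ) : 0 ≤ bmp x := bump0.nonneg_normed x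
lemma bmp_integral : ∫ x, bmp x = 1 := bump0.integral_normed
lemma bmp_integrable : Integrable bmp := bump0.integrable_normed
lemma bmp_cont : Continuous bmp := bump0.continuous_normed
lemma bmp_zero {x : ℝ} (hx : 1 ≤ |x|) : bmp x = 0 := by
  have h : x ∉ Function.support (bump0.normed volume) := by
    rw [bump0.support_normed_eq]
    simp [bump0]
    exact hx
  exact Function.notMem_support.mp h

/-- Schwartz version of the bump. -/
noncomputable def bmpS : 𝓢(ℝ, ℂ) :=
  HasCompactSupport.toSchwartzMap (f := fun x => (bmp x : ℂ))
    ((bump0.hasCompactSupport_normed (μ := volume)).comp_left (g := fun y : ℝ => (y : ℂ)) (by simp))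
    (Complex.ofRealCLM.contDiff.comp (bump0.contDiff_normed (n := ⊤)))

lemma bmpS_apply (x : ℝ) : bmpS x = (bmp x : ℂ) := rfl

lemma bmp_scale_integrable {η : ℝ} (hη : 0 < η) (V : ℝ) : Integrable fun u => bmp ((u - V) / η) :=
  (bmp_integrable.comp_div hη.ne').comp_sub_right V

lemma bmp_scale_integral {η : ℝ} (hη : 0 < η) (V : ℝ) : ∫ u, bmp ((u - V) / η) = η := by
  rw [integral_sub_right_eq_self (fun u => bmp (u / η)) V, Measure.integral_comp_div, bmp_integral]
  simp [abs_of_pos hη]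

lemma eA_bmp_integrable (a : ZMod q) {η : ℝ} (hη : 0 < η) (V : ℝ) :
    Integrable fun u => eA a u * bmp ((u - V) / η) := by
  refine Integrable.bdd_mul (c := 7) (bmp_scale_integrable hη V) (eA_meas a).aestronglyMeasurable ?_
  exact Eventually.of_forall fun u => by simpa using eA_bound a u

lemma avg_bound {a : ZMod q} (ha : IsUnit a) :
    ∃ C : ℝ, 0 ≤ C ∧ ∀ η : ℝ, 0 < η → η ≤ 1 → ∀ V : ℝ, 2 ≤ V →
      |∫ u, eA a u * bmp ((u - V) / η)| ≤ C * (η ^ (3 / 4 : ℝ) / V ^ 2) := by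
  obtain ⟨C, hC, h⟩ := smooth_avg ha bmpS
  refine ⟨C, hC, fun η hη hη1 V hV => ?_⟩
  have hlim : Tendsto (fun n : ℕ => ∫ u, hA a (1 / ((n : ℝ) + 1)) u * bmpS ((u - V) / η)) atTop
      (nhds (∫ u, ((eA a u * bmp ((u - V) / η) : ℝ) : ℂ))) := by
    refine tendsto_integral_of_dominated_convergence (fun u => 7 * bmp ((u - V) / η)) ?_
      ((bmp_scale_integrable hη V).const_mul 7) ?_ ?_
    · intro n
      refine AEStronglyMeasurable.mul (hA_integrable a (by positivity)).aestronglyMeasurable ?_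
      refine Continuous.aestronglyMeasurable ?_
      have := bmpS.continuous
      fun_prop
    · intro n
      refine Eventually.of_forall fun u => ?_
      rw [norm_mul, bmpS_apply, Complex.norm_real, Real.norm_of_nonneg (bmp_nonneg _)]
      refine mul_le_mul_of_nonneg_right ?_ (bmp_nonneg _)
      unfold hA
      by_cases hu : u ∈ Set.Ioi (0 : ℝ)
      · rw [Set.indicator_of_mem hu, Complex.norm_real, Real.norm_eq_abs, abs_mul, abs_of_pos (Real.exp_pos _)]
        have h1 : Real.exp (-(1 / ((n : ℝ) + 1)) * u) ≤ 1 := by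
          rw [Real.exp_le_one_iff]
          have : 0 < 1 / ((n : ℝ) + 1) := by positivity
          have hu' : 0 < u := hu
          nlinarith
        nlinarith [eA_bound a u, abs_nonneg (eA a u), Real.exp_pos (-(1 / ((n : ℝ) + 1)) * u)]
      · rw [Set.indicator_of_notMem hu]; simp
    · refine Eventually.of_forall fun u => ?_
      by_cases hu : u ∈ Set.Ioi (0 : ℝ)
      · have h1 : Tendsto (fun n : ℕ => Real.exp (-(1 / ((n : ℝ) + 1)) * u)) atTop (nhds 1) := by
          have h2 : Tendsto (fun n : ℕ => -(1 / ((n : ℝ) + 1)) * u) atTop (nhds (-0 * u)) :=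
            (tendsto_one_div_add_atTop_nhds_zero_nat.neg).mul_const u
          have := (Real.continuous_exp.tendsto _).comp h2
          simp only [Function.comp_def, neg_zero, zero_mul, Real.exp_zero] at this
          exact this
        have h3 : Tendsto (fun n : ℕ => ((eA a u * Real.exp (-(1 / ((n : ℝ) + 1)) * u) : ℝ) : ℂ)
            * bmpS ((u - V) / η)) atTop (nhds (((eA a u * 1 : ℝ) : ℂ) * bmpS ((u - V) / η))) :=
          ((Complex.continuous_ofReal.tendsto _).comp (h1.const_mul (eA a u))).mul_const _
        rw [bmpS_apply] at h3
        simp only [hA, Set.indicator_of_mem hu]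
        rw [bmpS_apply]
        convert h3 using 2
        push_cast
        ring
      · have hb : bmp ((u - V) / η) = 0 := by
          apply bmp_zero
          have hu' : u ≤ 0 := by simpa using hu
          rw [abs_div, abs_of_pos hη, abs_of_nonpos (by linarith), le_div_iff₀ hη]
          linarith
        simp only [bmpS_apply, hb]
        simp
  have h2 := le_of_tendsto (hlim.norm) (Eventually.of_forall fun n => by
    refine h (1 / ((n : ℝ) + 1)) (by positivity) ?_ η hη hη1 V (by linarith)
    rw [div_le_one (by positivity)]
    have : (0 : ℝ) ≤ n := Nat.cast_nonneg n
    linarith)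
  have h3 : (∫ u, ((eA a u * bmp ((u - V) / η) : ℝ) : ℂ)) = ((∫ u, eA a u * bmp ((u - V) / η) : ℝ) : ℂ) :=
    integral_ofReal
  rw [h3, Complex.norm_real, Real.norm_eq_abs] at h2
  exact h2

lemma eA_slow (a : ZMod q) {U u η : ℝ} (hη : 0 ≤ η) (h1 : U ≤ u) (h2 : u ≤ U + 2 * η) :
    eA a U - 12 * η ≤ eA a u := by
  unfold eA
  have hm := psiA_mono a (Real.exp_le_exp.mpr h1)
  have hP := psiA_le a (Real.exp_pos U).le
  have hP0 := psiA_nonneg a (Real.exp U)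
  have he : Real.exp (-u) = Real.exp (-U) * Real.exp (-(u - U)) := by
    rw [← Real.exp_add]; congr 1; ring
  have h3 : 1 - 2 * η ≤ Real.exp (-(u - U)) := by
    have := Real.add_one_le_exp (-(u - U))
    linarith
  have h4 : psiA a (Real.exp U) * Real.exp (-U) ≤ 6 := by
    calc _ ≤ 6 * Real.exp U * Real.exp (-U) := by gcongr
      _ = 6 := by rw [mul_assoc, ← Real.exp_add]; simp
  have h5 : 0 ≤ psiA a (Real.exp U) * Real.exp (-U) := by positivity
  have h6 : psiA a (Real.exp U) * Real.exp (-u) ≤ psiA a (Real.exp u) * Real.exp (-u) := by gcongr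
  have h7 : psiA a (Real.exp U) * Real.exp (-U) * (1 - 2 * η) ≤ psiA a (Real.exp U) * Real.exp (-u) := by
    rw [he, ← mul_assoc]; gcongr
  nlinarith

lemma eA_decay {a : ZMod q} (ha : IsUnit a) :
    ∃ C : ℝ, 0 ≤ C ∧ ∀ U : ℝ, 0 ≤ U → |eA a U| ≤ C * (1 + U) ^ (-(8 / 5) : ℝ) := by
  obtain ⟨C, hC, h⟩ := avg_bound ha
  have hmain : ∀ U : ℝ, 3 ≤ U → |eA a U| ≤ (12 + 4 * C) * U ^ (-(8 / 5) : ℝ) := by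
    intro U hU
    have hU0 : 0 < U := by linarith
    set η : ℝ := U ^ (-(8 / 5) : ℝ) with hη
    have hη0 : 0 < η := by positivity
    have hη1 : η ≤ 1 := Real.rpow_le_one_of_one_le_of_nonpos (by linarith) (by norm_num)
    have hpow : η ^ (3 / 4 : ℝ) / U ^ 2 = η * η := by
      have e1 : η ^ (3 / 4 : ℝ) = U ^ (-(6 / 5) : ℝ) := by
        rw [hη, ← Real.rpow_mul hU0.le]; norm_num
      have e2 : η * η = U ^ (-(16 / 5) : ℝ) := by
        rw [hη, ← Real.rpow_add hU0]; norm_num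
      rw [e1, e2, div_eq_mul_inv, ← Real.rpow_natCast, ← Real.rpow_neg hU0.le, ← Real.rpow_add hU0]
      norm_num
    have hsm : ∀ V : ℝ, U - 1 ≤ V → |∫ u, eA a u * bmp ((u - V) / η)| ≤ 4 * C * (η * η) := by
      intro V hV
      refine (h η hη0 hη1 V (by linarith)).trans ?_
      rw [← hpow]
      have h1 : η ^ (3 / 4 : ℝ) / V ^ 2 ≤ η ^ (3 / 4 : ℝ) / (U / 2) ^ 2 := by
        gcongr; linarith
      calc _ ≤ C * (η ^ (3 / 4 : ℝ) / (U / 2) ^ 2) := by gcongr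
        _ = _ := by field_simp; ring
    -- upper bound
    have hup : (eA a U - 12 * η) * η ≤ 4 * C * (η * η) := by
      have h1 := hsm (U + η) (by linarith)
      have h2 : ∫ u, (eA a U - 12 * η) * bmp ((u - (U + η)) / η) ≤ ∫ u, eA a u * bmp ((u - (U + η)) / η) := by
        refine integral_mono ((bmp_scale_integrable hη0 _).const_mul _) (eA_bmp_integrable a hη0 _) fun u => ?_
        rcases le_or_gt 1 |(u - (U + η)) / η| with hb | hb
        · simp only [bmp_zero hb]; simp
        · rw [abs_div, abs_of_pos hη0, div_lt_one hη0, abs_lt] at hb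
          refine mul_le_mul_of_nonneg_right (eA_slow a hη0.le ?_ ?_) (bmp_nonneg _) <;> linarith [hb.1, hb.2]
      rw [integral_const_mul, bmp_scale_integral hη0] at h2
      linarith [le_abs_self (∫ u, eA a u * bmp ((u - (U + η)) / η))]
    have hlo : -(4 * C * (η * η)) ≤ (eA a U + 12 * η) * η := by
      have h1 := hsm (U - η) (by linarith)
      have h2 : ∫ u, eA a u * bmp ((u - (U - η)) / η) ≤ ∫ u, (eA a U + 12 * η) * bmp ((u - (U - η)) / η) := by
        refine integral_mono (eA_bmp_integrable a hη0 _) ((bmp_scale_integrable hη0 _).const_mul _) fun u => ?_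
        rcases le_or_gt 1 |(u - (U - η)) / η| with hb | hb
        · simp only [bmp_zero hb]; simp
        · rw [abs_div, abs_of_pos hη0, div_lt_one hη0, abs_lt] at hb
          refine mul_le_mul_of_nonneg_right ?_ (bmp_nonneg _)
          have := eA_slow a (U := u) (u := U) hη0.le (by linarith [hb.2]) (by linarith [hb.1])
          linarith
      rw [integral_const_mul, bmp_scale_integral hη0] at h2
      linarith [neg_abs_le (∫ u, eA a u * bmp ((u - (U - η)) / η))]
    rw [abs_le]
    constructor
    · by_contra hcon
      push Not at hcon
      nlinarith
    · by_contra hcon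
      push Not at hcon
      nlinarith
  refine ⟨(12 + 4 * C) * 4 + 7 * 16, by positivity, fun U hU => ?_⟩
  have hpos : 0 < (1 + U) ^ (-(8 / 5) : ℝ) := by positivity
  rcases le_total 3 U with h3 | h3
  · refine (hmain U h3).trans ?_
    have h1 : U ^ (-(8 / 5) : ℝ) ≤ 4 * (1 + U) ^ (-(8 / 5) : ℝ) := by
      calc U ^ (-(8 / 5) : ℝ) ≤ ((1 + U) / 2) ^ (-(8 / 5) : ℝ) :=
            Real.rpow_le_rpow_of_nonpos (by positivity) (by linarith) (by norm_num)
        _ = 2 ^ (8 / 5 : ℝ) * (1 + U) ^ (-(8 / 5) : ℝ) := by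
            rw [Real.div_rpow (by positivity) (by norm_num), Real.rpow_neg (by norm_num : (0 : ℝ) ≤ 2)]
            field_simp
        _ ≤ 4 * (1 + U) ^ (-(8 / 5) : ℝ) := by
            gcongr
            calc (2 : ℝ) ^ (8 / 5 : ℝ) ≤ 2 ^ (2 : ℝ) :=
                  Real.rpow_le_rpow_of_exponent_le (by norm_num) (by norm_num)
              _ = 4 := by norm_num
    calc _ ≤ (12 + 4 * C) * (4 * (1 + U) ^ (-(8 / 5) : ℝ)) := by gcongr
      _ ≤ _ := by nlinarith
  · refine (eA_bound a U).trans ?_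
    have h1 : 1 ≤ 16 * (1 + U) ^ (-(8 / 5) : ℝ) := by
      have h2 : (4 : ℝ) ^ (-(2 : ℝ)) ≤ (1 + U) ^ (-(8 / 5) : ℝ) := by
        calc (4 : ℝ) ^ (-(2 : ℝ)) ≤ 4 ^ (-(8 / 5) : ℝ) :=
              Real.rpow_le_rpow_of_exponent_le (by norm_num) (by norm_num)
          _ ≤ _ := Real.rpow_le_rpow_of_nonpos (by positivity) (by linarith) (by norm_num)
      rw [Real.rpow_neg (by norm_num)] at h2
      norm_num at h2
      norm_num
      linarith
    nlinarith [mul_nonneg hC hpos.le]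

lemma psiA_asymp {a : ZMod q} (ha : IsUnit a) :
    ∃ C : ℝ, 0 ≤ C ∧ ∀ x : ℝ, 1 ≤ x →
      |psiA a x - (q.totient : ℝ)⁻¹ * x| ≤ C * (x * (1 + Real.log x) ^ (-(8 / 5) : ℝ)) := by
  obtain ⟨C, hC, h⟩ := eA_decay ha
  refine ⟨C, hC, fun x hx => ?_⟩
  have hx0 : 0 < x := by linarith
  have := h (Real.log x) (Real.log_nonneg hx)
  unfold eA at this
  rw [Real.exp_neg, Real.exp_log hx0] at this
  have e : psiA a x - (q.totient : ℝ)⁻¹ * x = x * (psiA a x * x⁻¹ - (q.totient : ℝ)⁻¹) := by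
    field_simp
  rw [e, abs_mul, abs_of_pos hx0]
  calc _ ≤ x * (C * (1 + Real.log x) ^ (-(8 / 5) : ℝ)) := by gcongr
    _ = _ := by ring

end Tauber
end LandauD

namespace LandauD
set_option linter.unusedSectionVars false
set_option linter.unusedTactic false
set_option linter.unusedVariables false

section ThetaAP
open MeasureTheory Finset ArithmeticFunction.vonMangoldt

variable {q : ℕ} [NeZero q]

/-- The error function `y / (1 + log y) ^ (8/5)`. -/
noncomputable def Psi (y : ℝ) : ℝ := y * (1 + Real.log y) ^ (-(8/5) : ℝ)

lemma Psi_nonneg {y : ℝ} (hy : 1 ≤ y) : 0 ≤ Psi y := by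
  have := Real.log_nonneg hy
  unfold Psi; positivity

lemma sqrt_le_Psi {y : ℝ} (hy : 1 ≤ y) : √y ≤ 16 * Psi y := by
  have ht := Real.log_nonneg hy
  set t := Real.log y with htd
  have hy0 : 0 < y := by linarith
  have h1 : 1 + t ≤ 4 * Real.exp (t / 4) := by linarith [Real.add_one_le_exp (t / 4)]
  have h2 : (1 + t) ^ (8 / 5 : ℝ) ≤ 16 * √y := by
    calc (1 + t) ^ (8 / 5 : ℝ) ≤ (1 + t) ^ (2 : ℝ) :=
          Real.rpow_le_rpow_of_exponent_le (by linarith) (by norm_num)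
      _ = (1 + t) ^ 2 := by norm_cast
      _ ≤ (4 * Real.exp (t / 4)) ^ 2 := by gcongr
      _ = 16 * √y := by
        rw [mul_pow, ← Real.exp_nat_mul, Real.sqrt_eq_rpow, Real.rpow_def_of_pos hy0]
        rw [← htd]
        norm_num
        ring_nf
  unfold Psi
  rw [Real.rpow_neg (by linarith), ← div_eq_mul_inv, ← mul_div_assoc, le_div_iff₀ (by positivity)]
  nlinarith [Real.sqrt_nonneg y, Real.mul_self_sqrt hy0.le]

lemma log_le_Psi {y : ℝ} (hy : 1 ≤ y) : Real.log y ≤ 32 * Psi y := by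
  have h := Real.log_le_rpow_div (x := y) (by linarith) (ε := 1 / 2) (by norm_num)
  rw [← Real.sqrt_eq_rpow] at h
  linarith [sqrt_le_Psi hy]

/-- Theta function in a residue class. -/
noncomputable def thA (a : ZMod q) (y : ℝ) : ℝ :=
  ∑ p ∈ Icc 1 ⌊y⌋₊, if p.Prime ∧ (p : ZMod q) = a then Real.log p else 0

lemma psiA_sub_thA (a : ZMod q) (y : ℝ) :
    |psiA a y - thA a y| ≤ Chebyshev.psi y - Chebyshev.theta y := by
  have h1 : Chebyshev.psi y - Chebyshev.theta y = ∑ p ∈ Icc 1 ⌊y⌋₊,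
      (ArithmeticFunction.vonMangoldt p - if p.Prime then Real.log p else 0) := by
    rw [Finset.sum_sub_distrib, ← Finset.sum_filter]; rfl
  rw [h1, psiA, thA, ← Finset.sum_sub_distrib]
  refine (Finset.abs_sum_le_sum_abs _ _).trans (Finset.sum_le_sum fun n _ => ?_)
  unfold residueClass
  by_cases hn : (n : ZMod q) = a
  · rw [Set.indicator_of_mem (by simpa using hn)]
    by_cases hp : n.Prime
    · simp [hp, hn, ArithmeticFunction.vonMangoldt_apply_prime]
    · simp [hp, abs_of_nonneg ArithmeticFunction.vonMangoldt_nonneg]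
  · rw [Set.indicator_of_notMem (by simpa using hn)]
    by_cases hp : n.Prime
    · simp [hp, hn, ArithmeticFunction.vonMangoldt_apply_prime]
    · simp [hp]

lemma thA_asymp {a : ZMod q} (ha : IsUnit a) : ∃ C : ℝ, 0 ≤ C ∧ ∀ y : ℝ, 1 ≤ y →
    |thA a y - (q.totient : ℝ)⁻¹ * y| ≤ C * Psi y := by
  obtain ⟨C, hC0, hC⟩ := psiA_asymp ha
  obtain ⟨c, hc⟩ : ∃ c : ℝ, ∀ x : ℝ, 1 ≤ x → Chebyshev.psi x - Chebyshev.theta x ≤ c * √x :=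
    ⟨_, fun x _ => Chebyshev.psi_sub_theta_le_mul_sqrt.choose_spec x⟩
  refine ⟨C + |c| * 16, by positivity, fun y hy => ?_⟩
  have h1 := hC y hy
  have h2 := (psiA_sub_thA a y).trans (hc y hy)
  have h3 := sqrt_le_Psi hy
  have h4 : c * √y ≤ |c| * (16 * Psi y) :=
    (mul_le_mul_of_nonneg_right (le_abs_self c) (Real.sqrt_nonneg y)).trans (by gcongr)
  change _ ≤ C * Psi y at h1
  rw [abs_le] at *
  constructor <;> nlinarith [h1.1, h1.2, h2.1, h2.2]

/-- The prime condition. -/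
def okP (p : ℕ) : Prop := p % 8 = 1 ∨ p % 8 = 3

instance (p : ℕ) : Decidable (okP p) := by unfold okP; infer_instance

/-- Twisted theta function over primes one or three modulo eight. -/
noncomputable def thX (χ : ℕ → ℝ) (N : ℕ) : ℝ :=
  ∑ p ∈ Icc 1 N, if p.Prime ∧ okP p then χ p * Real.log p else 0

/-- The nontrivial character modulo four, as a real function. -/
noncomputable def c4 (n : ℕ) : ℝ := ((ZMod.χ₄ (n : ZMod 4) : ℤ) : ℝ)

/-- The trivial twist. -/
noncomputable def c1 (n : ℕ) : ℝ := 1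

lemma cast8 (p a : ℕ) (ha : a < 8) : ((p : ZMod 8) = (a : ZMod 8)) ↔ p % 8 = a := by
  rw [ZMod.natCast_eq_natCast_iff, Nat.ModEq, Nat.mod_eq_of_lt ha]

lemma thX_c1 (y : ℝ) : thX c1 ⌊y⌋₊ = thA (1 : ZMod 8) y + thA (3 : ZMod 8) y := by
  unfold thX thA
  rw [← Finset.sum_add_distrib]
  refine Finset.sum_congr rfl fun p _ => ?_
  have h1 := cast8 p 1 (by norm_num)
  have h3 := cast8 p 3 (by norm_num)
  simp only [Nat.cast_one, Nat.cast_ofNat] at h1 h3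
  simp only [h1, h3]
  unfold okP c1
  by_cases hp : p.Prime <;> by_cases h1 : p % 8 = 1 <;> by_cases h3 : p % 8 = 3 <;>
    simp [hp, h1, h3]

lemma thX_c4 (y : ℝ) : thX c4 ⌊y⌋₊ = thA (1 : ZMod 8) y - thA (3 : ZMod 8) y := by
  unfold thX thA
  rw [← Finset.sum_sub_distrib]
  refine Finset.sum_congr rfl fun p _ => ?_
  have h1 := cast8 p 1 (by norm_num)
  have h3 := cast8 p 3 (by norm_num)
  simp only [Nat.cast_one, Nat.cast_ofNat] at h1 h3
  simp only [h1, h3]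
  have k1 : p % 8 = 1 → c4 p = 1 := fun h => by
    unfold c4; rw [ZMod.χ₄_nat_one_mod_four (by omega)]; simp
  have k3 : p % 8 = 3 → c4 p = -1 := fun h => by
    unfold c4; rw [ZMod.χ₄_nat_three_mod_four (by omega)]; simp
  unfold okP
  by_cases hp : p.Prime <;> by_cases h1 : p % 8 = 1 <;> by_cases h3 : p % 8 = 3 <;>
    simp_all

lemma thX_asymp : ∃ C : ℝ, 0 ≤ C ∧ ∀ y : ℝ, 1 ≤ y →
    |thX c1 ⌊y⌋₊ - (1 / 2) * y| ≤ C * Psi y ∧ |thX c4 ⌊y⌋₊ - 0 * y| ≤ C * Psi y := by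
  have u1 : IsUnit (1 : ZMod 8) := isUnit_one
  have u3 : IsUnit (3 : ZMod 8) := by decide
  obtain ⟨C1, h10, h1⟩ := thA_asymp u1
  obtain ⟨C3, h30, h3⟩ := thA_asymp u3
  have ht : ((Nat.totient 8 : ℕ) : ℝ)⁻¹ = 1 / 4 := by
    have : Nat.totient 8 = 4 := by decide
    rw [this]; norm_num
  refine ⟨C1 + C3, by positivity, fun y hy => ?_⟩
  have h1 := h1 y hy
  have h3 := h3 y hy
  rw [thX_c1, thX_c4]
  rw [ht] at h1 h3
  rw [abs_le] at *
  rw [abs_le]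
  refine ⟨⟨?_, ?_⟩, ?_, ?_⟩ <;> nlinarith

end ThetaAP
end LandauD

namespace LandauD
set_option linter.unusedSectionVars false
set_option linter.unusedTactic false
set_option linter.unusedVariables false

section Elem
open Finset

/-- Squarefree numbers composed of primes one or three modulo eight. -/
def good (n : ℕ) : Prop := Squarefree n ∧ ∀ p : ℕ, p.Prime → p ∣ n → okP p

open Classical in
/-- Indicator function. -/
noncomputable def ff (n : ℕ) : ℝ := if good n then 1 else 0

lemma ff_nonneg (n : ℕ) : 0 ≤ ff n := by unfold ff; split_ifs <;> norm_num
lemma ff_le_one (n : ℕ) : ff n ≤ 1 := by unfold ff; split_ifs <;> norm_num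
lemma ff_zero : ff 0 = 0 := by
  unfold ff good; simp
lemma good_one : good 1 := ⟨squarefree_one, fun p hp h => by
  have := Nat.dvd_one.mp h; exact absurd this hp.one_lt.ne'⟩
lemma ff_one : ff 1 = 1 := by
  unfold ff; simp [good_one]

lemma ff_mul_coprime {m n : ℕ} (h : m.Coprime n) : ff (m * n) = ff m * ff n := by
  have : good (m * n) ↔ good m ∧ good n := by
    unfold good
    rw [Nat.squarefree_mul_iff]
    constructor
    · rintro ⟨⟨-, h1, h2⟩, h3⟩
      exact ⟨⟨h1, fun p hp hd => h3 p hp (hd.mul_right _)⟩,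
        ⟨h2, fun p hp hd => h3 p hp (hd.mul_left _)⟩⟩
    · rintro ⟨⟨h1, h2⟩, h3, h4⟩
      exact ⟨⟨h, h1, h3⟩, fun p hp hd => ((hp.dvd_mul).mp hd).elim (h2 p hp) (h4 p hp)⟩
  unfold ff
  by_cases h1 : good m <;> by_cases h2 : good n <;> simp [this, h1, h2]

lemma ff_prime {p : ℕ} (hp : p.Prime) : ff p = if okP p then 1 else 0 := by
  have : good p ↔ okP p := by
    unfold good
    constructor
    · exact fun h => h.2 p hp dvd_rfl
    · intro h
      refine ⟨hp.prime.squarefree, fun r hr hd => ?_⟩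
      rwa [(Nat.prime_dvd_prime_iff_eq hr hp).mp hd]
  unfold ff
  simp [this]

lemma ff_eq_zero {n : ℕ} (h : ¬ Squarefree n) : ff n = 0 := by
  unfold ff good; simp [h]

lemma ff_mul_prime {m p : ℕ} (hp : p.Prime) :
    ff (m * p) = if okP p ∧ ¬ p ∣ m then ff m else 0 := by
  by_cases hd : p ∣ m
  · simp only [hd, not_true, and_false, if_false]
    apply ff_eq_zero
    intro hs
    have := (Nat.squarefree_mul_iff.mp hs).1
    exact ((hp.coprime_iff_not_dvd).mp this.symm) hd
  · rw [ff_mul_coprime ((hp.coprime_iff_not_dvd).mpr hd).symm, ff_prime hp]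
    by_cases h : okP p <;> simp [h, hd]

lemma sum_divAnti (F : ℕ → ℕ → ℝ) (N : ℕ) :
    ∑ n ∈ Icc 1 N, ∑ x ∈ n.divisorsAntidiagonal, F x.1 x.2
      = ∑ m ∈ Icc 1 N, ∑ p ∈ Icc 1 (N / m), F m p := by
  rw [Finset.sum_sigma', Finset.sum_sigma']
  refine Finset.sum_bij' (fun x _ => ⟨x.2.1, x.2.2⟩) (fun x _ => ⟨x.1 * x.2, (x.1, x.2)⟩)
    ?_ ?_ ?_ ?_ ?_
  · rintro ⟨n, a, b⟩ h
    simp only [mem_sigma, mem_Icc, Nat.mem_divisorsAntidiagonal] at h ⊢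
    obtain ⟨⟨h1, h2⟩, rfl, h3⟩ := h
    have ha : 0 < a := Nat.pos_of_ne_zero (by rintro rfl; simp at h3)
    have hb : 0 < b := Nat.pos_of_ne_zero (by rintro rfl; simp at h3)
    refine ⟨⟨ha, le_trans (Nat.le_mul_of_pos_right a hb) h2⟩, hb, ?_⟩
    rw [Nat.le_div_iff_mul_le ha, mul_comm]; exact h2
  · rintro ⟨a, b⟩ h
    simp only [mem_sigma, mem_Icc, Nat.mem_divisorsAntidiagonal] at h ⊢
    obtain ⟨⟨h1, h2⟩, h3, h4⟩ := h
    rw [Nat.le_div_iff_mul_le h1, mul_comm] at h4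
    have : 0 < a * b := Nat.mul_pos h1 h3
    exact ⟨⟨this, h4⟩, trivial, this.ne'⟩
  · rintro ⟨n, a, b⟩ h
    simp only [mem_sigma, mem_Icc, Nat.mem_divisorsAntidiagonal] at h ⊢
    obtain ⟨⟨h1, h2⟩, rfl, h3⟩ := h
    rfl
  · rintro ⟨a, b⟩ h
    rfl
  · rintro ⟨n, a, b⟩ h
    rfl

lemma ff_log (χ : ℕ → ℝ) {n : ℕ} :
    ff n * χ n * Real.log n = ∑ x ∈ n.divisorsAntidiagonal,
      if x.2.Prime then ff (x.1 * x.2) * χ (x.1 * x.2) * Real.log x.2 else 0 := by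
  by_cases hs : Squarefree n
  · rw [← ArithmeticFunction.vonMangoldt_sum, Finset.mul_sum,
      Nat.sum_divisorsAntidiagonal' (f := fun a b => if b.Prime then ff (a * b) * χ (a * b) * Real.log b else 0)]
    refine Finset.sum_congr rfl fun d hd => ?_
    have hdn := Nat.dvd_of_mem_divisors hd
    rw [Nat.div_mul_cancel hdn]
    by_cases hp : d.Prime
    · rw [ArithmeticFunction.vonMangoldt_apply_prime hp]; simp [hp]
    · rw [ArithmeticFunction.vonMangoldt_eq_zero_iff.mpr]
      · simp [hp]
      · intro hpp
        have hsd := hs.squarefree_of_dvd hdn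
        rw [isPrimePow_nat_iff] at hpp
        obtain ⟨p, k, hp', hk, rfl⟩ := hpp
        rw [Nat.squarefree_pow_iff hp'.ne_one hk.ne'] at hsd
        rw [hsd.2, pow_one] at hp
        exact hp hp'
  · rw [ff_eq_zero hs, zero_mul, zero_mul]
    symm
    refine Finset.sum_eq_zero fun x hx => ?_
    rw [(Nat.mem_divisorsAntidiagonal.mp hx).1, ff_eq_zero hs]; simp

lemma log_identity (χ : ℕ → ℝ) (hχm : ∀ m n, χ (m * n) = χ m * χ n) (hχ1 : ∀ n, |χ n| ≤ 1) (N : ℕ) :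
    |∑ n ∈ Icc 1 N, ff n * χ n * Real.log n - ∑ m ∈ Icc 1 N, ff m * χ m * thX χ (N / m)|
      ≤ ∑ k ∈ Icc 1 N, ff k * (Real.log 4 * √((N : ℝ) / k)) := by
  have h1 : ∑ n ∈ Icc 1 N, ff n * χ n * Real.log n = ∑ m ∈ Icc 1 N, ∑ p ∈ Icc 1 (N / m),
      if p.Prime then ff (m * p) * χ (m * p) * Real.log p else 0 := by
    rw [← sum_divAnti (fun m p => if p.Prime then ff (m * p) * χ (m * p) * Real.log p else 0)]
    exact Finset.sum_congr rfl fun n _ => ff_log χ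
  have hlog : ∀ p : ℕ, 0 ≤ Real.log p := fun p => Real.log_natCast_nonneg p
  -- the correction
  have h2 : |∑ n ∈ Icc 1 N, ff n * χ n * Real.log n - ∑ m ∈ Icc 1 N, ff m * χ m * thX χ (N / m)|
      ≤ ∑ m ∈ Icc 1 N, ∑ p ∈ Icc 1 (N / m), if p.Prime ∧ p ∣ m then ff m * Real.log p else 0 := by
    rw [h1, ← Finset.sum_sub_distrib]
    refine (Finset.abs_sum_le_sum_abs _ _).trans (Finset.sum_le_sum fun m _ => ?_)
    rw [thX, Finset.mul_sum, ← Finset.sum_sub_distrib]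
    refine (Finset.abs_sum_le_sum_abs _ _).trans (Finset.sum_le_sum fun p _ => ?_)
    by_cases hp : p.Prime
    · rw [ff_mul_prime hp]
      by_cases hd : p ∣ m
      · by_cases hok : okP p
        · simp only [hp, hd, hok, not_true, and_false, if_false, if_true, and_true, zero_mul, zero_sub]
          rw [abs_neg, abs_mul, abs_mul, abs_mul, abs_of_nonneg (ff_nonneg m), abs_of_nonneg (hlog p)]
          have := hχ1 m
          have := hχ1 p
          have h5 : |χ m| * |χ p| ≤ 1 := mul_le_one₀ (hχ1 m) (abs_nonneg _) (hχ1 p)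
          have h6 := mul_nonneg (ff_nonneg m) (hlog p)
          nlinarith
        · simp only [hp, hd, hok]
          have h6 := mul_nonneg (ff_nonneg m) (hlog p)
          simpa using h6
      · by_cases hok : okP p
        · simp only [hp, hd, hok, if_true, not_false_iff, and_true, and_false, if_false, hχm]
          apply le_of_eq
          rw [abs_eq_zero]; ring
        · simp [hp, hd, hok]
    · simp [hp]
  refine h2.trans ?_
  -- reindex
  have h3 : ∑ m ∈ Icc 1 N, ∑ p ∈ Icc 1 (N / m), (if p.Prime ∧ p ∣ m then ff m * Real.log p else 0)
      = ∑ m ∈ Icc 1 N, ∑ x ∈ m.divisorsAntidiagonal,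
        if x.2.Prime ∧ x.2 ≤ N / (x.1 * x.2) then ff (x.1 * x.2) * Real.log x.2 else 0 := by
    refine Finset.sum_congr rfl fun m hm => ?_
    have hm0 : m ≠ 0 := by have := (mem_Icc.mp hm).1; omega
    rw [Nat.sum_divisorsAntidiagonal' (f := fun a b => if b.Prime ∧ b ≤ N / (a * b) then ff (a * b) * Real.log b else 0),
      ← Finset.sum_filter, ← Finset.sum_filter]
    refine Finset.sum_congr_of_eq_on_inter ?_ ?_ ?_
    · intro p hp hp'
      exfalso
      simp only [mem_filter, mem_Icc, Nat.mem_divisors, not_and] at hp hp'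
      refine hp' ⟨hp.2.2, hm0⟩ hp.2.1 ?_
      rw [Nat.div_mul_cancel hp.2.2]; exact hp.1.2
    · intro p hp hp'
      exfalso
      simp only [mem_filter, mem_Icc, Nat.mem_divisors, not_and] at hp hp'
      have := hp.2.2
      rw [Nat.div_mul_cancel hp.1.1] at this
      exact hp' ⟨hp.2.1.pos, this⟩ hp.2.1 hp.1.1
    · intro p hp hp'
      simp only [mem_filter, mem_Icc, Nat.mem_divisors] at hp hp'
      rw [Nat.div_mul_cancel hp'.1.1]
  rw [h3, sum_divAnti (fun a b => if b.Prime ∧ b ≤ N / (a * b) then ff (a * b) * Real.log b else 0)]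
  refine Finset.sum_le_sum fun k hk => ?_
  have hk1 : 1 ≤ k := (mem_Icc.mp hk).1
  have hk0 : (0 : ℝ) < k := by exact_mod_cast hk1
  have h4 : ∑ p ∈ Icc 1 (N / k), (if p.Prime ∧ p ≤ N / (k * p) then ff (k * p) * Real.log p else 0)
      ≤ ff k * Chebyshev.theta (√((N : ℝ) / k)) := by
    unfold Chebyshev.theta
    rw [Finset.mul_sum, ← Finset.sum_filter]
    have hsub : {p ∈ Icc 1 (N / k) | p.Prime ∧ p ≤ N / (k * p)} ⊆
        {p ∈ Ioc 0 ⌊√((N : ℝ) / k)⌋₊ | p.Prime} := by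
      intro p hp
      simp only [mem_filter, mem_Icc, mem_Ioc] at hp ⊢
      refine ⟨⟨hp.2.1.pos, ?_⟩, hp.2.1⟩
      apply Nat.le_floor
      apply Real.le_sqrt_of_sq_le
      rw [le_div_iff₀ hk0]
      have := hp.2.2
      rw [Nat.le_div_iff_mul_le (Nat.mul_pos hk1 hp.2.1.pos)] at this
      have h7 : (p : ℝ) * (k * p) ≤ N := by exact_mod_cast this
      nlinarith
    refine (Finset.sum_le_sum (g := fun p : ℕ => ff k * Real.log p) fun p hp => ?_).trans
      (Finset.sum_le_sum_of_subset_of_nonneg hsub fun p _ _ => mul_nonneg (ff_nonneg k) (hlog p))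
    refine mul_le_mul_of_nonneg_right ?_ (hlog p)
    rw [ff_mul_prime (mem_filter.mp hp).2.1]
    split_ifs
    · exact le_rfl
    · exact ff_nonneg k
  refine h4.trans ?_
  exact mul_le_mul_of_nonneg_left (Chebyshev.theta_le_log4_mul_x (Real.sqrt_nonneg _)) (ff_nonneg k)

end Elem
end LandauD

namespace LandauD
set_option linter.unusedSectionVars false
set_option linter.unusedTactic false
set_option linter.unusedVariables false

section Euler
open Finset

/-- The Dirichlet series of `ff`. -/
noncomputable def FF (s : ℝ) : ℝ := ∑' n : ℕ, ff n * (n : ℝ) ^ (-s)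

lemma FF_summable {s : ℝ} (hs : 1 < s) : Summable fun n : ℕ => ff n * (n : ℝ) ^ (-s) := by
  refine Summable.of_nonneg_of_le (fun n => mul_nonneg (ff_nonneg n) (by positivity))
    (fun n => ?_) (Real.summable_nat_rpow.mpr (by linarith : -s < -1))
  exact mul_le_of_le_one_left (by positivity) (ff_le_one n)

lemma FF_local (p : Nat.Primes) (s : ℝ) :
    ∑' e : ℕ, ff ((p : ℕ) ^ e) * (((p : ℕ) ^ e : ℕ) : ℝ) ^ (-s)
      = 1 + ff p * ((p : ℕ) : ℝ) ^ (-s) := by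
  rw [tsum_eq_sum (s := {0, 1})]
  · rw [Finset.sum_pair (by norm_num)]
    simp [ff_one]
  · intro e he
    have : ff ((p : ℕ) ^ e) = 0 := by
      apply ff_eq_zero
      intro hsq
      simp only [mem_insert, mem_singleton, not_or] at he
      rw [Nat.squarefree_pow_iff p.2.ne_one he.1] at hsq
      exact he.2 hsq.2
    simp [this]

lemma FF_euler {s : ℝ} (hs : 1 < s) :
    HasProd (fun p : Nat.Primes => 1 + ff p * ((p : ℕ) : ℝ) ^ (-s)) (FF s) := by
  have h := EulerProduct.eulerProduct_hasProd (f := fun n : ℕ => ff n * (n : ℝ) ^ (-s))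
    (by simp [ff_one]) (fun {m n} hmn => by
      rw [ff_mul_coprime hmn, Nat.cast_mul, Real.mul_rpow (by positivity) (by positivity)]; ring)
    (by simpa using (FF_summable hs).abs) (by simp [ff_zero])
  unfold FF
  have hEq : ∀ p : Nat.Primes, ∑' e : ℕ, ff ((p : ℕ) ^ e) * (((p : ℕ) ^ e : ℕ) : ℝ) ^ (-s)
      = 1 + ff p * ((p : ℕ) : ℝ) ^ (-s) := by
    intro p
    exact FF_local p s
  simp only [hEq] at h
  exact h

lemma jac_iff {p : ℕ} (hp : p.Prime) (h2 : p ≠ 2) : jacobiSym (-2) p = 1 ↔ okP p := by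
  have hodd : p % 2 = 1 := (hp.eq_two_or_odd).resolve_left h2
  rw [jacobiSym.at_neg_two (Nat.odd_iff.mpr hodd), ZMod.χ₈'_nat_eq_if_mod_eight]
  unfold okP
  have : p % 8 = 1 ∨ p % 8 = 3 ∨ p % 8 = 5 ∨ p % 8 = 7 := by omega
  rcases this with h | h | h | h <;> simp [h] <;> omega

lemma prod_eq {s : ℝ} (hs : 1 < s) :
    ∏' p : {p : ℕ // p.Prime ∧ (p = 2 ∨ jacobiSym (-2) p = 1)}, (1 + (p.1 : ℝ) ^ (-s))
      = (1 + 2 ^ (-s)) * FF s := by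
  apply HasProd.tprod_eq
  let p2 : Nat.Primes := ⟨2, Nat.prime_two⟩
  have h1 := (hasProd_ite_eq p2 ((1 : ℝ) + 2 ^ (-s))).mul (FF_euler hs)
  let g : {p : ℕ // p.Prime ∧ (p = 2 ∨ jacobiSym (-2) p = 1)} → Nat.Primes := fun p => ⟨p.1, p.2.1⟩
  have hg : Function.Injective g := by
    intro a b hab
    have := congrArg Subtype.val hab
    exact Subtype.ext this
  have key : ∀ p : Nat.Primes, (if p = p2 then ((1 : ℝ) + 2 ^ (-s)) else 1) *
      (1 + ff p * ((p : ℕ) : ℝ) ^ (-s)) = if (p : ℕ) = 2 ∨ jacobiSym (-2) p = 1 then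
        1 + ((p : ℕ) : ℝ) ^ (-s) else 1 := by
    intro p
    by_cases h : p = p2
    · subst h
      have : ff 2 = 0 := by
        rw [ff_prime Nat.prime_two]; simp [okP]
      rw [if_pos rfl]
      change (1 + (2 : ℝ) ^ (-s)) * (1 + ff 2 * ((2 : ℕ) : ℝ) ^ (-s)) = _
      rw [if_pos (Or.inl rfl), this]
      change _ = 1 + ((2 : ℕ) : ℝ) ^ (-s)
      simp
    · have h' : (p : ℕ) ≠ 2 := fun hh => h (Subtype.ext hh)
      rw [if_neg h, one_mul, ff_prime p.2]
      have hj := jac_iff p.2 h'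
      by_cases hok : okP p <;> simp [hok, h', hj]
  rw [← hg.hasProd_iff] at h1
  · convert h1 using 1
    funext p
    simp only [Function.comp]
    rw [key, if_pos p.2.2]
  · intro p hp
    rw [key, if_neg]
    intro hh
    exact hp ⟨⟨p.1, p.2, hh⟩, rfl⟩

lemma FF_tendsto {Cm : ℝ} (hC : Tendsto
      (fun s : ℝ => Real.sqrt (s - 1) *
        ∏' p : {p : ℕ // p.Prime ∧ (p = 2 ∨ jacobiSym (-2) p = 1)}, (1 + (p.1 : ℝ) ^ (-s)))
      (nhdsWithin 1 (Set.Ioi 1)) (nhds (Real.sqrt Real.pi * Cm))) :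
    Tendsto (fun s : ℝ => √(s - 1) * FF s) (nhdsWithin 1 (Set.Ioi 1))
      (nhds (√Real.pi * Cm * (2 / 3))) := by
  have h1 : Tendsto (fun s : ℝ => (1 + (2 : ℝ) ^ (-s))⁻¹) (nhdsWithin 1 (Set.Ioi 1)) (nhds (2 / 3)) := by
    have : ContinuousAt (fun s : ℝ => (1 + (2 : ℝ) ^ (-s))⁻¹) 1 := by
      refine ContinuousAt.inv₀ ?_ (by positivity)
      refine continuousAt_const.add ?_
      exact ContinuousAt.rpow continuousAt_const continuousAt_neg (Or.inl (by norm_num))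
    have h2 := this.tendsto.mono_left (nhdsWithin_le_nhds (s := Set.Ioi 1))
    convert h2 using 2
    rw [Real.rpow_neg_one]; norm_num
  refine (hC.mul h1).congr' ?_
  filter_upwards [self_mem_nhdsWithin] with s hs
  rw [prod_eq hs]
  have : (1 + (2 : ℝ) ^ (-s)) ≠ 0 := by positivity
  field_simp

lemma FF_nonneg (s : ℝ) : 0 ≤ FF s := tsum_nonneg fun n => mul_nonneg (ff_nonneg n) (by positivity)

lemma FF_anti {s t : ℝ} (hs : 1 < s) (hst : s ≤ t) : FF t ≤ FF s := by
  refine Summable.tsum_le_tsum (fun n => ?_) (FF_summable (hs.trans_le hst)) (FF_summable hs)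
  rcases Nat.eq_zero_or_pos n with rfl | hn
  · simp [ff_zero]
  · refine mul_le_mul_of_nonneg_left ?_ (ff_nonneg n)
    exact Real.rpow_le_rpow_of_exponent_le (by exact_mod_cast hn) (by linarith)

lemma FF_bound {L : ℝ} (hF : Tendsto (fun s : ℝ => √(s - 1) * FF s) (nhdsWithin 1 (Set.Ioi 1)) (nhds L)) :
    ∃ C : ℝ, 0 ≤ C ∧ ∀ s, 1 < s → s ≤ 2 → √(s - 1) * FF s ≤ C := by
  have h1 : ∀ᶠ s in nhdsWithin (1 : ℝ) (Set.Ioi 1), √(s - 1) * FF s < L + 1 :=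
    hF.eventually (gt_mem_nhds (by linarith))
  obtain ⟨u, hu, hu'⟩ := (mem_nhdsGT_iff_exists_Ioo_subset).mp h1
  have hu1 : 1 < u := hu
  refine ⟨|L + 1| + FF u, by have := FF_nonneg u; positivity, fun s hs hs2 => ?_⟩
  have hFu := FF_nonneg u
  by_cases h : s < u
  · have : √(s - 1) * FF s < L + 1 := hu' ⟨hs, h⟩
    linarith [le_abs_self (L + 1)]
  · have h2 := FF_anti hu1 (not_lt.mp h)
    have h3 : √(s - 1) ≤ 1 := Real.sqrt_le_one.mpr (by linarith)
    have h4 := FF_nonneg s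
    have := abs_nonneg (L + 1)
    nlinarith [Real.sqrt_nonneg (s - 1)]

/-- Logarithmic sum of `ff`. -/
noncomputable def TT (x : ℝ) : ℝ := ∑ n ∈ Icc 1 ⌊x⌋₊, ff n / n

/-- Counting function of `ff`. -/
noncomputable def SS (x : ℝ) : ℝ := ∑ n ∈ Icc 1 ⌊x⌋₊, ff n

lemma SS_nonneg (x : ℝ) : 0 ≤ SS x := Finset.sum_nonneg fun n _ => ff_nonneg n

lemma TT_bound {L : ℝ} (hF : Tendsto (fun s : ℝ => √(s - 1) * FF s) (nhdsWithin 1 (Set.Ioi 1)) (nhds L)) :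
    ∃ C : ℝ, 0 ≤ C ∧ ∀ x : ℝ, 1 ≤ x → TT x ≤ C * √(1 + Real.log x) := by
  obtain ⟨C, hC0, hC⟩ := FF_bound hF
  refine ⟨Real.exp 1 * C, by positivity, fun x hx => ?_⟩
  have hl := Real.log_nonneg hx
  set l := 1 + Real.log x with hld
  have hl1 : 1 ≤ l := by linarith
  have hl0 : 0 < l := by linarith
  have hs : 1 < 1 + 1 / l := by have : 0 < 1 / l := by positivity
                                linarith
  have hs2 : 1 + 1 / l ≤ 2 := by
    have : 1 / l ≤ 1 := by rw [div_le_one hl0]; exact hl1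
    linarith
  have h1 := hC _ hs hs2
  have h2 : FF (1 + 1 / l) ≤ C * √l := by
    rw [add_sub_cancel_left, Real.sqrt_div (by norm_num), Real.sqrt_one, one_div,
      inv_mul_le_iff₀ (Real.sqrt_pos.mpr hl0)] at h1
    linarith
  have h3 : TT x ≤ Real.exp 1 * FF (1 + 1 / l) := by
    unfold TT FF
    rw [← tsum_mul_left]
    refine (Finset.sum_le_sum fun n hn => ?_).trans
      (Summable.sum_le_tsum (Icc 1 ⌊x⌋₊) (fun n _ => ?_) ((FF_summable hs).mul_left _))
    · have hn1 : 1 ≤ n := (mem_Icc.mp hn).1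
      have hnx : (n : ℝ) ≤ x := (Nat.le_floor_iff (by linarith)).mp (mem_Icc.mp hn).2
      have hn0 : (0 : ℝ) < n := by exact_mod_cast hn1
      rw [neg_add, Real.rpow_add hn0, Real.rpow_neg_one, div_eq_mul_inv]
      have h5 : 1 ≤ Real.exp 1 * (n : ℝ) ^ (-(1 / l)) := by
        rw [Real.rpow_def_of_pos hn0, ← Real.exp_add]
        apply Real.one_le_exp
        have h6 : Real.log n ≤ l := by linarith [Real.log_le_log hn0 hnx]
        have : Real.log n / l ≤ 1 := by rw [div_le_one hl0]; exact h6
        have : Real.log n * -(1 / l) = -(Real.log n / l) := by ring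
        linarith
      have h7 : 0 ≤ ff n * (n : ℝ)⁻¹ := mul_nonneg (ff_nonneg n) (by positivity)
      nlinarith
    · exact mul_nonneg (Real.exp_pos _).le (mul_nonneg (ff_nonneg n) (by positivity))
  calc TT x ≤ _ := h3
    _ ≤ Real.exp 1 * (C * √l) := by gcongr
    _ = _ := by ring

end Euler
end LandauD

namespace LandauD
set_option linter.unusedSectionVars false
set_option linter.unusedTactic false
set_option linter.unusedVariables false

section VSec
open Finset

/-- The error sum. -/
noncomputable def VV (x : ℝ) : ℝ := ∑ m ∈ Icc 1 ⌊x⌋₊, ff m * Psi (x / m)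

lemma mem_facts {x : ℝ} (hx : 1 ≤ x) {m : ℕ} (hm : m ∈ Icc 1 ⌊x⌋₊) :
    (0 : ℝ) < m ∧ (m : ℝ) ≤ x ∧ 1 ≤ x / m := by
  have h0 : (0 : ℝ) < m := by exact_mod_cast (mem_Icc.mp hm).1
  have h1 : (m : ℝ) ≤ x := (Nat.le_floor_iff (by linarith)).mp (mem_Icc.mp hm).2
  exact ⟨h0, h1, by rwa [le_div_iff₀ h0, one_mul]⟩

lemma Psi_le {y : ℝ} (hy : 1 ≤ y) : Psi y ≤ y := by
  have := Real.log_nonneg hy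
  unfold Psi
  refine mul_le_of_le_one_right (by linarith) ?_
  exact Real.rpow_le_one_of_one_le_of_nonpos (by linarith) (by norm_num)

lemma VV_le {x : ℝ} (hx : 1 ≤ x) : VV x ≤ x * TT x := by
  unfold VV TT
  rw [Finset.mul_sum]
  refine Finset.sum_le_sum fun m hm => ?_
  obtain ⟨h0, h1, h2⟩ := mem_facts hx hm
  have := mul_le_mul_of_nonneg_left (Psi_le h2) (ff_nonneg m)
  calc _ ≤ _ := this
    _ = _ := by ring

lemma VV_nonneg {x : ℝ} (hx : 1 ≤ x) : 0 ≤ VV x :=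
  Finset.sum_nonneg fun m hm => mul_nonneg (ff_nonneg m) (Psi_nonneg (mem_facts hx hm).2.2)

lemma SS_le {x : ℝ} (hx : 1 ≤ x) : SS x ≤ x * TT x := by
  unfold SS TT
  rw [Finset.mul_sum]
  refine Finset.sum_le_sum fun m hm => ?_
  obtain ⟨h0, h1, h2⟩ := mem_facts hx hm
  calc ff m = ff m * 1 := by ring
    _ ≤ ff m * (x / m) := mul_le_mul_of_nonneg_left h2 (ff_nonneg m)
    _ = _ := by ring

lemma log_main (χ : ℕ → ℝ) (hχm : ∀ m n, χ (m * n) = χ m * χ n) (hχ1 : ∀ n, |χ n| ≤ 1) (κ C : ℝ)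
    (hC : ∀ y : ℝ, 1 ≤ y → |thX χ ⌊y⌋₊ - κ * y| ≤ C * Psi y) {x : ℝ} (hx : 1 ≤ x) :
    |Real.log x * ∑ n ∈ Icc 1 ⌊x⌋₊, ff n * χ n - κ * x * ∑ n ∈ Icc 1 ⌊x⌋₊, ff n * χ n / n|
      ≤ (32 + C + Real.log 4 * 16) * VV x := by
  have h1 := log_identity χ hχm hχ1 ⌊x⌋₊
  have hfc : ∀ n, |ff n * χ n| ≤ ff n := fun n => by
    rw [abs_mul, abs_of_nonneg (ff_nonneg n)]
    exact mul_le_of_le_one_right (ff_nonneg n) (hχ1 n)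
  have hl4 : 0 ≤ Real.log 4 := Real.log_nonneg (by norm_num)
  have h2 : ∑ k ∈ Icc 1 ⌊x⌋₊, ff k * (Real.log 4 * √((⌊x⌋₊ : ℝ) / k)) ≤ Real.log 4 * 16 * VV x := by
    unfold VV
    rw [Finset.mul_sum]
    refine Finset.sum_le_sum fun m hm => ?_
    obtain ⟨h0, h1, h2⟩ := mem_facts hx hm
    have h3 : √((⌊x⌋₊ : ℝ) / m) ≤ 16 * Psi (x / m) :=
      (Real.sqrt_le_sqrt (div_le_div_of_nonneg_right (Nat.floor_le (by linarith)) h0.le)).trans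
        (sqrt_le_Psi h2)
    calc _ ≤ ff m * (Real.log 4 * (16 * Psi (x / m))) := by
          have := ff_nonneg m
          gcongr
      _ = _ := by ring
  have h3 : |∑ m ∈ Icc 1 ⌊x⌋₊, ff m * χ m * thX χ (⌊x⌋₊ / m)
      - κ * x * ∑ n ∈ Icc 1 ⌊x⌋₊, ff n * χ n / n| ≤ C * VV x := by
    unfold VV
    rw [Finset.mul_sum, Finset.mul_sum, ← Finset.sum_sub_distrib]
    refine (Finset.abs_sum_le_sum_abs _ _).trans (Finset.sum_le_sum fun m hm => ?_)
    obtain ⟨h0, h1, h2⟩ := mem_facts hx hm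
    have h4 := hC _ h2
    rw [Nat.floor_div_natCast] at h4
    calc |ff m * χ m * thX χ (⌊x⌋₊ / m) - κ * x * (ff m * χ m / m)|
        = |ff m * χ m| * |thX χ (⌊x⌋₊ / m) - κ * (x / m)| := by rw [← abs_mul]; congr 1; ring
      _ ≤ ff m * (C * Psi (x / m)) :=
          mul_le_mul (hfc m) h4 (abs_nonneg _) (ff_nonneg m)
      _ = _ := by ring
  have h4 : |Real.log x * ∑ n ∈ Icc 1 ⌊x⌋₊, ff n * χ n - ∑ n ∈ Icc 1 ⌊x⌋₊, ff n * χ n * Real.log n|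
      ≤ 32 * VV x := by
    unfold VV
    rw [Finset.mul_sum, Finset.mul_sum, ← Finset.sum_sub_distrib]
    refine (Finset.abs_sum_le_sum_abs _ _).trans (Finset.sum_le_sum fun m hm => ?_)
    obtain ⟨h0, h1, h2⟩ := mem_facts hx hm
    have h5 : Real.log x - Real.log m = Real.log (x / m) := by
      rw [Real.log_div (by linarith) h0.ne']
    calc |Real.log x * (ff m * χ m) - ff m * χ m * Real.log m|
        = |ff m * χ m| * |Real.log (x / m)| := by rw [← abs_mul, ← h5]; congr 1; ring
      _ ≤ ff m * (32 * Psi (x / m)) := by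
          rw [abs_of_nonneg (Real.log_nonneg h2)]
          exact mul_le_mul (hfc m) (log_le_Psi h2) (Real.log_nonneg h2) (ff_nonneg m)
      _ = _ := by ring
  have h5 := h1.trans h2
  rw [abs_le] at *
  constructor <;> linarith [h3.1, h3.2, h4.1, h4.2, h5.1, h5.2]

lemma c1_mul (m n : ℕ) : c1 (m * n) = c1 m * c1 n := by simp [c1]
lemma c1_abs (n : ℕ) : |c1 n| ≤ 1 := by simp [c1]
lemma c4_mul (m n : ℕ) : c4 (m * n) = c4 m * c4 n := by
  unfold c4; rw [Nat.cast_mul, map_mul, Int.cast_mul]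
lemma c4_abs (n : ℕ) : |c4 n| ≤ 1 := by
  unfold c4
  have : ∀ a : ZMod 4, |ZMod.χ₄ a| ≤ 1 := by decide
  exact_mod_cast this n

/-- Twisted counting function. -/
noncomputable def GG (x : ℝ) : ℝ := ∑ n ∈ Icc 1 ⌊x⌋₊, ff n * c4 n

lemma main_ests : ∃ C : ℝ, 0 ≤ C ∧ ∀ x : ℝ, 1 ≤ x →
    |Real.log x * SS x - (1 / 2) * x * TT x| ≤ C * VV x ∧ |Real.log x * GG x| ≤ C * VV x := by
  obtain ⟨C, hC0, hC⟩ := thX_asymp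
  refine ⟨32 + C + Real.log 4 * 16, ?_, fun x hx => ?_⟩
  · have : 0 ≤ Real.log 4 := Real.log_nonneg (by norm_num)
    positivity
  have h1 := log_main c1 c1_mul c1_abs (1 / 2) C (fun y hy => (hC y hy).1) hx
  have h2 := log_main c4 c4_mul c4_abs 0 C (fun y hy => (hC y hy).2) hx
  simp only [c1, mul_one] at h1
  simp only [zero_mul, sub_zero] at h2
  exact ⟨h1, h2⟩

lemma SS_bound {K : ℝ} (hK0 : 0 ≤ K) (hK : ∀ x : ℝ, 1 ≤ x → TT x ≤ K * √(1 + Real.log x)) :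
    ∃ C : ℝ, 0 ≤ C ∧ ∀ x : ℝ, 1 ≤ x → SS x ≤ C * (x * (1 + Real.log x) ^ (-(1/2) : ℝ)) := by
  obtain ⟨C, hC0, hC⟩ := main_ests
  refine ⟨(C + 3 / 2) * K, by positivity, fun x hx => ?_⟩
  have hl := Real.log_nonneg hx
  have h1 := (hC x hx).1
  have h2 := VV_le hx
  have h3 := SS_le hx
  have h4 := hK x hx
  set l := 1 + Real.log x with hld
  have hl0 : 0 < l := by linarith
  have h5 : l * SS x ≤ (C + 3 / 2) * (x * TT x) := by
    have := (abs_le.mp h1).2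
    nlinarith
  have h6 : l * SS x ≤ (C + 3 / 2) * (x * (K * √l)) := h5.trans (by gcongr)
  rw [Real.rpow_neg hl0.le, ← Real.sqrt_eq_rpow]
  have hs := Real.sqrt_pos.mpr hl0
  have hss := Real.mul_self_sqrt hl0.le
  have h7 : √l * SS x ≤ (C + 3 / 2) * (x * K) := by
    have : √l * (√l * SS x) ≤ √l * ((C + 3 / 2) * (x * K)) := by
      rw [← mul_assoc, hss]; linarith
    exact le_of_mul_le_mul_left this hs
  rw [← div_eq_mul_inv, ← mul_div_assoc, le_div_iff₀ hs]
  linarith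

lemma Psi_dyadic {y : ℝ} (hy : 1 ≤ y) (J : ℕ) (hJ : y < 2 ^ J) :
    Psi y ≤ 8 * ∑ j ∈ range J, if (2 : ℝ) ^ j ≤ y then (2 : ℝ) ^ j * (1 + (j : ℝ)) ^ (-(8/5) : ℝ) else 0 := by
  obtain ⟨j, hj1, hj2⟩ := exists_nat_pow_near hy (by norm_num : (1 : ℝ) < 2)
  have hjJ : j < J := by
    have : (2 : ℝ) ^ j < 2 ^ J := lt_of_le_of_lt hj1 hJ
    exact (pow_lt_pow_iff_right₀ (by norm_num)).mp this
  have hlog : (1 + (j : ℝ)) / 2 ≤ 1 + Real.log y := by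
    have h1 : Real.log ((2 : ℝ) ^ j) ≤ Real.log y := Real.log_le_log (by positivity) hj1
    rw [Real.log_pow] at h1
    have h2 := Real.log_two_gt_d9
    have : (0 : ℝ) ≤ j := Nat.cast_nonneg j
    nlinarith
  have h1 : Psi y ≤ 8 * ((2 : ℝ) ^ j * (1 + (j : ℝ)) ^ (-(8/5) : ℝ)) := by
    unfold Psi
    have h2 : (1 + Real.log y) ^ (-(8/5) : ℝ) ≤ 4 * (1 + (j : ℝ)) ^ (-(8/5) : ℝ) := by
      calc (1 + Real.log y) ^ (-(8/5) : ℝ) ≤ ((1 + (j : ℝ)) / 2) ^ (-(8/5) : ℝ) :=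
            Real.rpow_le_rpow_of_nonpos (by positivity) hlog (by norm_num)
        _ = 2 ^ (8/5 : ℝ) * (1 + (j : ℝ)) ^ (-(8/5) : ℝ) := by
            rw [Real.div_rpow (by positivity) (by norm_num), Real.rpow_neg (by norm_num : (0 : ℝ) ≤ 2)]
            field_simp
        _ ≤ 2 ^ (2 : ℝ) * (1 + (j : ℝ)) ^ (-(8/5) : ℝ) := by
            gcongr <;> norm_num
        _ = _ := by norm_num
    calc y * (1 + Real.log y) ^ (-(8/5) : ℝ) ≤ 2 ^ (j + 1) * (4 * (1 + (j : ℝ)) ^ (-(8/5) : ℝ)) := by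
          have : 0 ≤ Real.log y := Real.log_nonneg hy
          gcongr
      _ = _ := by ring
  refine h1.trans (mul_le_mul_of_nonneg_left ?_ (by norm_num))
  have h3 := Finset.single_le_sum (f := fun j : ℕ => if (2 : ℝ) ^ j ≤ y then (2 : ℝ) ^ j * (1 + (j : ℝ)) ^ (-(8/5) : ℝ) else 0)
    (fun i _ => by split_ifs <;> positivity) (mem_range.mpr hjJ)
  simpa only [hj1, if_true] using h3

lemma VV_bound {K : ℝ} (hK0 : 0 ≤ K) 
    (hK : ∀ x : ℝ, 1 ≤ x → SS x ≤ K * (x * (1 + Real.log x) ^ (-(1/2) : ℝ))) :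
    ∃ C : ℝ, 0 ≤ C ∧ ∀ x : ℝ, 1 ≤ x → VV x ≤ C * (x * (1 + Real.log x) ^ (-(1/2) : ℝ)) := by
  have hsum : Summable fun j : ℕ => (1 + (j : ℝ)) ^ (-(11/10) : ℝ) := by
    have := (summable_nat_add_iff 1).mpr (Real.summable_nat_rpow.mpr (by norm_num : (-(11/10) : ℝ) < -1))
    refine this.congr fun j => ?_
    push_cast; rw [add_comm]
  refine ⟨8 * K * ∑' j : ℕ, (1 + (j : ℝ)) ^ (-(11/10) : ℝ), ?_, fun x hx => ?_⟩
  · have : 0 ≤ ∑' j : ℕ, (1 + (j : ℝ)) ^ (-(11/10) : ℝ) := tsum_nonneg fun j => by positivity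
    positivity
  have hl := Real.log_nonneg hx
  obtain ⟨J, hJ⟩ := pow_unbounded_of_one_lt x (by norm_num : (1 : ℝ) < 2)
  have h1 : VV x ≤ 8 * ∑ j ∈ range J, ∑ m ∈ Icc 1 ⌊x⌋₊,
      if (2 : ℝ) ^ j ≤ x / m then (2 : ℝ) ^ j * (1 + (j : ℝ)) ^ (-(8/5) : ℝ) * ff m else 0 := by
    rw [Finset.sum_comm, Finset.mul_sum]
    unfold VV
    refine Finset.sum_le_sum fun m hm => ?_
    obtain ⟨h0, h1, h2⟩ := mem_facts hx hm
    have h3 : x / m < 2 ^ J := by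
      refine lt_of_le_of_lt (div_le_self (by linarith) ?_) hJ
      exact_mod_cast (mem_Icc.mp hm).1
    refine (mul_le_mul_of_nonneg_left (Psi_dyadic h2 J h3) (ff_nonneg m)).trans (le_of_eq ?_)
    rw [mul_left_comm, Finset.mul_sum]
    congr 1
    refine Finset.sum_congr rfl fun j _ => ?_
    split_ifs <;> ring
  have h2 : ∀ j ∈ range J, ∑ m ∈ Icc 1 ⌊x⌋₊,
      (if (2 : ℝ) ^ j ≤ x / m then (2 : ℝ) ^ j * (1 + (j : ℝ)) ^ (-(8/5) : ℝ) * ff m else 0)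
      ≤ (K * (x * (1 + Real.log x) ^ (-(1/2) : ℝ))) * (1 + (j : ℝ)) ^ (-(11/10) : ℝ) := by
    intro j _
    have h2j : (0 : ℝ) < 2 ^ j := by positivity
    have e1 : ∑ m ∈ Icc 1 ⌊x⌋₊,
      (if (2 : ℝ) ^ j ≤ x / m then (2 : ℝ) ^ j * (1 + (j : ℝ)) ^ (-(8/5) : ℝ) * ff m else 0)
      ≤ (2 : ℝ) ^ j * (1 + (j : ℝ)) ^ (-(8/5) : ℝ) * SS (x / 2 ^ j) := by
      unfold SS
      rw [Finset.mul_sum, ← Finset.sum_filter]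
      refine Finset.sum_le_sum_of_subset_of_nonneg ?_ fun m _ _ => mul_nonneg (by positivity) (ff_nonneg m)
      intro m hm
      obtain ⟨hm1, hm2⟩ := mem_filter.mp hm
      obtain ⟨h0, h1, h2⟩ := mem_facts hx hm1
      refine mem_Icc.mpr ⟨(mem_Icc.mp hm1).1, Nat.le_floor ?_⟩
      rw [le_div_iff₀ h0] at hm2
      rw [le_div_iff₀ h2j]; linarith
    refine e1.trans ?_
    by_cases hxj : (1 : ℝ) ≤ x / 2 ^ j
    · have e2 := hK _ hxj
      have hlj := Real.log_nonneg hxj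
      have e3 : 1 + Real.log x ≤ (1 + Real.log (x / 2 ^ j)) * (1 + (j : ℝ)) := by
        have : Real.log (x / 2 ^ j) = Real.log x - j * Real.log 2 := by
          rw [Real.log_div (by linarith) h2j.ne', Real.log_pow]
        have h3 := Real.log_two_lt_d9
        have h4 := Real.log_pos (by norm_num : (1 : ℝ) < 2)
        have h5 : (0 : ℝ) ≤ j := Nat.cast_nonneg j
        have h6 : Real.log x = Real.log (x / 2 ^ j) + j * Real.log 2 := by linarith
        rw [h6]
        nlinarith
      have e4 : (1 + Real.log (x / 2 ^ j)) ^ (-(1/2) : ℝ) ≤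
          (1 + (j : ℝ)) ^ (1/2 : ℝ) * (1 + Real.log x) ^ (-(1/2) : ℝ) := by
        have e5 := Real.rpow_le_rpow_of_nonpos (by linarith) e3 (by norm_num : (-(1/2) : ℝ) ≤ 0)
        rw [Real.mul_rpow (by linarith) (by positivity)] at e5
        calc _ = (1 + (j : ℝ)) ^ (1/2 : ℝ) * ((1 + Real.log (x / 2 ^ j)) ^ (-(1/2) : ℝ) * (1 + (j : ℝ)) ^ (-(1/2) : ℝ)) := by
              rw [mul_left_comm, ← Real.rpow_add (by positivity)]; norm_num
          _ ≤ _ := by gcongr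
      calc (2 : ℝ) ^ j * (1 + (j : ℝ)) ^ (-(8/5) : ℝ) * SS (x / 2 ^ j)
          ≤ (2 : ℝ) ^ j * (1 + (j : ℝ)) ^ (-(8/5) : ℝ) * (K * (x / 2 ^ j * ((1 + (j : ℝ)) ^ (1/2 : ℝ) * (1 + Real.log x) ^ (-(1/2) : ℝ)))) := by
            refine mul_le_mul_of_nonneg_left (e2.trans ?_) (by positivity)
            gcongr
        _ = (K * (x * (1 + Real.log x) ^ (-(1/2) : ℝ))) * ((1 + (j : ℝ)) ^ (-(8/5) : ℝ) * (1 + (j : ℝ)) ^ (1/2 : ℝ)) := by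
            field_simp
        _ = _ := by rw [← Real.rpow_add (by positivity)]; norm_num
    · have : SS (x / 2 ^ j) = 0 := by
        unfold SS
        rw [Nat.floor_eq_zero.mpr (not_le.mp hxj)]; simp
      rw [this, mul_zero]
      positivity
  refine h1.trans ?_
  calc 8 * ∑ j ∈ range J, ∑ m ∈ Icc 1 ⌊x⌋₊,
      (if (2 : ℝ) ^ j ≤ x / m then (2 : ℝ) ^ j * (1 + (j : ℝ)) ^ (-(8/5) : ℝ) * ff m else 0)
      ≤ 8 * ∑ j ∈ range J, (K * (x * (1 + Real.log x) ^ (-(1/2) : ℝ))) * (1 + (j : ℝ)) ^ (-(11/10) : ℝ) := by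
        gcongr with j hj; exact h2 j hj
    _ = 8 * (K * (x * (1 + Real.log x) ^ (-(1/2) : ℝ))) * ∑ j ∈ range J, (1 + (j : ℝ)) ^ (-(11/10) : ℝ) := by
        rw [← Finset.mul_sum]; ring
    _ ≤ 8 * (K * (x * (1 + Real.log x) ^ (-(1/2) : ℝ))) * ∑' j : ℕ, (1 + (j : ℝ)) ^ (-(11/10) : ℝ) := by
        refine mul_le_mul_of_nonneg_left (hsum.sum_le_tsum _ fun j _ => by positivity) (by positivity)
    _ = _ := by ring

end VSec
end LandauD

namespace LandauD
set_option linter.unusedSectionVars false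
set_option linter.unusedTactic false
set_option linter.unusedVariables false

section Asym
open Finset MeasureTheory

lemma rp32 {l : ℝ} (hl : 0 < l) : l ^ (-(3/2) : ℝ) = l ^ (-(1/2) : ℝ) / l := by
  rw [show (-(3/2) : ℝ) = -(1/2) - 1 by norm_num, Real.rpow_sub_one hl.ne']

lemma rp32' {l : ℝ} (hl : 0 < l) : l ^ (-(1/2) - 1 : ℝ) = l ^ (-(1/2) : ℝ) / l :=
  Real.rpow_sub_one hl.ne' _

lemma rp11 {l : ℝ} (hl : 0 < l) : l ^ (-(1/2) : ℝ) * l ^ (-(1/2) : ℝ) = 1 / l := by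
  rw [← Real.rpow_add hl, show (-(1/2) + -(1/2) : ℝ) = -1 by norm_num, Real.rpow_neg_one, one_div]

lemma SS_mono : Monotone SS := fun x y h =>
  Finset.sum_le_sum_of_subset_of_nonneg (Finset.Icc_subset_Icc_right (Nat.floor_mono h))
    fun n _ _ => ff_nonneg n

lemma SS_measurable : Measurable SS := SS_mono.measurable

lemma SS_le_self {x : ℝ} (hx : 0 ≤ x) : SS x ≤ x := by
  unfold SS
  calc _ ≤ ∑ n ∈ Icc 1 ⌊x⌋₊, (1 : ℝ) := Finset.sum_le_sum fun n _ => ff_le_one n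
    _ = (⌊x⌋₊ : ℝ) := by simp
    _ ≤ x := Nat.floor_le hx

lemma sum_Icc0 (c : ℕ → ℝ) (hc : c 0 = 0) (n : ℕ) : ∑ k ∈ Icc 0 n, c k = ∑ k ∈ Icc 1 n, c k := by
  rw [Finset.Icc_eq_cons_Ioc (Nat.zero_le _), Finset.sum_cons, hc, zero_add]; rfl

/-- Integral of the counting function. -/
noncomputable def RR (x : ℝ) : ℝ := ∫ t in (1 : ℝ)..x, SS t * (t ^ 2)⁻¹

lemma RR_int {a b : ℝ} (ha : 0 < a) (hb : 0 < b) :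
    IntervalIntegrable (fun t => SS t * (t ^ 2)⁻¹) volume a b := by
  refine (SS_mono.intervalIntegrable).mul_continuousOn ?_
  refine ContinuousOn.inv₀ (by fun_prop) fun t ht => ?_
  have : 0 < t := lt_of_lt_of_le (lt_min ha hb) ht.1
  positivity

lemma TT_eq {x : ℝ} (hx : 1 ≤ x) : TT x = SS x / x + RR x := by
  have hder : ∀ t : ℝ, deriv (fun t : ℝ => t⁻¹) t = -(t ^ 2)⁻¹ := fun t => deriv_inv
  have h := sum_mul_eq_sub_integral_mul₀ (𝕜 := ℝ) (f := fun t : ℝ => t⁻¹) ff ff_zero x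
    (fun t ht => differentiableAt_inv (by have := ht.1; linarith)) ?_
  · rw [sum_Icc0 _ (by simp [ff_zero]), sum_Icc0 _ ff_zero] at h
    have h1 : TT x = ∑ k ∈ Icc 1 ⌊x⌋₊, ((k : ℝ))⁻¹ * ff k := by
      unfold TT; exact Finset.sum_congr rfl fun n _ => by ring
    rw [h1, h, RR, intervalIntegral.integral_of_le hx]
    have h2 : ∫ t in Set.Ioc 1 x, deriv (fun t : ℝ => t⁻¹) t * ∑ k ∈ Icc 0 ⌊t⌋₊, ff k
        = - ∫ t in Set.Ioc 1 x, SS t * (t ^ 2)⁻¹ := by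
      rw [← integral_neg]
      congr 1
      funext t
      rw [hder, sum_Icc0 _ ff_zero]
      unfold SS; ring
    rw [h2]
    unfold SS
    ring
  · have : deriv (fun t : ℝ => t⁻¹) = fun t => -(t ^ 2)⁻¹ := funext hder
    rw [this]
    refine ContinuousOn.integrableOn_Icc ?_
    refine (ContinuousOn.inv₀ (by fun_prop) fun t ht => ?_).neg
    have := ht.1
    positivity

lemma SS_right_cont {x : ℝ} (hx : 0 ≤ x) : ContinuousWithinAt SS (Set.Ici x) x := by
  have h : SS =ᶠ[nhdsWithin x (Set.Ici x)] fun _ => SS x := by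
    have h1 : Set.Iio ((⌊x⌋₊ : ℝ) + 1) ∈ nhds x := Iio_mem_nhds (Nat.lt_floor_add_one x)
    filter_upwards [self_mem_nhdsWithin, mem_nhdsWithin_of_mem_nhds h1] with t ht ht2
    have : ⌊t⌋₊ = ⌊x⌋₊ := by
      rw [Nat.floor_eq_iff (hx.trans ht)]
      exact ⟨(Nat.floor_le hx).trans ht, ht2⟩
    unfold SS
    rw [this]
  exact (continuousWithinAt_const.congr_of_eventuallyEq h rfl)

lemma RR_deriv {x : ℝ} (hx : 1 ≤ x) :
    HasDerivWithinAt RR (SS x * (x ^ 2)⁻¹) (Set.Ici x) x := by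
  have h := intervalIntegral.integral_hasDerivWithinAt_right (s := Set.Ici x) (t := Set.Ioi x)
    (RR_int (by norm_num : (0 : ℝ) < 1) (by linarith : 0 < x)) ?_ ?_
  · exact h
  · refine Measurable.stronglyMeasurable ?_ |>.stronglyMeasurableAtFilter
    exact SS_measurable.mul (by fun_prop)
  · refine ContinuousWithinAt.mul ((SS_right_cont (by linarith)).mono Set.Ioi_subset_Ici_self) ?_
    refine ContinuousWithinAt.inv₀ (by fun_prop) (by positivity)

lemma RR_cont {a b : ℝ} (ha : 1 ≤ a) : ContinuousOn RR (Set.Icc a b) := by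
  intro x hx
  have h1 : 1 ≤ x := ha.trans hx.1
  have := intervalIntegral.continuousOn_primitive_interval' (μ := volume)
    (f := fun t => SS t * (t ^ 2)⁻¹) (a := 1) (b₁ := 1) (b₂ := x + 1)
    (RR_int (by norm_num) (by linarith)) (by simp)
  rw [Set.uIcc_of_le (by linarith)] at this
  have h2 := (this x ⟨h1, by linarith⟩)
  have h3 : ContinuousWithinAt RR (Set.Icc 1 (x + 1)) x := h2
  refine (h3.mono_of_mem_nhdsWithin ?_)
  have h4 : Set.Iio (x + 1) ∈ nhdsWithin x (Set.Icc a b) := mem_nhdsWithin_of_mem_nhds (Iio_mem_nhds (by linarith))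
  filter_upwards [self_mem_nhdsWithin, h4] with t ht ht2
  exact ⟨ha.trans ht.1, le_of_lt ht2⟩

lemma SS_RR {K1 K2 : ℝ} (hK1 : 0 ≤ K1) (hK2 : 0 ≤ K2)
    (h1 : ∀ x : ℝ, 1 ≤ x → SS x ≤ K1 * (x * (1 + Real.log x) ^ (-(1/2) : ℝ)))
    (h2 : ∀ x : ℝ, 1 ≤ x → |Real.log x * SS x - (1 / 2) * x * TT x| ≤ K2 * (x * (1 + Real.log x) ^ (-(1/2) : ℝ))) :
    ∀ x : ℝ, 2 ≤ x → |SS x / x - RR x / (2 * Real.log x)| ≤ (K1 + K2) * Real.log x ^ (-(3/2) : ℝ) := by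
  intro x hx
  have hx1 : 1 ≤ x := by linarith
  have hx0 : 0 < x := by linarith
  have e1 := h1 x hx1
  have e2 := h2 x hx1
  have hl : 0 < Real.log x := Real.log_pos (by linarith)
  have e3 : (1 + Real.log x) ^ (-(1/2) : ℝ) ≤ Real.log x ^ (-(1/2) : ℝ) :=
    Real.rpow_le_rpow_of_nonpos hl (by linarith) (by norm_num)
  set P := Real.log x ^ (-(1/2) : ℝ) with hP
  have e4 : Real.log x ^ (-(3/2) : ℝ) = P / Real.log x := by
    rw [hP]; exact rp32 hl
  have e5 : SS x ≤ K1 * (x * P) := e1.trans (by gcongr)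
  have e6 : |Real.log x * SS x - (1 / 2) * x * TT x| ≤ K2 * (x * P) := e2.trans (by gcongr)
  have e7 : SS x / x - RR x / (2 * Real.log x)
      = (Real.log x * SS x - (1 / 2) * x * TT x + SS x / 2) / (x * Real.log x) := by
    rw [TT_eq hx1]; field_simp; ring
  rw [e7, e4, abs_div, abs_of_pos (by positivity : 0 < x * Real.log x), div_le_iff₀ (by positivity)]
  have hS := SS_nonneg x
  calc _ ≤ K2 * (x * P) + K1 * (x * P) := by
        refine (abs_add_le _ _).trans (add_le_add e6 ?_)
        rw [abs_of_nonneg (by positivity)]; linarith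
    _ = _ := by field_simp; ring

lemma Q_bound {K : ℝ} (hK : 0 ≤ K)
    (h : ∀ x : ℝ, 2 ≤ x → |SS x / x - RR x / (2 * Real.log x)| ≤ K * Real.log x ^ (-(3/2) : ℝ)) :
    ∀ a b : ℝ, 2 ≤ a → a ≤ b →
      |RR b * Real.log b ^ (-(1/2) : ℝ) - RR a * Real.log a ^ (-(1/2) : ℝ)| ≤ K / Real.log a := by
  intro a b ha hab
  have hlpos : ∀ x, a ≤ x → 0 < Real.log x := fun x hx => Real.log_pos (by linarith)
  have hder : ∀ x, a ≤ x → HasDerivAt (fun x => Real.log x ^ (-(1/2) : ℝ))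
      (x⁻¹ * (-(1/2)) * Real.log x ^ (-(1/2) - 1 : ℝ)) x := fun x hx =>
    (Real.hasDerivAt_log (by linarith)).rpow_const (Or.inl (hlpos x hx).ne')
  have key := image_norm_le_of_norm_deriv_right_le_deriv_boundary' (a := a) (b := b)
    (f := fun x => RR x * Real.log x ^ (-(1/2) : ℝ) - RR a * Real.log a ^ (-(1/2) : ℝ))
    (f' := fun x => SS x * (x ^ 2)⁻¹ * Real.log x ^ (-(1/2) : ℝ) +
      RR x * (x⁻¹ * (-(1/2)) * Real.log x ^ (-(1/2) - 1 : ℝ)))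
    (B := fun x => K * ((Real.log a)⁻¹ - (Real.log x)⁻¹))
    (B' := fun x => K * (x⁻¹ / Real.log x ^ 2)) ?_ ?_ ?_ ?_ ?_ ?_ (Set.right_mem_Icc.mpr hab)
  · rw [Real.norm_eq_abs] at key
    refine key.trans ?_
    rw [div_eq_mul_inv]
    refine mul_le_mul_of_nonneg_left ?_ hK
    have : 0 < (Real.log b)⁻¹ := inv_pos.mpr (hlpos b hab)
    linarith
  · refine ContinuousOn.sub ((RR_cont (by linarith)).mul ?_) continuousOn_const
    exact fun x hx => (hder x hx.1).continuousAt.continuousWithinAt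
  · intro x hx
    exact ((RR_deriv (by linarith [hx.1])).mul (hder x hx.1).hasDerivWithinAt).sub_const _
  · simp
  · intro x hx
    refine ContinuousAt.continuousWithinAt ?_
    refine continuousAt_const.mul (continuousAt_const.sub ?_)
    exact (Real.continuousAt_log (by linarith [hx.1])).inv₀ (hlpos x hx.1).ne'
  · intro x hx
    have := (((Real.hasDerivAt_log (by linarith [hx.1] : x ≠ 0)).inv (hlpos x hx.1).ne').const_sub ((Real.log a)⁻¹)).const_mul K
    rw [neg_div, neg_neg] at this
    exact this.hasDerivWithinAt
  · intro x hx
    have hx2 : 2 ≤ x := ha.trans hx.1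
    have hx0 : 0 < x := by linarith
    have hl := hlpos x hx.1
    have hh := h x hx2
    have e4 : Real.log x ^ (-(3/2) : ℝ) = Real.log x ^ (-(1/2) : ℝ) / Real.log x := by
      exact rp32 hl
    have e5 : Real.log x ^ (-(1/2) - 1 : ℝ) = Real.log x ^ (-(1/2) : ℝ) / Real.log x := by
      exact rp32' hl
    have e6 : Real.log x ^ (-(1/2) : ℝ) * Real.log x ^ (-(1/2) : ℝ) = 1 / Real.log x := by
      exact rp11 hl
    have hPpos : 0 < Real.log x ^ (-(1/2) : ℝ) := by positivity
    rw [e4] at hh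
    rw [e5]
    generalize Real.log x ^ (-(1/2) : ℝ) = P at *
    have e7 : SS x * (x ^ 2)⁻¹ * P + RR x * (x⁻¹ * (-(1/2)) * (P / Real.log x))
        = (P / x) * (SS x / x - RR x / (2 * Real.log x)) := by
      field_simp; ring
    rw [e7, Real.norm_eq_abs, abs_mul, abs_of_pos (by positivity : 0 < P / x)]
    calc _ ≤ P / x * (K * (P / Real.log x)) := by gcongr
      _ = K * (P * P) / (x * Real.log x) := by field_simp
      _ = _ := by rw [e6]; field_simp

lemma S_asymp {K : ℝ} (hK : 0 ≤ K)
    (h : ∀ x : ℝ, 2 ≤ x → |SS x / x - RR x / (2 * Real.log x)| ≤ K * Real.log x ^ (-(3/2) : ℝ)) :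
    ∃ c : ℝ, ∀ x : ℝ, 2 ≤ x → |SS x - c * (x * Real.log x ^ (-(1/2) : ℝ))|
      ≤ 2 * K * (x * Real.log x ^ (-(3/2) : ℝ)) := by
  have hQ := Q_bound hK h
  set Q : ℝ → ℝ := fun x => RR x * Real.log x ^ (-(1/2) : ℝ) with hQd
  have ht0 : Tendsto (fun x : ℝ => K / Real.log x) atTop (nhds 0) :=
    Real.tendsto_log_atTop.const_div_atTop K
  have hcau : CauchySeq Q := by
    rw [Metric.cauchySeq_iff']
    intro ε hε
    obtain ⟨N, hN1, hN2⟩ := ((ht0.eventually (gt_mem_nhds hε)).and (eventually_ge_atTop 2)).exists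
    exact ⟨N, fun n hn => lt_of_le_of_lt (by rw [Real.dist_eq]; exact hQ N n hN2 hn) hN1⟩
  obtain ⟨c, hc⟩ := cauchySeq_tendsto_of_complete hcau
  refine ⟨c / 2, fun x hx => ?_⟩
  have hx0 : 0 < x := by linarith
  have hl : 0 < Real.log x := Real.log_pos (by linarith)
  have h1 : |c - Q x| ≤ K / Real.log x := by
    refine le_of_tendsto ((hc.sub_const (Q x)).abs) ?_
    filter_upwards [eventually_ge_atTop x] with y hy
    exact hQ x y hx hy
  have h2 := h x hx
  have e4 : Real.log x ^ (-(3/2) : ℝ) = Real.log x ^ (-(1/2) : ℝ) / Real.log x := by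
    exact rp32 hl
  have e6 : Real.log x ^ (-(1/2) : ℝ) * Real.log x ^ (-(1/2) : ℝ) = 1 / Real.log x := by
    exact rp11 hl
  have hPpos : 0 < Real.log x ^ (-(1/2) : ℝ) := by positivity
  simp only [hQd] at h1
  rw [e4] at h2 ⊢
  generalize Real.log x ^ (-(1/2) : ℝ) = P at *
  have e7 : SS x - c / 2 * (x * P) = x * (SS x / x - RR x / (2 * Real.log x))
      + x * (P / 2) * (-(c - RR x * P)) := by
    have : RR x / (2 * Real.log x) = RR x / 2 * (P * P) := by rw [e6]; field_simp
    rw [this]; field_simp; ring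
  rw [e7]
  refine (abs_add_le _ _).trans ?_
  rw [abs_mul, abs_mul, abs_neg, abs_of_pos hx0, abs_of_pos (by positivity : 0 < x * (P / 2))]
  calc _ ≤ x * (K * (P / Real.log x)) + x * (P / 2) * (K / Real.log x) := by gcongr
    _ = (3 / 2) * (K * (x * (P / Real.log x))) := by ring
    _ ≤ 2 * K * (x * (P / Real.log x)) := by
      have : 0 ≤ K * (x * (P / Real.log x)) := by positivity
      linarith

lemma SG_asymp {L : ℝ} (hF : Tendsto (fun s : ℝ => √(s - 1) * FF s) (nhdsWithin 1 (Set.Ioi 1)) (nhds L)) :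
    ∃ c K : ℝ, 0 ≤ K ∧ ∀ x : ℝ, 2 ≤ x →
      |SS x - c * (x * Real.log x ^ (-(1/2) : ℝ))| ≤ K * (x * Real.log x ^ (-(3/2) : ℝ)) ∧
      |GG x| ≤ K * (x * Real.log x ^ (-(3/2) : ℝ)) := by
  obtain ⟨K0, hK0, h0⟩ := TT_bound hF
  obtain ⟨K1, hK1, h1⟩ := SS_bound hK0 h0
  obtain ⟨K2, hK2, h2⟩ := VV_bound hK1 h1
  obtain ⟨K3, hK3, h3⟩ := main_ests
  have h4 := SS_RR hK1 (by positivity : 0 ≤ K3 * K2) h1 (fun x hx => ((h3 x hx).1).trans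
    ((mul_le_mul_of_nonneg_left (h2 x hx) hK3).trans_eq (mul_assoc _ _ _).symm))
  obtain ⟨c, hc⟩ := S_asymp (by positivity) h4
  refine ⟨c, 2 * (K1 + K3 * K2), by positivity, fun x hx => ⟨hc x hx, ?_⟩⟩
  have hx0 : 0 < x := by linarith
  have hl : 0 < Real.log x := Real.log_pos (by linarith)
  have e4 : Real.log x ^ (-(3/2) : ℝ) = Real.log x ^ (-(1/2) : ℝ) / Real.log x := by
    exact rp32 hl
  have e3 : (1 + Real.log x) ^ (-(1/2) : ℝ) ≤ Real.log x ^ (-(1/2) : ℝ) :=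
    Real.rpow_le_rpow_of_nonpos hl (by linarith) (by norm_num)
  have e5 := (h3 x (by linarith)).2
  rw [abs_mul, abs_of_pos hl] at e5
  have e6 : Real.log x * |GG x| ≤ K3 * (K2 * (x * Real.log x ^ (-(1/2) : ℝ))) :=
    e5.trans (mul_le_mul_of_nonneg_left ((h2 x (by linarith)).trans (by gcongr)) hK3)
  rw [e4]
  have hPpos : 0 < Real.log x ^ (-(1/2) : ℝ) := by positivity
  generalize Real.log x ^ (-(1/2) : ℝ) = P at *
  have e7 : |GG x| ≤ K3 * K2 * (x * (P / Real.log x)) := by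
    rw [← mul_div_assoc, ← mul_div_assoc, le_div_iff₀ hl]; linarith
  have : 0 ≤ (2 * K1 + K3 * K2) * (x * (P / Real.log x)) := by positivity
  linarith

end Asym
end LandauD

namespace LandauD
set_option linter.unusedSectionVars false
set_option linter.unusedTactic false
set_option linter.unusedVariables false

section Const
open Finset MeasureTheory

lemma FF_LSeries {s : ℝ} (hs : 1 < s) : LSeries (fun n => (ff n : ℂ)) (s : ℂ) = (FF s : ℂ) := by
  unfold LSeries FF
  rw [Complex.ofReal_tsum]
  refine tsum_congr fun n => ?_
  rcases Nat.eq_zero_or_pos n with rfl | hn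
  · simp [ff_zero]
  · rw [LSeries.term_of_ne_zero hn.ne', Real.rpow_neg (Nat.cast_nonneg n), div_eq_mul_inv]
    push_cast
    rw [Complex.ofReal_cpow (Nat.cast_nonneg n)]
    simp

lemma FF_int {δ : ℝ} (hδ : 0 < δ) : FF (1 + δ) =
    (1 + δ) * ∫ u in Set.Ioi (0 : ℝ), SS (Real.exp u) * Real.exp (-u) * Real.exp (-(δ * u)) := by
  have hs1 : 1 < (((1 + δ : ℝ)) : ℂ).re := by rw [Complex.ofReal_re]; linarith
  have hL := LSeries_eq_mul_integral_of_nonneg ff zero_le_one hs1 (by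
    refine IsBigO.of_bound 1 (Eventually.of_forall fun n => ?_)
    have h0 := SS_nonneg n
    have h1 := SS_le_self (Nat.cast_nonneg n)
    unfold SS at h0 h1
    rw [Nat.floor_natCast] at h0 h1
    rw [Real.norm_of_nonneg h0]
    simpa using h1) ff_nonneg
  rw [FF_LSeries (by linarith)] at hL
  have him : Real.exp '' (Set.Ioi 0) = Set.Ioi 1 := by
    ext y
    constructor
    · rintro ⟨u, hu, rfl⟩; exact Real.one_lt_exp_iff.mpr hu
    · intro hy
      have hy' : (1 : ℝ) < y := hy
      exact ⟨Real.log y, Real.log_pos hy', Real.exp_log (by linarith)⟩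
  rw [← him, integral_image_eq_integral_abs_deriv_smul measurableSet_Ioi
      (fun x _ => (Real.hasDerivAt_exp x).hasDerivWithinAt) Real.exp_injective.injOn] at hL
  have hcv : ∫ u in Set.Ioi (0 : ℝ), |Real.exp u| • ((∑ k ∈ Icc 1 ⌊Real.exp u⌋₊, (ff k : ℂ)) *
      ((Real.exp u : ℝ) : ℂ) ^ (-(((1 + δ : ℝ) : ℂ) + 1)))
      = ∫ u in Set.Ioi (0 : ℝ), ((SS (Real.exp u) * Real.exp (-u) * Real.exp (-(δ * u)) : ℝ) : ℂ) := by
    refine setIntegral_congr_fun measurableSet_Ioi fun u hu => ?_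
    simp only [abs_of_pos (Real.exp_pos u), Complex.real_smul]
    have h1 : ((Real.exp u : ℝ) : ℂ) ^ (-(((1 + δ : ℝ) : ℂ) + 1)) =
        ((Real.exp (u * (-((1 + δ) + 1))) : ℝ) : ℂ) := by
      rw [Real.exp_mul, Complex.ofReal_cpow (Real.exp_pos u).le]
      push_cast; rfl
    rw [h1]
    unfold SS
    rw [mul_assoc (∑ n ∈ Icc 1 ⌊Real.exp u⌋₊, ff n), ← Real.exp_add]
    rw [mul_left_comm, ← Complex.ofReal_mul, ← Real.exp_add, Complex.ofReal_mul, Complex.ofReal_sum]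
    congr 3
    ring
  rw [hcv, integral_complex_ofReal, ← Complex.ofReal_mul] at hL
  exact_mod_cast hL

/-- Error function. -/
noncomputable def EE (c u : ℝ) : ℝ := SS (Real.exp u) * Real.exp (-u) - c * u ^ (-(1/2) : ℝ)

lemma EE_integrable {c K : ℝ} (h : ∀ x : ℝ, 2 ≤ x →
      |SS x - c * (x * Real.log x ^ (-(1/2) : ℝ))| ≤ K * (x * Real.log x ^ (-(3/2) : ℝ))) :
    IntegrableOn (EE c) (Set.Ioi 0) := by
  have hm : Measurable (EE c) := by
    unfold EE
    exact ((SS_measurable.comp Real.measurable_exp).mul (by fun_prop)).sub (by fun_prop)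
  have hl2 : 0 < Real.log 2 := Real.log_pos (by norm_num)
  rw [← Set.Ioc_union_Ioi_eq_Ioi hl2.le]
  refine IntegrableOn.union ?_ ?_
  · have hi : IntegrableOn (fun u : ℝ => 1 + |c| * u ^ (-(1/2) : ℝ)) (Set.Ioc 0 (Real.log 2)) := by
      have h1 : IntervalIntegrable (fun u : ℝ => 1 + |c| * u ^ (-(1/2) : ℝ)) volume 0 (Real.log 2) :=
        (intervalIntegrable_const).add
          ((intervalIntegral.intervalIntegrable_rpow' (by norm_num)).const_mul _)
      exact (intervalIntegrable_iff_integrableOn_Ioc_of_le hl2.le).mp h1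
    refine Integrable.mono' hi hm.aestronglyMeasurable ?_
    rw [ae_restrict_iff' measurableSet_Ioc]
    refine Eventually.of_forall fun u hu => ?_
    unfold EE
    refine (norm_sub_le _ _).trans (add_le_add ?_ ?_)
    · rw [Real.norm_of_nonneg (mul_nonneg (SS_nonneg _) (Real.exp_pos _).le), Real.exp_neg,
        ← div_eq_mul_inv, div_le_one (Real.exp_pos u)]
      exact SS_le_self (Real.exp_pos u).le
    · rw [norm_mul, Real.norm_eq_abs, Real.norm_of_nonneg (Real.rpow_nonneg hu.1.le _)]
  · have hi : IntegrableOn (fun u : ℝ => K * u ^ (-(3/2) : ℝ)) (Set.Ioi (Real.log 2)) :=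
      (integrableOn_Ioi_rpow_of_lt (by norm_num) hl2).const_mul _
    refine Integrable.mono' hi hm.aestronglyMeasurable ?_
    rw [ae_restrict_iff' measurableSet_Ioi]
    refine Eventually.of_forall fun u hu => ?_
    have hu' : Real.log 2 < u := hu
    have h2 : 2 ≤ Real.exp u := by
      rw [← Real.exp_log (by norm_num : (0 : ℝ) < 2)]
      exact Real.exp_le_exp.mpr hu'.le
    have h3 := h _ h2
    rw [Real.log_exp] at h3
    unfold EE
    have he := Real.exp_pos u
    have e1 : SS (Real.exp u) * Real.exp (-u) - c * u ^ (-(1/2) : ℝ)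
        = (SS (Real.exp u) - c * (Real.exp u * u ^ (-(1/2) : ℝ))) / Real.exp u := by
      rw [Real.exp_neg]; field_simp
    rw [e1, Real.norm_eq_abs, abs_div, abs_of_pos he, div_le_iff₀ he]
    linarith

lemma const_eq {c K L : ℝ} (h : ∀ x : ℝ, 2 ≤ x →
      |SS x - c * (x * Real.log x ^ (-(1/2) : ℝ))| ≤ K * (x * Real.log x ^ (-(3/2) : ℝ)))
    (hF : Tendsto (fun s : ℝ => √(s - 1) * FF s) (nhdsWithin 1 (Set.Ioi 1)) (nhds L)) :
    L = c * √Real.pi := by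
  have hE := EE_integrable h
  set M := ∫ u in Set.Ioi (0 : ℝ), |EE c u| with hM
  have hrep : ∀ δ : ℝ, 0 < δ → |FF (1 + δ) - (1 + δ) * (c * ((1 / δ) ^ (1/2 : ℝ) * √Real.pi))| ≤ (1 + δ) * M := by
    intro δ hδ
    have hg : IntegrableOn (fun u : ℝ => u ^ (-(1/2) : ℝ) * Real.exp (-(δ * u))) (Set.Ioi 0) := by
      have := integrableOn_rpow_mul_exp_neg_mul_rpow (p := 1) (s := -(1/2)) (b := δ) (by norm_num) (by norm_num) hδ
      simpa using this
    have hEe : IntegrableOn (fun u : ℝ => EE c u * Real.exp (-(δ * u))) (Set.Ioi 0) := by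
      refine Integrable.mono' hE.norm (hE.aestronglyMeasurable.mul (by fun_prop)) ?_
      rw [ae_restrict_iff' measurableSet_Ioi]
      refine Eventually.of_forall fun u hu => ?_
      have hu' : 0 < u := hu
      rw [norm_mul, Real.norm_of_nonneg (Real.exp_pos (-(δ * u))).le]
      exact mul_le_of_le_one_right (norm_nonneg _) (Real.exp_le_one_iff.mpr (by nlinarith))
    have e1 : ∫ u in Set.Ioi (0 : ℝ), SS (Real.exp u) * Real.exp (-u) * Real.exp (-(δ * u))
        = c * ((1 / δ) ^ (1/2 : ℝ) * √Real.pi) + ∫ u in Set.Ioi (0 : ℝ), EE c u * Real.exp (-(δ * u)) := by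
      have hG := Real.integral_rpow_mul_exp_neg_mul_Ioi (a := 1 / 2) (by norm_num) hδ
      rw [Real.Gamma_one_half_eq, show (1 / 2 - 1 : ℝ) = -(1/2) by norm_num] at hG
      rw [← hG, ← integral_const_mul, ← integral_add (hg.const_mul c) hEe]
      congr 1
      funext u
      unfold EE; ring
    rw [FF_int hδ, e1]
    have e2 : (1 + δ) * (c * ((1 / δ) ^ (1/2 : ℝ) * √Real.pi) + ∫ u in Set.Ioi (0 : ℝ), EE c u * Real.exp (-(δ * u)))
        - (1 + δ) * (c * ((1 / δ) ^ (1/2 : ℝ) * √Real.pi)) = (1 + δ) * ∫ u in Set.Ioi (0 : ℝ), EE c u * Real.exp (-(δ * u)) := by ring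
    rw [e2, abs_mul, abs_of_pos (by linarith)]
    refine mul_le_mul_of_nonneg_left ?_ (by linarith)
    rw [← Real.norm_eq_abs]
    refine (norm_integral_le_integral_norm _).trans ?_
    refine setIntegral_mono_on hEe.norm hE.norm measurableSet_Ioi fun u hu => ?_
    have hu' : 0 < u := hu
    rw [norm_mul, Real.norm_of_nonneg (Real.exp_pos (-(δ * u))).le]
    exact mul_le_of_le_one_right (norm_nonneg _) (Real.exp_le_one_iff.mpr (by nlinarith))
  have hlim : Tendsto (fun s : ℝ => √(s - 1) * FF s) (nhdsWithin 1 (Set.Ioi 1)) (nhds (c * √Real.pi)) := by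
    have t1 : Tendsto (fun s : ℝ => s * (c * √Real.pi)) (nhdsWithin 1 (Set.Ioi 1)) (nhds (c * √Real.pi)) := by
      have : Continuous fun s : ℝ => s * (c * √Real.pi) := by fun_prop
      have h2 := (this.tendsto 1).mono_left (nhdsWithin_le_nhds (s := Set.Ioi 1))
      simpa using h2
    have t2 : Tendsto (fun s : ℝ => √(s - 1) * (s * M)) (nhdsWithin 1 (Set.Ioi 1)) (nhds 0) := by
      have : Continuous fun s : ℝ => √(s - 1) * (s * M) := by fun_prop
      have h2 := (this.tendsto 1).mono_left (nhdsWithin_le_nhds (s := Set.Ioi 1))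
      simpa using h2
    have t3 : Tendsto (fun s : ℝ => √(s - 1) * FF s - s * (c * √Real.pi)) (nhdsWithin 1 (Set.Ioi 1)) (nhds 0) := by
      refine squeeze_zero_norm' ?_ t2
      filter_upwards [self_mem_nhdsWithin] with s hs
      have hs' : 1 < s := hs
      have hd : 0 < s - 1 := by linarith
      have h3 := hrep (s - 1) hd
      rw [add_sub_cancel] at h3
      have hsq := Real.sqrt_pos.mpr hd
      have e3 : (1 / (s - 1)) ^ (1/2 : ℝ) = 1 / √(s - 1) := by
        rw [← Real.sqrt_eq_rpow, Real.sqrt_div (by norm_num), Real.sqrt_one]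
      rw [e3] at h3
      have e4 : √(s - 1) * FF s - s * (c * √Real.pi) =
          √(s - 1) * (FF s - s * (c * (1 / √(s - 1) * √Real.pi))) := by field_simp
      rw [e4, Real.norm_eq_abs, abs_mul, abs_of_pos hsq]
      exact mul_le_mul_of_nonneg_left h3 hsq.le
    have := t3.add t1
    simpa using this
  exact tendsto_nhds_unique hF hlim

end Const
end LandauD

namespace LandauD
set_option linter.unusedSectionVars false
set_option linter.unusedTactic false
set_option linter.unusedVariables false

section Final
open Finset

lemma good_odd {n : ℕ} (h : good n) : n % 2 = 1 := by
  by_contra h2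
  have : 2 ∣ n := by omega
  have := h.2 2 Nat.prime_two this
  unfold okP at this
  omega

lemma odd_prop {d : ℕ} (hd : d % 2 = 1) :
    good d ↔ Squarefree d ∧ ∀ p : ℕ, p.Prime → Odd p → p ∣ d → jacobiSym (-2) p = 1 := by
  unfold good
  refine and_congr_right fun _ => forall_congr' fun p => forall_congr' fun hp => ?_
  constructor
  · intro h ho hpd
    exact (jac_iff hp (by rintro rfl; exact absurd ho (by decide))).mpr (h hpd)
  · intro h hpd
    have h2 : p ≠ 2 := by rintro rfl; omega
    exact (jac_iff hp h2).mp (h (hp.odd_of_ne_two h2) hpd)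

open Classical in
lemma ind_eq {d : ℕ} (hd : 1 ≤ d) : (if d ∈ Dmtwo then (1:ℝ) else 0) =
    (if 2 ∣ d then ff (d / 2) else 0) + (ff d - ff d * c4 d) / 2 := by
  rcases Nat.even_or_odd' d with ⟨m, rfl | rfl⟩
  · have hnd : ff (2 * m) = 0 := by
      unfold ff
      rw [if_neg]
      intro h
      have := good_odd h
      omega
    have hm : (2 * m ∈ Dmtwo) ↔ good m := by
      constructor
      · rintro ⟨h1, h2, h3, h4⟩
        have h5 := Nat.squarefree_mul_iff.mp h2
        have hmo : m % 2 = 1 := by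
          have := h5.1
          rw [Nat.coprime_two_left] at this
          exact Nat.odd_iff.mp this
        exact (odd_prop hmo).mpr ⟨h5.2.2, fun p hp ho hpm => h4 p hp ho (hpm.mul_left _)⟩
      · intro h
        have hmo := good_odd h
        obtain ⟨h1, h2⟩ := (odd_prop hmo).mp h
        refine ⟨by omega, Nat.squarefree_mul_iff.mpr ⟨?_, Nat.prime_two.prime.squarefree, h1⟩, by omega, ?_⟩
        · rw [Nat.coprime_two_left]; exact Nat.odd_iff.mpr hmo
        · intro p hp ho hpd
          rcases hp.dvd_mul.mp hpd with h | h
          · have := (Nat.prime_dvd_prime_iff_eq hp Nat.prime_two).mp h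
            subst this
            exact absurd ho (by decide)
          · exact h2 p hp ho h
    rw [hnd, if_pos (dvd_mul_right 2 m), Nat.mul_div_cancel_left _ (by norm_num)]
    unfold ff
    simp [hm]
  · have hod : (2 * m + 1) % 2 = 1 := by omega
    have h2 : ¬ (2 ∣ 2 * m + 1) := by omega
    rw [if_neg h2]
    have hg := odd_prop hod
    have h4 : (2 * m + 1) % 4 = 1 ∨ (2 * m + 1) % 4 = 3 := by omega
    generalize 2 * m + 1 = d at *
    rcases h4 with h4 | h4
    · have hc : c4 d = 1 := by
        unfold c4
        rw [ZMod.χ₄_nat_one_mod_four h4]; simp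
      rw [if_neg (fun h => h.2.2.1 h4), hc]; ring
    · have hc : c4 d = -1 := by
        unfold c4
        rw [ZMod.χ₄_nat_three_mod_four h4]; simp
      have hm : d ∈ Dmtwo ↔ good d := by
        rw [hg]
        constructor
        · rintro ⟨_, h, _, h'⟩; exact ⟨h, h'⟩
        · rintro ⟨h, h'⟩; exact ⟨by omega, h, by omega, h'⟩
      rw [hc]
      unfold ff
      by_cases h : good d <;> simp [hm, h]

lemma sum_even (N : ℕ) : ∑ d ∈ Icc 1 N, (if 2 ∣ d then ff (d / 2) else 0) = ∑ m ∈ Icc 1 (N / 2), ff m := by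
  rw [← Finset.sum_filter]
  refine Finset.sum_nbij' (fun d => d / 2) (fun m => 2 * m) ?_ ?_ ?_ ?_ ?_
  · intro a ha; simp only [Finset.mem_filter, Finset.mem_Icc] at ha ⊢; omega
  · intro a ha; simp only [Finset.mem_filter, Finset.mem_Icc] at ha ⊢; omega
  · intro a ha; simp only [Finset.mem_filter, Finset.mem_Icc] at ha ⊢; omega
  · intro a ha
    omega
  · intro a ha; rfl

lemma card_eq {X : ℝ} (hX : 0 ≤ X) : (Nat.card {d : ℕ | d ∈ Dmtwo ∧ (d : ℝ) ≤ X} : ℝ) =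
    SS (X / 2) + (SS X - GG X) / 2 := by
  classical
  have hs : {d : ℕ | d ∈ Dmtwo ∧ (d : ℝ) ≤ X} = (((Icc 1 ⌊X⌋₊).filter (· ∈ Dmtwo) : Finset ℕ) : Set ℕ) := by
    ext d
    simp only [Set.mem_setOf_eq, Finset.coe_filter, Finset.mem_Icc, Nat.le_floor_iff hX]
    constructor
    · rintro ⟨h1, h2⟩
      have : 1 < d := h1.1
      exact ⟨⟨by omega, h2⟩, h1⟩
    · rintro ⟨⟨_, h2⟩, h1⟩; exact ⟨h1, h2⟩
  rw [hs, Nat.card_coe_set_eq, Set.ncard_coe_finset, Finset.card_filter]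
  push_cast
  have hfl : ⌊X / 2⌋₊ = ⌊X⌋₊ / 2 := Nat.floor_div_ofNat X 2
  unfold SS GG
  rw [hfl, ← sum_even, ← Finset.sum_sub_distrib, Finset.sum_div, ← Finset.sum_add_distrib]
  refine Finset.sum_congr rfl fun d hd => ?_
  rw [← ind_eq (Finset.mem_Icc.mp hd).1]

/-- Effect of halving on the logarithm. -/
lemma half_log {l : ℝ} (hl : 2 * Real.log 2 ≤ l) :
    |(l - Real.log 2) ^ (-(1/2) : ℝ) - l ^ (-(1/2) : ℝ)| ≤ 2 * l ^ (-(3/2) : ℝ) ∧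
    (l - Real.log 2) ^ (-(3/2) : ℝ) ≤ 4 * l ^ (-(3/2) : ℝ) := by
  have h2 : 0 < Real.log 2 := Real.log_pos (by norm_num)
  have h2' : Real.log 2 < 1 := by linarith [Real.log_two_lt_d9]
  have hl0 : 0 < l := by linarith
  set k := l - Real.log 2 with hk
  have hk0 : 0 < k := by linarith
  have hkl : l ≤ 2 * k := by linarith
  have e1 : ∀ y : ℝ, 0 < y → y ^ (-(1/2) : ℝ) = 1 / √y := fun y hy => by
    rw [Real.rpow_neg hy.le, ← Real.sqrt_eq_rpow, one_div]
  rw [rp32 hk0, rp32 hl0, e1 k hk0, e1 l hl0]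
  have sk := Real.sqrt_pos.mpr hk0
  have sl := Real.sqrt_pos.mpr hl0
  have qk := Real.sq_sqrt hk0.le
  have ql := Real.sq_sqrt hl0.le
  have hkl' : √k ≤ √l := Real.sqrt_le_sqrt (by linarith)
  have hlk : √l ≤ 2 * √k := by
    apply Real.sqrt_le_iff.mpr
    constructor
    · positivity
    · rw [mul_pow, qk]; linarith
  constructor
  · rw [abs_of_nonneg (sub_nonneg.mpr (one_div_le_one_div_of_le sk hkl'))]
    have hd : (√l - √k) * (√l + √k) = Real.log 2 := by
      have : l - k = Real.log 2 := by rw [hk]; ring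
      nlinarith
    rw [div_sub_div _ _ sk.ne' sl.ne', one_mul, mul_one, div_div, ← mul_div_assoc, mul_one,
      div_le_div_iff₀ (by positivity) (by positivity)]
    have h3 : (√l - √k) * √l ≤ 1 := by
      have : (√l - √k) * √l ≤ (√l - √k) * (√l + √k) :=
        mul_le_mul_of_nonneg_left (by linarith) (by linarith)
      linarith
    calc (√l - √k) * (√l * l) = ((√l - √k) * √l) * (√l * √l) := by nlinarith
      _ ≤ 1 * (√l * √l) := mul_le_mul_of_nonneg_right h3 (by positivity)
      _ ≤ 2 * (√k * √l) := by nlinarith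
  · rw [div_div, div_div, ← mul_div_assoc, mul_one, div_le_div_iff₀ (by positivity) (by positivity)]
    have := mul_le_mul hlk hkl hl0.le (by positivity)
    nlinarith

lemma final {c K : ℝ} (hK : 0 ≤ K) (h : ∀ x : ℝ, 2 ≤ x →
      |SS x - c * (x * Real.log x ^ (-(1/2) : ℝ))| ≤ K * (x * Real.log x ^ (-(3/2) : ℝ)) ∧
      |GG x| ≤ K * (x * Real.log x ^ (-(3/2) : ℝ))) {X : ℝ} (hX : 4 ≤ X) :
    |SS (X / 2) + (SS X - GG X) / 2 - c * (X * Real.log X ^ (-(1/2) : ℝ))| ≤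
      (3 * K + |c|) * (X * Real.log X ^ (-(3/2) : ℝ)) := by
  obtain ⟨a1, a2⟩ := h X (by linarith)
  obtain ⟨b1, -⟩ := h (X / 2) (by linarith)
  have hl : 2 * Real.log 2 ≤ Real.log X := by
    have := Real.log_le_log (by norm_num) hX
    rw [show (4:ℝ) = 2 ^ 2 by norm_num, Real.log_pow] at this
    simpa using this
  obtain ⟨c1, c2⟩ := half_log hl
  rw [Real.log_div (by linarith) (by norm_num)] at b1
  set A := (Real.log X - Real.log 2) ^ (-(1/2) : ℝ)
  set B := (Real.log X - Real.log 2) ^ (-(3/2) : ℝ)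
  set A' := Real.log X ^ (-(1/2) : ℝ)
  set B' := Real.log X ^ (-(3/2) : ℝ)
  have X0 : 0 < X := by linarith
  have e1 : K * (X / 2 * B) ≤ 2 * K * (X * B') := by
    have : K * (X / 2 * B) ≤ K * (X / 2 * (4 * B')) := by gcongr
    linarith
  have e2 : |c * (X / 2) * (A - A')| ≤ |c| * (X * B') := by
    rw [abs_mul, abs_mul, abs_of_pos (show 0 < X / 2 by linarith)]
    have : |c| * (X / 2) * |A - A'| ≤ |c| * (X / 2) * (2 * B') := by gcongr
    linarith
  rw [abs_le] at *
  constructor <;> nlinarith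

end Final
end LandauD

/-- `|D₋₂(X)| = (2Cm₂/3)·X/√(log X) + O(X/(log X)^{3/2})`, where
`Cm₂ = π^{-1/2} lim_{s→1⁺} √(s-1) ∏_{p ∈ P₋₂} (1 + p^{-s})` and `P₋₂` is the set of primes
`p` with `p = 2` or `(-2/p) = 1`. -/
theorem stmt8 (Cm₂ : ℝ)
    (hC : Tendsto
      (fun s : ℝ => Real.sqrt (s - 1) *
        ∏' p : {p : ℕ // p.Prime ∧ (p = 2 ∨ jacobiSym (-2) p = 1)}, (1 + (p.1 : ℝ) ^ (-s)))
      (nhdsWithin 1 (Set.Ioi 1)) (nhds (Real.sqrt Real.pi * Cm₂))) :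
    (fun X : ℝ =>
        (Nat.card {d : ℕ | d ∈ Dmtwo ∧ (d : ℝ) ≤ X} : ℝ) -
          (2 * Cm₂ / 3) * X / Real.sqrt (Real.log X))
      =O[atTop] fun X : ℝ => X / Real.log X ^ ((3 : ℝ) / 2) := by
  have hF := LandauD.FF_tendsto hC
  obtain ⟨c, K, hK, h⟩ := LandauD.SG_asymp hF
  have hc := LandauD.const_eq (fun x hx => (h x hx).1) hF
  have hpi : 0 < Real.sqrt Real.pi := Real.sqrt_pos.mpr Real.pi_pos
  have hc' : 2 * Cm₂ / 3 = c := by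
    apply mul_right_cancel₀ hpi.ne'
    rw [← hc]; ring
  refine IsBigO.of_bound (3 * K + |c|) ?_
  filter_upwards [eventually_ge_atTop 4] with X hX
  have hl : 0 < Real.log X := Real.log_pos (by linarith)
  have hf := LandauD.final hK h hX
  rw [Real.rpow_neg hl.le, Real.rpow_neg hl.le, ← Real.sqrt_eq_rpow, ← div_eq_mul_inv,
    ← div_eq_mul_inv, ← mul_div_assoc] at hf
  rw [LandauD.card_eq (by linarith), hc', Real.norm_eq_abs, Real.norm_of_nonneg (by positivity)]
  exact hf
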